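/- Assume d ≥ 7. For two independent simple random walks on Z^d with ranges R_∞ and R̃_∞, define Γ(A,B) := Σ_{x∈A} Σ_{y∈B} G(y−x) P_y(H_B^+ = ∞). Then there exist constants c₁, c₂ > 0 such that for all sufficiently large t, exp(−c₁ t^{1−2/(d−2)}) ≤ P(Γ(R̃_∞, R_∞) > t) ≤ exp(−c₂ t^{1−2/(d−2)}). -/

import Mathlib

open Filter Finset MeasureTheory
open scoped symmDiff ENNReal

namespace SRW

/-- Vertices of `ℤ^d`. -/
abbrev V (d : ℕ) : Type := Fin d → ℤ

/-- The set of nearest-neighbor steps (the `2d` unit vectors `±e_i`) in `ℤ^d`. -/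
def steps (d : ℕ) : Finset (V d) :=
  (Finset.univ : Finset (Fin d × Bool)).image
    (fun p j => if j = p.1 then (if p.2 then 1 else -1) else 0)

/-- Position at time `k` of the walk started at `x` with step sequence `s`. -/
def pos {d : ℕ} (x : V d) (s : ℕ → V d) (k : ℕ) : V d :=
  x + ∑ i ∈ Finset.range k, s i

open Classical in
/-- Probability, for the simple random walk, of an event depending on the
first `n` steps (steps beyond `n` are set to `0`): each of the `(2d)^n`
admissible step sequences has equal probability. -/
noncomputable def probN (d n : ℕ) (P : (ℕ → V d) → Prop) : ℝ :=
  (((Fintype.piFinset fun _ : Fin n => steps d).filter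
      (fun s => P fun i => if h : i < n then s ⟨i, h⟩ else 0)).card : ℝ) / ((2 * d : ℕ) : ℝ) ^ n

/-- Expectation of a functional of the first `n` steps of the walk. -/
noncomputable def expN (d n : ℕ) (f : (ℕ → V d) → ℝ) : ℝ :=
  (∑ s ∈ Fintype.piFinset fun _ : Fin n => steps d,
      f fun i => if h : i < n then s ⟨i, h⟩ else 0) / ((2 * d : ℕ) : ℝ) ^ n

/-- Escape probability `P_x(H_A^+ = ∞)`: the walk started at `x` never
hits `A` at a positive time (decreasing limit of the finite-horizon events). -/
noncomputable def esc (d : ℕ) (A : Set (V d)) (x : V d) : ℝ :=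
  ⨅ n : ℕ, probN d n (fun s => ∀ k, 1 ≤ k → k ≤ n → pos x s k ∉ A)

/-- Newtonian capacity `Cap(A) = Σ_{x∈A} P_x(H_A^+ = ∞)`. -/
noncomputable def cap {d : ℕ} (A : Finset (V d)) : ℝ :=
  ∑ x ∈ A, esc d (↑A) x

/-- Green's function `G(z) = Σ_n P_0(S_n = z)`. -/
noncomputable def G (d : ℕ) (z : V d) : ℝ :=
  ∑' n : ℕ, probN d n (fun s => pos 0 s n = z)

/-- Truncated Green's function `G_T(z) = Σ_{n≤T} P_0(S_n = z)`. -/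
noncomputable def GT (d T : ℕ) (z : V d) : ℝ :=
  ∑ n ∈ Finset.range (T + 1), probN d n (fun s => pos 0 s n = z)

/-- Convolution `(G ⋆ G_T)(x) = Σ_y G(x-y) G_T(y)`. -/
noncomputable def GconvGT (d T : ℕ) (x : V d) : ℝ :=
  ∑' y : V d, G d (x - y) * GT d T y

/-- Euclidean norm on `ℤ^d`. -/
noncomputable def nrm {d : ℕ} (x : V d) : ℝ :=
  Real.sqrt (∑ i, ((x i : ℝ)) ^ 2)

/-- The range `{S_k : k ∈ I}` of the walk started at `x` over the set of times `I`. -/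
noncomputable def rangeOn {d : ℕ} (x : V d) (s : ℕ → V d) (I : Finset ℕ) : Finset (V d) :=
  I.image (pos x s)

/-- Probability that the walk started at `z` hits both `A` and `B` in finite time
(increasing limit of the finite-horizon probabilities). -/
noncomputable def hitBothProb (d : ℕ) (A B : Finset (V d)) (z : V d) : ℝ :=
  ⨆ n : ℕ, probN d n (fun s => (∃ k ≤ n, pos z s k ∈ A) ∧ (∃ k ≤ n, pos z s k ∈ B))

/-- The discrete cube `Q(x,r) = [x - r/2, x + r/2)^d ∩ ℤ^d`. -/
def cube {d : ℕ} (x : V d) (r : ℝ) : Set (V d) :=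
  {y | ∀ i, (x i : ℝ) - r / 2 ≤ (y i : ℝ) ∧ (y i : ℝ) < (x i : ℝ) + r / 2}

/-- The corrector `ξ_n(T)`. -/
noncomputable def xi (d n T : ℕ) (s : ℕ → V d) : ℝ :=
  ∑ k ∈ Finset.range (n + 1), ∑ x ∈ rangeOn 0 s (Finset.Icc 0 k),
    esc d (↑(rangeOn 0 s (Finset.Icc 0 k))) x * (GconvGT d T (x - pos 0 s k) / T)

/-- The capacity cross-term `χ_C(A,B) = Cap(A) + Cap(B) - Cap(A ∪ B)`. -/
noncomputable def chiC {d : ℕ} (A B : Finset (V d)) : ℝ := cap A + cap B - cap (A ∪ B)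

open Classical in
/-- Conditional expectation, given the first `m` steps (equal to those of `s`),
of a functional of the first `n` steps. -/
noncomputable def condExpN (d n m : ℕ) (f : (ℕ → V d) → ℝ) (s : ℕ → V d) : ℝ :=
  expN d n (fun s' => if ∀ i < m, s' i = s i then f s' else 0) * ((2 * d : ℕ) : ℝ) ^ m

/-- The compensator `ξ_n^*(T)`. -/
noncomputable def xiStar (d n T : ℕ) (s : ℕ → V d) : ℝ :=
  (1 / (T : ℝ)) * ∑ j ∈ Finset.range T, ∑ l ∈ Finset.Icc 1 (n / T - 1),
    condExpN d (n + T) (j + l * T)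
      (fun s' => chiC (rangeOn 0 s' (Finset.Icc j (j + l * T)))
        (rangeOn 0 s' (Finset.Icc (j + l * T) (j + (l + 1) * T)))) s

/-- `E[Cap(R_n)]`, the expected capacity of the range up to time `n`. -/
noncomputable def expCapRange (d n : ℕ) : ℝ :=
  expN d n (fun s => cap (rangeOn 0 s (Finset.Icc 0 n)))

/-- The maximal capacity `c_n` of the range of a nearest-neighbor path with `n` steps. -/
noncomputable def maxPathCap (d n : ℕ) : ℝ :=
  sSup {y : ℝ | ∃ (x : V d) (s : ℕ → V d), (∀ i, s i ∈ steps d) ∧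
    y = cap (rangeOn x s (Finset.Icc 0 n))}

/-- `Γ(A,Λ) = Σ_{x∈A} Σ_{y∈Λ} G(y-x) P_y(H_Λ^+ = ∞)`. -/
noncomputable def GamFin (d : ℕ) (A : Finset (V d)) (Λ : Set (V d)) : ℝ :=
  ∑ x ∈ A, ∑' y : Λ, G d ((y : V d) - x) * esc d Λ (y : V d)

/-- `P(Γ(R̃_∞, Λ) > t)`, as the increasing limit of the finite-horizon probabilities. -/
noncomputable def PGam (d : ℕ) (Λ : Set (V d)) (t : ℝ) : ℝ :=
  ⨆ N : ℕ, probN d N (fun s => t < GamFin d (rangeOn 0 s (Finset.Icc 0 N)) Λ)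

/-- `E_x[Γ(R̃_∞, Λ)]`, as the increasing limit of the finite-horizon expectations. -/
noncomputable def EGam (d : ℕ) (x : V d) (Λ : Set (V d)) : ℝ :=
  ⨆ N : ℕ, expN d N (fun s => GamFin d (rangeOn x s (Finset.Icc 0 N)) Λ)

/-- The law of the first `n` steps of two independent simple random walks:
uniform measure on pairs of admissible step sequences of length `n`. -/
noncomputable def pairLevel (d n : ℕ) : Measure ((Fin n → V d) × (Fin n → V d)) :=
  (((2 * d : ℕ) : ℝ≥0∞) ^ (2 * n))⁻¹ •
    ∑ a ∈ Fintype.piFinset fun _ : Fin n => steps d,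
      ∑ b ∈ Fintype.piFinset fun _ : Fin n => steps d, Measure.dirac (a, b)

open Classical in
/-- `Γ(R̃_∞, R_∞) = Σ_{x ∈ R̃_∞} Σ_{y ∈ R_∞} G(y-x) P_y(H_{R_∞}^+ = ∞)` for
two (step sequences of) walks, with values in `ℝ≥0∞`. -/
noncomputable def gammaInf (d : ℕ) (sA sB : ℕ → V d) : ℝ≥0∞ :=
  ∑' x : V d, ∑' y : V d,
    if x ∈ Set.range (pos (0 : V d) sA) ∧ y ∈ Set.range (pos (0 : V d) sB) then
      ENNReal.ofReal (G d (y - x) * esc d (Set.range (pos (0 : V d) sB)) y)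
    else 0

section Averaging

variable {d : ℕ}

/-- The unit step in direction `i`, positively oriented iff `b`. -/
def unitStep (p : Fin d × Bool) : V d :=
  fun j => if j = p.1 then (if p.2 then 1 else -1) else 0

lemma unitStep_injective : Function.Injective (unitStep (d := d)) := by
  rintro ⟨i, b⟩ ⟨j, c⟩ h
  have hi := congrFun h i
  have hij : i = j := by
    by_contra hne
    simp only [unitStep, if_true, hne, if_false] at hi
    split_ifs at hi <;> omega
  subst hij
  simp only [unitStep, if_true] at hi
  cases b <;> cases c <;> simp at hi ⊢

lemma steps_eq : steps d = (Finset.univ : Finset (Fin d × Bool)).image unitStep := rfl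

lemma sum_steps {M : Type*} [AddCommMonoid M] (f : V d → M) :
    ∑ e ∈ steps d, f e = ∑ i : Fin d, (f (unitStep (i, true)) + f (unitStep (i, false))) := by
  rw [steps_eq, Finset.sum_image (fun _ _ _ _ h => unitStep_injective h), Fintype.sum_prod_type]
  simp

lemma card_steps : (steps d).card = 2 * d := by
  rw [steps_eq, Finset.card_image_of_injective _ unitStep_injective]
  simp [mul_comm]

lemma neg_unitStep (i : Fin d) (b : Bool) : -unitStep (i, b) = unitStep (i, !b) := by
  funext j
  simp only [unitStep, Pi.neg_apply]
  cases b <;> simp <;> split_ifs <;> simp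

lemma sum_steps_neg {M : Type*} [AddCommMonoid M] (f : V d → M) :
    ∑ e ∈ steps d, f (-e) = ∑ e ∈ steps d, f e := by
  rw [sum_steps, sum_steps]
  refine Finset.sum_congr rfl fun i _ => ?_
  simp [neg_unitStep, add_comm]

/-- One-step averaging operator of the simple random walk. -/
noncomputable def avg (f : V d → ℝ≥0∞) (x : V d) : ℝ≥0∞ :=
  ((2 * d : ℕ) : ℝ≥0∞)⁻¹ * ∑ e ∈ steps d, f (x + e)

lemma avg_mono {f g : V d → ℝ≥0∞} (h : ∀ x, f x ≤ g x) (x : V d) : avg f x ≤ avg g x := by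
  unfold avg
  gcongr
  exact h _

lemma avg_add (f g : V d → ℝ≥0∞) : avg (fun x => f x + g x) = fun x => avg f x + avg g x := by
  funext x
  simp only [avg, Finset.sum_add_distrib, mul_add]

lemma avg_mul_left (c : ℝ≥0∞) (f : V d → ℝ≥0∞) : avg (fun x => c * f x) = fun x => c * avg f x := by
  funext x
  simp only [avg, ← Finset.mul_sum]
  ring

lemma avg_tsum {ι : Type*} (f : ι → V d → ℝ≥0∞) :
    avg (fun x => ∑' i, f i x) = fun x => ∑' i, avg (f i) x := by
  funext x
  simp only [avg, ENNReal.tsum_mul_left]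
  rw [Summable.tsum_finsetSum (fun _ _ => ENNReal.summable)]

lemma avg_const (hd : d ≠ 0) (c : ℝ≥0∞) : avg (fun _ : V d => c) = fun _ => c := by
  funext x
  have h : ((2 * d : ℕ) : ℝ≥0∞) ≠ 0 := by simpa using hd
  rw [avg, Finset.sum_const, card_steps, nsmul_eq_mul, ← mul_assoc,
    ENNReal.inv_mul_cancel h (ENNReal.natCast_ne_top _), one_mul]

lemma avg_comp_add (f : V d → ℝ≥0∞) (c : V d) :
    avg (fun x => f (x + c)) = fun x => avg f (x + c) := by
  funext x
  simp only [avg, add_right_comm]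

lemma avg_comp_neg (f : V d → ℝ≥0∞) : avg (fun x => f (-x)) = fun x => avg f (-x) := by
  funext x
  simp only [avg, neg_add]
  rw [sum_steps_neg (fun e => f (-x + e))]

lemma iter_avg_mono {f g : V d → ℝ≥0∞} (h : ∀ x, f x ≤ g x) (n : ℕ) (x : V d) :
    avg^[n] f x ≤ avg^[n] g x := by
  induction n generalizing x with
  | zero => exact h x
  | succ n ih =>
    rw [Function.iterate_succ_apply', Function.iterate_succ_apply']
    exact avg_mono ih x

lemma iter_avg_mul_left (c : ℝ≥0∞) (f : V d → ℝ≥0∞) (n : ℕ) :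
    avg^[n] (fun x => c * f x) = fun x => c * avg^[n] f x := by
  induction n with
  | zero => rfl
  | succ n ih => simp only [Function.iterate_succ_apply', ih, avg_mul_left]

lemma iter_avg_tsum {ι : Type*} (f : ι → V d → ℝ≥0∞) (n : ℕ) :
    avg^[n] (fun x => ∑' i, f i x) = fun x => ∑' i, avg^[n] (f i) x := by
  induction n with
  | zero => rfl
  | succ n ih => simp only [Function.iterate_succ_apply', ih, avg_tsum]

lemma iter_avg_sum {ι : Type*} (s : Finset ι) (f : ι → V d → ℝ≥0∞) (n : ℕ) :
    avg^[n] (fun x => ∑ i ∈ s, f i x) = fun x => ∑ i ∈ s, avg^[n] (f i) x := by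
  simp only [← Finset.tsum_subtype, iter_avg_tsum]

lemma iter_avg_const (hd : d ≠ 0) (c : ℝ≥0∞) (n : ℕ) :
    avg^[n] (fun _ : V d => c) = fun _ => c := by
  induction n with
  | zero => rfl
  | succ n ih => rw [Function.iterate_succ_apply', ih, avg_const hd]

lemma iter_avg_comp_add (f : V d → ℝ≥0∞) (c : V d) (n : ℕ) :
    avg^[n] (fun x => f (x + c)) = fun x => avg^[n] f (x + c) := by
  induction n with
  | zero => rfl
  | succ n ih => simp only [Function.iterate_succ_apply', ih, avg_comp_add]

lemma iter_avg_comp_neg (f : V d → ℝ≥0∞) (n : ℕ) :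
    avg^[n] (fun x => f (-x)) = fun x => avg^[n] f (-x) := by
  induction n with
  | zero => rfl
  | succ n ih => simp only [Function.iterate_succ_apply', ih, avg_comp_neg]

/-- Heat kernel `P_0(S_n = z)`. -/
noncomputable def hk (n : ℕ) (z : V d) : ℝ≥0∞ := avg^[n] (Pi.single 0 1 : V d → ℝ≥0∞) z

lemma hk_zero (z : V d) : hk 0 z = if z = 0 then 1 else 0 := by
  simp [hk, Pi.single_apply]

lemma hk_succ (n : ℕ) : hk (n + 1) = avg (hk n : V d → ℝ≥0∞) := by
  funext z
  rw [hk, Function.iterate_succ_apply']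
  rfl

lemma hk_neg (n : ℕ) (z : V d) : hk n (-z) = hk n z := by
  have h := congrFun (iter_avg_comp_neg (Pi.single 0 1 : V d → ℝ≥0∞) n) z
  rw [hk, ← h, hk]
  refine congrArg (fun g => avg^[n] g z) (funext fun x => ?_)
  simp [Pi.single_apply]

lemma hk_sub_comm (n : ℕ) (x y : V d) : hk n (x - y) = hk n (y - x) := by
  rw [← hk_neg, neg_sub]

lemma iter_avg_single (n : ℕ) (x y : V d) :
    avg^[n] (fun z => if z = y then 1 else 0) x = hk n (y - x) := by
  have h := congrFun (iter_avg_comp_add (Pi.single 0 1 : V d → ℝ≥0∞) (-y) n) x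
  rw [hk_sub_comm, hk, sub_eq_add_neg, ← h]
  refine congrArg (fun g => avg^[n] g x) (funext fun z => ?_)
  simp [Pi.single_apply, add_neg_eq_zero]

lemma iter_avg_eq_tsum (n : ℕ) (f : V d → ℝ≥0∞) (x : V d) :
    avg^[n] f x = ∑' y, hk n (y - x) * f y := by
  have h : f = fun z => ∑' y, f y * (if z = y then 1 else 0) := by
    funext z
    rw [tsum_eq_single z]
    · simp
    · intro y hy
      simp [hy.symm]
  conv_lhs => rw [h]
  rw [iter_avg_tsum]
  refine tsum_congr fun y => ?_
  rw [iter_avg_mul_left]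
  beta_reduce
  rw [iter_avg_single, mul_comm]

lemma iter_avg_hk (m n : ℕ) : avg^[m] (hk n) = (hk (m + n) : V d → ℝ≥0∞) := by
  funext z
  simp only [hk, Function.iterate_add_apply]
  rfl

lemma iter_avg_hk_sub (m n : ℕ) (x y : V d) :
    avg^[m] (fun z => hk n (y - z)) x = hk (m + n) (y - x) := by
  have h := congrFun (iter_avg_comp_add (hk n : V d → ℝ≥0∞) (-y) m) x
  rw [hk_sub_comm (m + n), ← iter_avg_hk, sub_eq_add_neg, ← h]
  refine congrArg (fun g => avg^[m] g x) (funext fun z => ?_)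
  rw [hk_sub_comm, sub_eq_add_neg]

lemma tsum_hk (hd : d ≠ 0) (n : ℕ) (x : V d) : ∑' y, hk n (y - x) = 1 := by
  have := iter_avg_eq_tsum n (fun _ => (1 : ℝ≥0∞)) x
  rw [iter_avg_const hd] at this
  simpa using this.symm

lemma hk_le_one (hd : d ≠ 0) (n : ℕ) (z : V d) : hk n z ≤ 1 := by
  have h := ENNReal.le_tsum (f := fun y => hk n (y - 0)) z
  rw [tsum_hk hd n 0] at h
  simpa using h

lemma hk_ne_top (hd : d ≠ 0) (n : ℕ) (z : V d) : hk n z ≠ ∞ :=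
  ne_top_of_le_ne_top ENNReal.one_ne_top (hk_le_one hd n z)

/-- Green's function with values in `ℝ≥0∞`. -/
noncomputable def gr (z : V d) : ℝ≥0∞ := ∑' n, hk n z

/-- Green's operator. -/
noncomputable def green (f : V d → ℝ≥0∞) (x : V d) : ℝ≥0∞ := ∑' n, avg^[n] f x

lemma gr_sub_comm (x y : V d) : gr (x - y) = gr (y - x) := by
  simp only [gr, hk_sub_comm _ x y]

lemma green_eq_tsum (f : V d → ℝ≥0∞) (x : V d) : green f x = ∑' y, gr (y - x) * f y := by
  simp only [green, iter_avg_eq_tsum, gr, ← ENNReal.tsum_mul_right]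
  rw [ENNReal.tsum_comm]

lemma green_eq_add (f : V d → ℝ≥0∞) (x : V d) : green f x = f x + avg (green f) x := by
  have h : avg (green f) x = ∑' n, avg^[n + 1] f x := by
    have := congrFun (avg_tsum (fun n => avg^[n] f)) x
    simp only [Function.iterate_succ_apply']
    exact this
  rw [h, green, tsum_eq_zero_add' ENNReal.summable]
  rfl

lemma green_mono {f g : V d → ℝ≥0∞} (h : ∀ x, f x ≤ g x) (x : V d) : green f x ≤ green g x :=
  ENNReal.tsum_le_tsum fun n => iter_avg_mono h n x

lemma gr_eq_add (z : V d) : gr z = (if z = 0 then 1 else 0) + avg gr z := by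
  have h : avg gr z = ∑' n, hk (n + 1) z := by
    have := congrFun (avg_tsum (fun n => (hk n : V d → ℝ≥0∞))) z
    simp only [hk_succ]
    exact this
  rw [h, gr, tsum_eq_zero_add' ENNReal.summable, hk_zero]

end Averaging

section HeatKernel

open Real

variable {d : ℕ}

/-- Lebesgue measure on a period of the circle. -/
noncomputable def circ : Measure ℝ := volume.restrict (Set.Ioc (-(π / 2)) (3 * π / 2))

instance : IsFiniteMeasure circ := by
  unfold circ
  infer_instance

/-- Characteristic function of a step of the walk. -/
noncomputable def charFn (θ : Fin d → ℝ) : ℝ := (∑ i, cos (θ i)) / d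

/-- Fourier integral representing the heat kernel. -/
noncomputable def fourierInt (n : ℕ) (z : V d) : ℝ :=
  ∫ θ : Fin d → ℝ, charFn θ ^ n * cos (∑ i, θ i * z i) ∂(Measure.pi fun _ => circ)

lemma abs_charFn_le (θ : Fin d → ℝ) : |charFn θ| ≤ 1 := by
  unfold charFn
  rcases Nat.eq_zero_or_pos d with rfl | hd
  · simp
  have hd' : (0 : ℝ) < d := by exact_mod_cast hd
  rw [abs_div, abs_of_pos hd', div_le_one hd']
  calc |∑ i, cos (θ i)| ≤ ∑ i : Fin d, |cos (θ i)| := Finset.abs_sum_le_sum_abs _ _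
    _ ≤ ∑ i : Fin d, (1 : ℝ) := Finset.sum_le_sum fun i _ => abs_cos_le_one _
    _ = d := by simp

lemma measurable_charFn : Measurable (charFn : (Fin d → ℝ) → ℝ) := by
  unfold charFn
  fun_prop

lemma integrable_fourier (n : ℕ) (z : V d) :
    Integrable (fun θ : Fin d → ℝ => charFn θ ^ n * cos (∑ i, θ i * z i))
      (Measure.pi fun _ => circ) := by
  refine Integrable.of_bound (C := 1) ?_ (Eventually.of_forall fun θ => ?_)
  · exact ((measurable_charFn.pow_const n).mul (by fun_prop)).aestronglyMeasurable
  · rw [norm_mul, norm_pow, Real.norm_eq_abs, Real.norm_eq_abs]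
    exact mul_le_one₀ (pow_le_one₀ (abs_nonneg _) (abs_charFn_le _)) (abs_nonneg _)
      (abs_cos_le_one _)

lemma sum_mul_unitStep (θ : Fin d → ℝ) (z : V d) (i : Fin d) (b : Bool) :
    ∑ j, θ j * ((z + unitStep (i, b)) j : ℤ) =
      ∑ j, θ j * z j + (if b then θ i else -θ i) := by
  have h : ∀ j, θ j * ((z + unitStep (i, b)) j : ℤ) =
      θ j * z j + if j = i then (if b then θ i else -θ i) else 0 := by
    intro j
    simp only [Pi.add_apply, unitStep, Int.cast_add, mul_add]
    by_cases hj : j = i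
    · subst hj
      cases b <;> simp
    · simp [hj]
  simp only [h, Finset.sum_add_distrib, Finset.sum_ite_eq', Finset.mem_univ, if_true]

lemma fourierInt_succ (hd : d ≠ 0) (n : ℕ) (z : V d) :
    fourierInt (n + 1) z = (2 * d : ℝ)⁻¹ * ∑ e ∈ steps d, fourierInt n (z + e) := by
  unfold fourierInt
  rw [← integral_finsetSum _ (fun e _ => integrable_fourier n (z + e)),
    ← integral_const_mul]
  refine integral_congr_ae (Eventually.of_forall fun θ => ?_)
  have hd' : (d : ℝ) ≠ 0 := by exact_mod_cast hd
  beta_reduce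
  rw [sum_steps, pow_succ]
  have h : ∀ i : Fin d, (charFn θ ^ n * cos (∑ j, θ j * ((z + unitStep (i, true)) j : ℤ)) +
      charFn θ ^ n * cos (∑ j, θ j * ((z + unitStep (i, false)) j : ℤ))) =
      2 * charFn θ ^ n * cos (∑ j, θ j * z j) * cos (θ i) := by
    intro i
    rw [sum_mul_unitStep, sum_mul_unitStep]
    simp only [if_true, Bool.false_eq_true, if_false, cos_add, cos_neg, sin_neg]
    ring
  simp only [h, ← Finset.mul_sum]
  have h2 : ∑ i, cos (θ i) = d * charFn θ := by
    unfold charFn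
    field_simp
  rw [h2]
  field_simp

lemma integral_exp_circ (k : ℤ) :
    ∫ x, Complex.exp (x * k * Complex.I) ∂circ = if k = 0 then (2 * π : ℂ) else 0 := by
  have hle : -(π / 2) ≤ 3 * π / 2 := by linarith [pi_pos]
  rw [circ, ← intervalIntegral.integral_of_le hle]
  split_ifs with hk
  · subst hk
    simp
    ring
  · have hc : (k * Complex.I : ℂ) ≠ 0 := by simp [hk]
    have h := integral_exp_mul_complex (a := -(π / 2)) (b := 3 * π / 2) hc
    have h' : ∀ x : ℝ, Complex.exp (x * k * Complex.I) = Complex.exp (k * Complex.I * x) := by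
      intro x
      congr 1
      ring
    simp only [h', h]
    rw [div_eq_zero_iff, sub_eq_zero]
    left
    rw [Complex.exp_eq_exp_iff_exists_int]
    refine ⟨k, ?_⟩
    push_cast
    ring

lemma fourierInt_zero (z : V d) : fourierInt 0 z = if z = 0 then (2 * π) ^ d else 0 := by
  have h : ∀ θ : Fin d → ℝ, charFn θ ^ 0 * cos (∑ i, θ i * z i) =
      RCLike.re (∏ i, Complex.exp (θ i * z i * Complex.I)) := by
    intro θ
    rw [← Complex.exp_sum, ← Finset.sum_mul, pow_zero, one_mul]
    have : (∑ i, (θ i : ℂ) * (z i : ℂ)) = ((∑ i, θ i * z i : ℝ) : ℂ) := by push_cast; rfl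
    rw [this]
    exact (Complex.exp_ofReal_mul_I_re _).symm
  unfold fourierInt
  simp only [h]
  have h_int : Integrable (fun θ : Fin d → ℝ => ∏ i, Complex.exp (θ i * z i * Complex.I))
      (Measure.pi fun _ => circ) := by
    refine Integrable.of_bound (C := 1) ?_ (Eventually.of_forall fun θ => ?_)
    · exact Continuous.aestronglyMeasurable (by fun_prop)
    · rw [norm_prod]
      refine le_of_eq (Finset.prod_eq_one fun i _ => ?_)
      have : (θ i * z i * Complex.I : ℂ) = ((θ i * z i : ℝ) : ℂ) * Complex.I := by push_cast; rfl
      rw [this, Complex.norm_exp_ofReal_mul_I]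
  rw [integral_re h_int]
  rw [integral_fintype_prod_eq_prod (𝕜 := ℂ) (fun i (x : ℝ) => Complex.exp (x * z i * Complex.I))]
  simp only [integral_exp_circ]
  split_ifs with hz
  · subst hz
    simp
    norm_cast
  · obtain ⟨i, hi⟩ := Function.ne_iff.mp hz
    rw [Finset.prod_eq_zero (Finset.mem_univ i) (by simpa using hi)]
    simp

lemma toReal_hk (hd : d ≠ 0) (n : ℕ) (z : V d) :
    (2 * π) ^ d * (hk n z).toReal = fourierInt n z := by
  induction n generalizing z with
  | zero =>
    rw [hk_zero, fourierInt_zero]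
    split_ifs <;> simp
  | succ n ih =>
    rw [fourierInt_succ hd, hk_succ, avg, ENNReal.toReal_mul, ENNReal.toReal_sum
      (fun e _ => hk_ne_top hd n _), mul_left_comm, Finset.mul_sum]
    simp only [ih]
    simp

lemma abs_charFn_le_exp (hd : d ≠ 0) (θ : Fin d → ℝ) :
    |charFn θ| ≤ exp (-(∑ i, sin (θ i) ^ 2) / (2 * d)) := by
  have hd' : (0 : ℝ) < d := by exact_mod_cast Nat.pos_of_ne_zero hd
  refine abs_le_of_sq_le_sq ?_ (exp_pos _).le
  rw [← exp_nat_mul]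
  have h1 : charFn θ ^ 2 ≤ (∑ i, cos (θ i) ^ 2) / d := by
    have := sq_sum_le_card_mul_sum_sq (s := (Finset.univ : Finset (Fin d)))
      (f := fun i => cos (θ i))
    simp only [Finset.card_univ, Fintype.card_fin] at this
    rw [charFn, div_pow, div_le_div_iff₀ (by positivity) hd']
    nlinarith
  have h2 : (∑ i, cos (θ i) ^ 2) / d = 1 - (∑ i, sin (θ i) ^ 2) / d := by
    simp only [cos_sq', Finset.sum_sub_distrib]
    simp
    field_simp
  have h3 := add_one_le_exp (-(∑ i, sin (θ i) ^ 2) / d)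
  have h4 : ((2 : ℕ) : ℝ) * (-(∑ i, sin (θ i) ^ 2) / (2 * d)) = -(∑ i, sin (θ i) ^ 2) / d := by
    push_cast
    field_simp
  rw [h4]
  rw [h2] at h1
  have h5 : -(∑ i, sin (θ i) ^ 2) / d = -((∑ i, sin (θ i) ^ 2) / d) := by ring
  linarith

lemma integral_exp_sin_sq_le {a : ℝ} (ha : 0 < a) :
    ∫ x, exp (-a * sin x ^ 2) ∂circ ≤ 2 * √(π ^ 3 / (4 * a)) := by
  have hle : -(π / 2) ≤ 3 * π / 2 := by linarith [pi_pos]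
  have hcont : Continuous fun x : ℝ => exp (-a * sin x ^ 2) := by fun_prop
  rw [circ, ← intervalIntegral.integral_of_le hle,
    ← intervalIntegral.integral_add_adjacent_intervals (b := π / 2)
      (hcont.intervalIntegrable _ _) (hcont.intervalIntegrable _ _)]
  have hshift : ∫ x in (π / 2)..(3 * π / 2), exp (-a * sin x ^ 2) =
      ∫ x in (-(π / 2))..(π / 2), exp (-a * sin x ^ 2) := by
    have := intervalIntegral.integral_comp_add_right (a := -(π / 2)) (b := π / 2)
      (fun x => exp (-a * sin x ^ 2)) π
    simp only [sin_add_pi, neg_sq] at this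
    rw [this]
    congr 1 <;> ring
  rw [hshift, ← two_mul]
  have hb : 0 < 4 * a / π ^ 2 := by positivity
  have hmain : ∫ x in (-(π / 2))..(π / 2), exp (-a * sin x ^ 2) ≤
      ∫ x : ℝ, exp (-(4 * a / π ^ 2) * x ^ 2) := by
    rw [intervalIntegral.integral_of_le (by linarith [pi_pos])]
    refine le_trans (setIntegral_mono_on (g := fun x => exp (-(4 * a / π ^ 2) * x ^ 2)) ?_ ?_
      measurableSet_Ioc ?_) ?_
    · exact (hcont.integrableOn_Ioc)
    · exact (integrable_exp_neg_mul_sq hb).integrableOn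
    · intro x hx
      have hx' : |x| ≤ π / 2 := abs_le.mpr ⟨hx.1.le, hx.2⟩
      have h1 := mul_abs_le_abs_sin hx'
      have h2 : (2 / π * |x|) ^ 2 ≤ |sin x| ^ 2 := by
        gcongr
      rw [mul_pow, sq_abs, sq_abs] at h2
      apply exp_le_exp.mpr
      have h3 : 4 * a / π ^ 2 * x ^ 2 = a * ((2 / π) ^ 2 * x ^ 2) := by ring
      nlinarith
    · exact setIntegral_le_integral (integrable_exp_neg_mul_sq hb)
        (Eventually.of_forall fun x => (exp_pos _).le)
  rw [integral_gaussian] at hmain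
  have h4 : π / (4 * a / π ^ 2) = π ^ 3 / (4 * a) := by field_simp
  rw [h4] at hmain
  linarith

lemma fourierInt_le (hd : d ≠ 0) {n : ℕ} (hn : n ≠ 0) (z : V d) :
    fourierInt n z ≤ (2 * √(π ^ 3 / (4 * (n / (2 * d))))) ^ d := by
  have hd' : (0 : ℝ) < d := by exact_mod_cast Nat.pos_of_ne_zero hd
  have hn' : (0 : ℝ) < n := by exact_mod_cast Nat.pos_of_ne_zero hn
  have ha : (0 : ℝ) < n / (2 * d) := by positivity
  have hprod : ∀ θ : Fin d → ℝ, ∏ i, exp (-(n / (2 * d) : ℝ) * sin (θ i) ^ 2) =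
      exp (-(∑ i, sin (θ i) ^ 2) / (2 * d)) ^ n := by
    intro θ
    rw [← exp_sum, ← exp_nat_mul, ← Finset.mul_sum]
    congr 1
    field_simp
  calc fourierInt n z
      ≤ ∫ θ : Fin d → ℝ, ∏ i, exp (-(n / (2 * d) : ℝ) * sin (θ i) ^ 2)
          ∂(Measure.pi fun _ => circ) := by
        refine integral_mono (integrable_fourier n z) ?_ fun θ => ?_
        · refine Integrable.of_bound (C := 1) ?_ (Eventually.of_forall fun θ => ?_)
          · exact Continuous.aestronglyMeasurable (by fun_prop)
          · rw [norm_prod]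
            refine Finset.prod_le_one (fun _ _ => norm_nonneg _) fun i _ => ?_
            rw [norm_eq_abs, abs_of_pos (exp_pos _)]
            refine exp_le_one_iff.mpr ?_
            have := sq_nonneg (sin (θ i))
            nlinarith
        · beta_reduce
          rw [hprod]
          calc charFn θ ^ n * cos (∑ i, θ i * z i)
              ≤ |charFn θ ^ n * cos (∑ i, θ i * z i)| := le_abs_self _
            _ = |charFn θ| ^ n * |cos (∑ i, θ i * z i)| := by rw [abs_mul, abs_pow]
            _ ≤ |charFn θ| ^ n * 1 := by
                gcongr
                exact abs_cos_le_one _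
            _ ≤ _ := by
                rw [mul_one]
                gcongr
                exact abs_charFn_le_exp hd θ
    _ = (∫ x, exp (-(n / (2 * d) : ℝ) * sin x ^ 2) ∂circ) ^ d := by
        have := integral_fintype_prod_eq_pow (𝕜 := ℝ) (ι := Fin d) (μ := circ)
          (fun x : ℝ => exp (-(n / (2 * d) : ℝ) * sin x ^ 2))
        rw [Fintype.card_fin] at this
        exact this
    _ ≤ _ := by
        refine pow_le_pow_left₀ (integral_nonneg fun x => (exp_pos _).le) ?_ _
        exact integral_exp_sin_sq_le ha

lemma exists_hk_le (hd : d ≠ 0) : ∃ C : ℝ, 0 < C ∧ ∀ (n : ℕ) (z : V d), n ≠ 0 →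
    hk n z ≤ ENNReal.ofReal (C * (n : ℝ) ^ (-(d : ℝ) / 2)) := by
  have hd' : (0 : ℝ) < d := by exact_mod_cast Nat.pos_of_ne_zero hd
  refine ⟨(2 * √(π ^ 3 * d / 2)) ^ d / (2 * π) ^ d, by positivity, fun n z hn => ?_⟩
  have hn' : (0 : ℝ) < n := by exact_mod_cast Nat.pos_of_ne_zero hn
  rw [← ENNReal.ofReal_toReal (hk_ne_top hd n z)]
  refine ENNReal.ofReal_le_ofReal ?_
  have h := fourierInt_le hd hn z
  rw [← toReal_hk hd] at h
  have h2 : (2 * √(π ^ 3 / (4 * (n / (2 * d))))) ^ d =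
      (2 * √(π ^ 3 * d / 2)) ^ d * (n : ℝ) ^ (-(d : ℝ) / 2) := by
    have h3 : π ^ 3 / (4 * (n / (2 * d))) = (π ^ 3 * d / 2) * (n : ℝ)⁻¹ := by field_simp; norm_num
    have h4 : (n : ℝ) ^ (-(d : ℝ) / 2) = (√(n : ℝ)⁻¹) ^ d := by
      rw [sqrt_eq_rpow, ← rpow_natCast, ← rpow_mul (by positivity), inv_rpow (by positivity),
        ← rpow_neg (by positivity)]
      congr 1
      ring
    rw [h3, sqrt_mul (by positivity), h4, ← mul_assoc, mul_pow]
  rw [h2] at h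
  rw [div_mul_eq_mul_div, le_div_iff₀ (by positivity), mul_comm]
  exact h

end HeatKernel

section WalkLaw

variable {d : ℕ}

/-- The law of the first `n` steps of the simple random walk. -/
noncomputable def level (d n : ℕ) : Measure (Fin n → V d) :=
  (((2 * d : ℕ) : ℝ≥0∞) ^ n)⁻¹ • ∑ a ∈ Fintype.piFinset fun _ : Fin n => steps d, Measure.dirac a

lemma lintegral_level (n : ℕ) (F : (Fin n → V d) → ℝ≥0∞) :
    ∫⁻ a, F a ∂(level d n) = (((2 * d : ℕ) : ℝ≥0∞) ^ n)⁻¹ *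
      ∑ a ∈ Fintype.piFinset fun _ : Fin n => steps d, F a := by
  rw [level, lintegral_smul_measure, lintegral_finsetSum_measure, smul_eq_mul]
  congr 1
  exact Finset.sum_congr rfl fun a _ => lintegral_dirac a F

lemma lintegral_pairLevel (n : ℕ) (F : (Fin n → V d) × (Fin n → V d) → ℝ≥0∞) :
    ∫⁻ a, F a ∂(pairLevel d n) = ∫⁻ a, ∫⁻ b, F (a, b) ∂(level d n) ∂(level d n) := by
  simp only [lintegral_level]
  rw [pairLevel, lintegral_smul_measure, lintegral_finsetSum_measure, smul_eq_mul]
  rw [← Finset.mul_sum, ← mul_assoc, ← ENNReal.mul_inv, ← pow_add, ← two_mul n]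
  · simp only [lintegral_finsetSum_measure, lintegral_dirac]
  · exact Or.inr (ENNReal.pow_ne_top (ENNReal.natCast_ne_top _))
  · exact Or.inl (ENNReal.pow_ne_top (ENNReal.natCast_ne_top _))

lemma sum_piFinset_succ {α M : Type*} [DecidableEq α] [AddCommMonoid M] (S : Finset α) (n : ℕ)
    (f : (Fin (n + 1) → α) → M) :
    ∑ a ∈ Fintype.piFinset (fun _ : Fin (n + 1) => S), f a =
      ∑ e ∈ S, ∑ a ∈ Fintype.piFinset (fun _ : Fin n => S), f (Fin.cons e a) := by
  rw [← Finset.sum_product']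
  refine Finset.sum_bij' (fun a _ => (a 0, Fin.tail a)) (fun p _ => Fin.cons p.1 p.2) ?_ ?_ ?_ ?_ ?_
  · intro a ha
    rw [Fintype.mem_piFinset] at ha
    exact Finset.mem_product.2 ⟨ha 0, Fintype.mem_piFinset.2 fun i => ha i.succ⟩
  · intro p hp
    rw [Finset.mem_product] at hp
    refine Fintype.mem_piFinset.2 fun i => ?_
    refine Fin.cases ?_ (fun j => ?_) i
    · exact hp.1
    · exact Fintype.mem_piFinset.1 hp.2 j
  · intro a _
    exact Fin.cons_self_tail a
  · intro p _
    simp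
  · intro a _
    rw [Fin.cons_self_tail]

lemma lintegral_level_succ (n : ℕ) (F : (Fin (n + 1) → V d) → ℝ≥0∞) :
    ∫⁻ a, F a ∂(level d (n + 1)) = ((2 * d : ℕ) : ℝ≥0∞)⁻¹ *
      ∑ e ∈ steps d, ∫⁻ a, F (Fin.cons e a) ∂(level d n) := by
  simp only [lintegral_level, sum_piFinset_succ]
  rw [← Finset.mul_sum, ← mul_assoc, ← ENNReal.mul_inv, pow_succ']
  · exact Or.inr (ENNReal.pow_ne_top (ENNReal.natCast_ne_top _))
  · exact Or.inl (ENNReal.natCast_ne_top _)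

/-- Extend a finite step sequence by zeros. -/
def extend {n : ℕ} (a : Fin n → V d) : ℕ → V d := fun i => if h : i < n then a ⟨i, h⟩ else 0

/-- Prepend a step. -/
def cons (e : V d) (s : ℕ → V d) : ℕ → V d := fun i => Nat.casesOn i e s

lemma cons_zero (e : V d) (s : ℕ → V d) : cons e s 0 = e := rfl

lemma cons_succ (e : V d) (s : ℕ → V d) (i : ℕ) : cons e s (i + 1) = s i := rfl

lemma extend_cons {n : ℕ} (e : V d) (a : Fin n → V d) :
    extend (Fin.cons e a : Fin (n + 1) → V d) = cons e (extend a) := by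
  funext i
  cases i with
  | zero => simp [extend, cons]
  | succ i =>
    by_cases h : i < n
    · simp only [extend, cons, Nat.succ_lt_succ_iff, h, dif_pos]
      exact Fin.cons_succ (α := fun _ => V d) e a ⟨i, h⟩
    · simp [extend, cons, h]

lemma pos_zero (x : V d) (s : ℕ → V d) : pos x s 0 = x := by simp [pos]

lemma pos_cons_succ (x e : V d) (s : ℕ → V d) (k : ℕ) :
    pos x (cons e s) (k + 1) = pos (x + e) s k := by
  simp only [pos, Finset.sum_range_succ', cons_succ, cons_zero]
  abel

lemma toReal_lintegral_level_extend (n : ℕ) (P : (ℕ → V d) → Prop) [DecidablePred P] :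
    ∫⁻ a, (if P (extend a) then 1 else 0) ∂(level d n) = ENNReal.ofReal (probN d n P) ∨ d = 0 := by
  by_cases hd : d = 0
  · exact Or.inr hd
  left
  have hpos : (0 : ℝ) < ((2 * d : ℕ) : ℝ) ^ n := by positivity
  rw [lintegral_level, probN, ENNReal.ofReal_div_of_pos hpos, ENNReal.ofReal_natCast,
    ENNReal.ofReal_pow (by positivity), ENNReal.ofReal_natCast, mul_comm, ← div_eq_mul_inv]
  congr 1
  rw [Finset.card_filter]
  push_cast
  refine Finset.sum_congr rfl fun a _ => ?_
  unfold extend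
  congr

lemma ofReal_probN (hd : d ≠ 0) (n : ℕ) (P : (ℕ → V d) → Prop) [DecidablePred P] :
    ENNReal.ofReal (probN d n P) = ∫⁻ a, (if P (extend a) then 1 else 0) ∂(level d n) :=
  ((toReal_lintegral_level_extend n P).resolve_right hd).symm

lemma probN_nonneg (n : ℕ) (P : (ℕ → V d) → Prop) : 0 ≤ probN d n P := by
  unfold probN
  positivity

lemma ofReal_probN_zero (hd : d ≠ 0) (P : (ℕ → V d) → Prop) [DecidablePred P] :
    ENNReal.ofReal (probN d 0 P) = if P (fun _ => 0) then 1 else 0 := by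
  rw [ofReal_probN hd, lintegral_level]
  have h : ∀ a : Fin 0 → V d, extend a = fun _ => 0 := fun a => by
    funext i
    simp [extend]
  simp [h]

lemma ofReal_probN_succ (hd : d ≠ 0) (n : ℕ) (P : (ℕ → V d) → Prop) :
    ENNReal.ofReal (probN d (n + 1) P) = ((2 * d : ℕ) : ℝ≥0∞)⁻¹ *
      ∑ e ∈ steps d, ENNReal.ofReal (probN d n fun s => P (cons e s)) := by
  classical
  simp only [ofReal_probN hd, lintegral_level_succ, extend_cons]

lemma ofReal_probN_pos_eq (hd : d ≠ 0) (n : ℕ) (x z : V d) :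
    ENNReal.ofReal (probN d n fun s => pos x s n = z) = hk n (z - x) := by
  classical
  induction n generalizing x with
  | zero =>
    rw [ofReal_probN_zero hd, hk_zero, pos_zero]
    simp only [sub_eq_zero, eq_comm]
  | succ n ih =>
    rw [ofReal_probN_succ hd]
    simp only [pos_cons_succ, ih]
    have h := congrFun (iter_avg_comp_add (hk n : V d → ℝ≥0∞) (-z) 1) x
    simp only [Function.iterate_one, ← sub_eq_add_neg] at h
    rw [hk_sub_comm, hk_succ, ← h, avg]
    simp only [hk_sub_comm]

/-- Probability of avoiding `Λ` during the times `1, …, n`, started from `y`. -/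
noncomputable def noret (Λ : Set (V d)) : ℕ → V d → ℝ≥0∞
  | 0 => fun _ => 1
  | n + 1 => avg (Λᶜ.indicator (noret Λ n))

lemma ofReal_probN_noret (hd : d ≠ 0) (Λ : Set (V d)) (n : ℕ) (x : V d) :
    ENNReal.ofReal (probN d n fun s => ∀ k, 1 ≤ k → k ≤ n → pos x s k ∉ Λ) = noret Λ n x := by
  classical
  induction n generalizing x with
  | zero =>
    rw [ofReal_probN_zero hd, noret, if_pos]
    omega
  | succ n ih =>
    rw [ofReal_probN_succ hd, noret, avg]
    congr 1
    refine Finset.sum_congr rfl fun e _ => ?_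
    have h : ∀ s : ℕ → V d, (∀ k, 1 ≤ k → k ≤ n + 1 → pos x (cons e s) k ∉ Λ) ↔
        x + e ∉ Λ ∧ ∀ k, 1 ≤ k → k ≤ n → pos (x + e) s k ∉ Λ := by
      intro s
      constructor
      · intro h
        refine ⟨?_, fun k h1 h2 => ?_⟩
        · have := h 1 le_rfl (by omega)
          rwa [pos_cons_succ, pos_zero] at this
        · have := h (k + 1) (by omega) (by omega)
          rwa [pos_cons_succ] at this
      · rintro ⟨h0, h⟩ k h1 h2
        obtain ⟨k, rfl⟩ : ∃ j, k = j + 1 := ⟨k - 1, by omega⟩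
        rw [pos_cons_succ]
        rcases Nat.eq_zero_or_pos k with rfl | hk
        · rwa [pos_zero]
        · exact h k hk (by omega)
    simp only [h]
    by_cases hx : x + e ∈ Λ
    · simp [hx, probN]
    · rw [Set.indicator_of_mem (by exact hx), ← ih]
      simp only [hx, not_false_eq_true, true_and]

lemma noret_le_one (hd : d ≠ 0) (Λ : Set (V d)) (n : ℕ) (x : V d) : noret Λ n x ≤ 1 := by
  induction n generalizing x with
  | zero => exact le_rfl
  | succ n ih =>
    calc noret Λ (n + 1) x ≤ avg (fun _ => 1) x := by
          refine avg_mono (fun y => ?_) x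
          exact (Set.indicator_le_self _ _ y).trans (ih y)
      _ = 1 := by rw [avg_const hd]

/-- The escape probability with values in `ℝ≥0∞`. -/
noncomputable def escE (Λ : Set (V d)) (x : V d) : ℝ≥0∞ := ⨅ n, noret Λ n x

lemma ofReal_esc (hd : d ≠ 0) (Λ : Set (V d)) (x : V d) :
    ENNReal.ofReal (esc d Λ x) = escE Λ x := by
  have hne : ∀ n, noret Λ n x ≠ ∞ := fun n =>
    ne_top_of_le_ne_top ENNReal.one_ne_top (noret_le_one hd Λ n x)
  have h : esc d Λ x = (escE Λ x).toReal := by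
    rw [escE, ENNReal.toReal_iInf hne, esc]
    refine iInf_congr fun n => ?_
    rw [← ofReal_probN_noret hd, ENNReal.toReal_ofReal (probN_nonneg _ _)]
  rw [h, ENNReal.ofReal_toReal]
  exact ne_top_of_le_ne_top (hne 0) (iInf_le _ 0)

lemma ofReal_G (hd : d ≠ 0) (z : V d) (hz : gr z ≠ ∞) : ENNReal.ofReal (G d z) = gr z := by
  have h : G d z = (gr z).toReal := by
    rw [gr, ENNReal.tsum_toReal_eq (fun n => hk_ne_top hd n z), G]
    refine tsum_congr fun n => ?_
    have := ofReal_probN_pos_eq hd n 0 z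
    rw [sub_zero] at this
    rw [← this, ENNReal.toReal_ofReal (probN_nonneg _ _)]
  rw [h, ENNReal.ofReal_toReal hz]

lemma G_nonneg (z : V d) : 0 ≤ G d z := tsum_nonneg fun _ => probN_nonneg _ _

/-- The equilibrium measure of `Λ`. -/
noncomputable def equil (Λ : Set (V d)) : V d → ℝ≥0∞ := Λ.indicator (escE Λ)

lemma gammaInf_eq (hd : d ≠ 0) (hgr : ∀ z : V d, gr z ≠ ∞) (sA sB : ℕ → V d) :
    gammaInf d sA sB = ∑' x, (Set.range (pos (0 : V d) sA)).indicator
      (green (equil (Set.range (pos (0 : V d) sB)))) x := by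
  classical
  refine tsum_congr fun x => ?_
  by_cases hx : x ∈ Set.range (pos (0 : V d) sA)
  · rw [Set.indicator_of_mem hx, green_eq_tsum]
    refine tsum_congr fun y => ?_
    by_cases hy : y ∈ Set.range (pos (0 : V d) sB)
    · rw [if_pos ⟨hx, hy⟩, equil, Set.indicator_of_mem hy, ENNReal.ofReal_mul (G_nonneg _),
        ofReal_G hd _ (hgr _), ofReal_esc hd]
    · rw [if_neg (fun h => hy h.2), equil, Set.indicator_of_notMem hy, mul_zero]
  · rw [Set.indicator_of_notMem hx]
    simp [hx]

end WalkLaw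

section InfiniteWalk

variable {d : ℕ}

/-- The first `n` terms of a sequence. -/
def restr {α : Type*} (n : ℕ) (s : ℕ → α) : Fin n → α := fun i => s i

lemma measurable_restr {α : Type*} [MeasurableSpace α] (n : ℕ) :
    Measurable (restr n : (ℕ → α) → Fin n → α) :=
  measurable_pi_lambda _ fun _ => measurable_pi_apply _

/-- A finite measure is determined by its images under an increasing generating sequence of maps. -/
lemma ext_of_map_eq {X : Type*} [mX : MeasurableSpace X] {Y : ℕ → Type*}
    [mY : ∀ n, MeasurableSpace (Y n)] (r : ∀ n, X → Y n) (hr : ∀ n, Measurable (r n))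
    (hmono : ∀ m n, m ≤ n → ∃ g : Y n → Y m, Measurable g ∧ r m = g ∘ r n)
    (hgen : mX ≤ ⨆ n, MeasurableSpace.comap (r n) (mY n))
    (μ ν : Measure X) [IsFiniteMeasure μ] (h : ∀ n, μ.map (r n) = ν.map (r n)) : μ = ν := by
  have key : ∀ n, ∀ B, MeasurableSet B → μ (r n ⁻¹' B) = ν (r n ⁻¹' B) := fun n B hB => by
    rw [← Measure.map_apply (hr n) hB, ← Measure.map_apply (hr n) hB, h]
  refine ext_of_generate_finite {s | ∃ n, ∃ B, MeasurableSet B ∧ s = r n ⁻¹' B} ?_ ?_ ?_ ?_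
  · refine le_antisymm (hgen.trans (iSup_le fun n => ?_)) ?_
    · rintro _ ⟨B, hB, rfl⟩
      exact MeasurableSpace.measurableSet_generateFrom ⟨n, B, hB, rfl⟩
    · refine MeasurableSpace.generateFrom_le ?_
      rintro _ ⟨n, B, hB, rfl⟩
      exact hr n hB
  · rintro _ ⟨n, B, hB, rfl⟩ _ ⟨m, B', hB', rfl⟩ -
    obtain ⟨g, hg, hg'⟩ := hmono n (max n m) (le_max_left _ _)
    obtain ⟨g', hg₂, hg₂'⟩ := hmono m (max n m) (le_max_right _ _)
    refine ⟨max n m, g ⁻¹' B ∩ g' ⁻¹' B', (hg hB).inter (hg₂ hB'), ?_⟩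
    rw [hg', hg₂']
    rfl
  · rintro _ ⟨n, B, hB, rfl⟩
    exact key n B hB
  · simpa using key 0 Set.univ MeasurableSet.univ

lemma exists_restr_eq {α : Type*} [MeasurableSpace α] (m n : ℕ) (hmn : m ≤ n) :
    ∃ g : (Fin n → α) → Fin m → α, Measurable g ∧ (restr m : (ℕ → α) → _) = g ∘ restr n :=
  ⟨fun a i => a (Fin.castLE hmn i), measurable_pi_lambda _ fun _ => measurable_pi_apply _, rfl⟩

lemma pi_le_iSup_comap_restr {α : Type*} [m : MeasurableSpace α] :
    (MeasurableSpace.pi : MeasurableSpace (ℕ → α)) ≤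
      ⨆ n, MeasurableSpace.comap (restr n) MeasurableSpace.pi := by
  refine iSup_le fun i => ?_
  refine le_trans ?_ (le_iSup _ (i + 1))
  rintro _ ⟨B, hB, rfl⟩
  exact ⟨(fun a : Fin (i + 1) → α => a (Fin.last i)) ⁻¹' B, measurable_pi_apply _ hB, rfl⟩

/-- `ν` is the law of the step sequence of a simple random walk. -/
def IsWalk (ν : Measure (ℕ → V d)) : Prop := ∀ n, ν.map (restr n) = level d n

lemma IsWalk.eq {ν ν' : Measure (ℕ → V d)} [IsFiniteMeasure ν] (h : IsWalk ν) (h' : IsWalk ν') :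
    ν = ν' :=
  ext_of_map_eq _ measurable_restr exists_restr_eq pi_le_iSup_comap_restr _ _
    fun n => (h n).trans (h' n).symm

lemma level_univ (hd : d ≠ 0) (n : ℕ) : level d n Set.univ = 1 := by
  have h0 : ((2 * d : ℕ) : ℝ≥0∞) ≠ 0 := by simpa using hd
  rw [← lintegral_one, lintegral_level]
  simp only [Finset.sum_const, Fintype.card_piFinset, Finset.prod_const, card_steps,
    Finset.card_univ, Fintype.card_fin, nsmul_eq_mul, mul_one]
  rw [Nat.cast_pow]
  exact ENNReal.inv_mul_cancel (pow_ne_zero _ h0) (ENNReal.pow_ne_top (ENNReal.natCast_ne_top _))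

lemma isProbabilityMeasure_level (hd : d ≠ 0) (n : ℕ) : IsProbabilityMeasure (level d n) :=
  ⟨level_univ hd n⟩

lemma IsWalk.isProbabilityMeasure (hd : d ≠ 0) {ν : Measure (ℕ → V d)} (h : IsWalk ν) :
    IsProbabilityMeasure ν := by
  refine ⟨?_⟩
  have := level_univ hd 0
  rwa [← h 0, Measure.map_apply (measurable_restr 0) MeasurableSet.univ, Set.preimage_univ] at this

lemma pairLevel_eq_prod (hd : d ≠ 0) (n : ℕ) : pairLevel d n = (level d n).prod (level d n) := by
  have := isProbabilityMeasure_level hd n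
  refine Measure.ext_of_lintegral _ fun F hF => ?_
  rw [lintegral_pairLevel, lintegral_prod _ hF.aemeasurable]

lemma isWalk_fst (hd : d ≠ 0) {μ : Measure ((ℕ → V d) × (ℕ → V d))}
    (hμ : ∀ n, μ.map (Prod.map (restr n) (restr n)) = pairLevel d n) :
    IsWalk (μ.map Prod.fst) := by
  intro n
  have := isProbabilityMeasure_level hd n
  rw [Measure.map_map (measurable_restr n) measurable_fst]
  have h : (restr n ∘ Prod.fst : (ℕ → V d) × (ℕ → V d) → _) =
    Prod.fst ∘ Prod.map (restr n) (restr n) := rfl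
  rw [h, ← Measure.map_map measurable_fst ((measurable_restr n).prodMap (measurable_restr n)), hμ,
    pairLevel_eq_prod hd, Measure.map_fst_prod, measure_univ, one_smul]

lemma eq_prod (hd : d ≠ 0) {μ : Measure ((ℕ → V d) × (ℕ → V d))} [IsFiniteMeasure μ]
    (hμ : ∀ n, μ.map (Prod.map (restr n) (restr n)) = pairLevel d n) :
    μ = (μ.map Prod.fst).prod (μ.map Prod.fst) := by
  have hw := isWalk_fst hd hμ
  have := hw.isProbabilityMeasure hd
  refine ext_of_map_eq (fun n => Prod.map (restr n) (restr n))
    (fun n => (measurable_restr n).prodMap (measurable_restr n)) ?_ ?_ _ _ fun n => ?_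
  · intro m n hmn
    obtain ⟨g, hg, hg'⟩ := exists_restr_eq (α := V d) m n hmn
    exact ⟨Prod.map g g, hg.prodMap hg, by rw [hg', Prod.map_comp_map]⟩
  · refine sup_le ?_ ?_
    · refine (MeasurableSpace.comap_mono pi_le_iSup_comap_restr).trans ?_
      rw [MeasurableSpace.comap_iSup]
      refine iSup_mono fun n => ?_
      rw [MeasurableSpace.comap_comp]
      rintro _ ⟨B, hB, rfl⟩
      exact ⟨Prod.fst ⁻¹' B, measurable_fst hB, rfl⟩
    · refine (MeasurableSpace.comap_mono pi_le_iSup_comap_restr).trans ?_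
      rw [MeasurableSpace.comap_iSup]
      refine iSup_mono fun n => ?_
      rw [MeasurableSpace.comap_comp]
      rintro _ ⟨B, hB, rfl⟩
      exact ⟨Prod.snd ⁻¹' B, measurable_snd hB, rfl⟩
  · rw [hμ, ← Measure.map_prod_map _ _ (measurable_restr n) (measurable_restr n), hw n,
      pairLevel_eq_prod hd]

lemma measurable_cons (e : V d) : Measurable (cons e) := by
  refine measurable_pi_lambda _ fun i => ?_
  cases i with
  | zero => exact measurable_const
  | succ i => exact measurable_pi_apply i

lemma IsWalk.map_cons (hd : d ≠ 0) {ν : Measure (ℕ → V d)} (h : IsWalk ν) :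
    ν = ((2 * d : ℕ) : ℝ≥0∞)⁻¹ • ∑ e ∈ steps d, ν.map (cons e) := by
  have := h.isProbabilityMeasure hd
  refine h.eq fun n => ?_
  refine Measure.ext_of_lintegral _ fun F hF => ?_
  rw [lintegral_map hF (measurable_restr n), lintegral_smul_measure,
    lintegral_finsetSum_measure, smul_eq_mul]
  have h1 : ∀ e : V d, ∫⁻ s, F (restr n s) ∂(ν.map (cons e)) = ∫⁻ s, F (restr n (cons e s)) ∂ν :=
    fun e => lintegral_map (hF.comp (measurable_restr n)) (measurable_cons e)
  simp only [h1]
  cases n with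
  | zero =>
    have h2 : ∀ a : Fin 0 → V d, F a = F Fin.elim0 := fun a => by
      congr 1
      exact Subsingleton.elim _ _
    have h3 := congrFun (avg_const hd (F Fin.elim0)) (0 : V d)
    rw [avg] at h3
    have := isProbabilityMeasure_level hd 0
    simp only [h2, lintegral_const, measure_univ, mul_one]
    exact h3
  | succ n =>
    rw [lintegral_level_succ]
    congr 1
    refine Finset.sum_congr rfl fun e _ => ?_
    have h2 : ∀ s : ℕ → V d, restr (n + 1) (cons e s) = Fin.cons e (restr n s) := by
      intro s
      funext i
      refine Fin.cases rfl (fun j => rfl) i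
    simp only [h2]
    rw [← h n, lintegral_map (measurable_of_countable _) (measurable_restr n)]

lemma IsWalk.lintegral_cons (hd : d ≠ 0) {ν : Measure (ℕ → V d)} (h : IsWalk ν)
    {F : (ℕ → V d) → ℝ≥0∞} (hF : Measurable F) :
    ∫⁻ s, F s ∂ν = ((2 * d : ℕ) : ℝ≥0∞)⁻¹ * ∑ e ∈ steps d, ∫⁻ s, F (cons e s) ∂ν := by
  conv_lhs => rw [h.map_cons hd]
  rw [lintegral_smul_measure, lintegral_finsetSum_measure, smul_eq_mul]
  congr 1
  exact Finset.sum_congr rfl fun e _ => lintegral_map hF (measurable_cons e)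

/-- Follow the first step sequence for `m` steps and then the second one. -/
def concat (m : ℕ) (s s' : ℕ → V d) : ℕ → V d := fun i => if i < m then s i else s' (i - m)

lemma measurable_concat (m : ℕ) :
    Measurable (fun p : (ℕ → V d) × (ℕ → V d) => concat m p.1 p.2) := by
  refine measurable_pi_lambda _ fun i => ?_
  unfold concat
  split_ifs
  · exact (measurable_pi_apply i).comp measurable_fst
  · exact (measurable_pi_apply (i - m)).comp measurable_snd

lemma concat_succ_cons (m : ℕ) (e : V d) (s s' : ℕ → V d) :
    concat (m + 1) (cons e s) s' = cons e (concat m s s') := by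
  funext i
  cases i with
  | zero => simp [concat, cons]
  | succ i => simp [concat, cons]

lemma IsWalk.lintegral_concat (hd : d ≠ 0) {ν : Measure (ℕ → V d)} (h : IsWalk ν) (m : ℕ)
    {F : (ℕ → V d) → ℝ≥0∞} (hF : Measurable F) :
    ∫⁻ s, F s ∂ν = ∫⁻ s, ∫⁻ s', F (concat m s s') ∂ν ∂ν := by
  have := h.isProbabilityMeasure hd
  induction m generalizing F with
  | zero =>
    have h0 : ∀ s s' : ℕ → V d, concat 0 s s' = s' := fun s s' => by
      funext i
      simp [concat]
    simp [h0]
  | succ m ih =>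
    rw [h.lintegral_cons hd hF, h.lintegral_cons hd
      (Measurable.lintegral_prod_right' (f := fun p : (ℕ → V d) × (ℕ → V d) =>
        F (concat (m + 1) p.1 p.2)) (hF.comp (measurable_concat _)))]
    congr 1
    refine Finset.sum_congr rfl fun e _ => ?_
    simp only [concat_succ_cons]
    exact ih (hF.comp (measurable_cons e))

lemma measurable_pos (x : V d) (n : ℕ) : Measurable (fun s => pos x s n) := by
  unfold pos
  exact measurable_const.add (Finset.measurable_sum _ fun i _ => measurable_pi_apply i)

lemma IsWalk.lintegral_pos (hd : d ≠ 0) {ν : Measure (ℕ → V d)} (h : IsWalk ν)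
    (f : V d → ℝ≥0∞) (n : ℕ) (x : V d) : ∫⁻ s, f (pos x s n) ∂ν = avg^[n] f x := by
  have := h.isProbabilityMeasure hd
  induction n generalizing x with
  | zero => simp [pos_zero]
  | succ n ih =>
    rw [h.lintegral_cons hd (F := fun s => f (pos x s (n + 1)))
      ((measurable_of_countable f).comp (measurable_pos x _)),
      Function.iterate_succ_apply']
    simp only [pos_cons_succ, ih, avg]

lemma pos_concat_add (x : V d) (m k : ℕ) (s s' : ℕ → V d) :
    pos x (concat m s s') (m + k) = pos (pos x s m) s' k := by
  simp only [pos, Finset.sum_range_add, add_assoc]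
  congr 2
  · refine Finset.sum_congr rfl fun i hi => ?_
    simp [concat, Finset.mem_range.1 hi]
  · refine Finset.sum_congr rfl fun i _ => ?_
    simp [concat]

lemma pos_concat_of_le (x : V d) {m k : ℕ} (hk : k ≤ m) (s s' : ℕ → V d) :
    pos x (concat m s s') k = pos x s k := by
  simp only [pos]
  congr 1
  refine Finset.sum_congr rfl fun i hi => ?_
  have := Finset.mem_range.1 hi
  simp [concat, lt_of_lt_of_le this hk]

end InfiniteWalk

section Potential

variable {d : ℕ}

/-- Probability of hitting `Λ` during the times `0, …, n`, started from `x`. -/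
noncomputable def hit (Λ : Set (V d)) : ℕ → V d → ℝ≥0∞
  | 0 => Λ.indicator 1
  | n + 1 => fun x => Λ.indicator 1 x + Λᶜ.indicator (avg (hit Λ n)) x

lemma hit_of_mem {Λ : Set (V d)} {x : V d} (hx : x ∈ Λ) (n : ℕ) : hit Λ n x = 1 := by
  cases n <;> simp [hit, hx]

lemma hit_zero_of_notMem {Λ : Set (V d)} {x : V d} (hx : x ∉ Λ) : hit Λ 0 x = 0 := by
  simp [hit, hx]

lemma hit_succ_of_notMem {Λ : Set (V d)} {x : V d} (hx : x ∉ Λ) (n : ℕ) :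
    hit Λ (n + 1) x = avg (hit Λ n) x := by
  simp [hit, hx]

lemma hit_add_noret (hd : d ≠ 0) (Λ : Set (V d)) (n : ℕ) (x : V d) :
    hit Λ n x + Λᶜ.indicator (noret Λ n) x = 1 := by
  induction n generalizing x with
  | zero => by_cases hx : x ∈ Λ <;> simp [hit, noret, hx]
  | succ n ih =>
    by_cases hx : x ∈ Λ
    · simp [hit, hx]
    · rw [hit_succ_of_notMem hx, Set.indicator_of_mem (by exact hx), noret]
      have h := congrFun (avg_add (hit Λ n) (Λᶜ.indicator (noret Λ n))) x
      simp only [ih, avg_const hd] at h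
      exact h.symm

lemma hit_le_one (hd : d ≠ 0) (Λ : Set (V d)) (n : ℕ) (x : V d) : hit Λ n x ≤ 1 := by
  rw [← hit_add_noret hd Λ n x]
  exact le_self_add

lemma hit_mono_right (Λ : Set (V d)) (x : V d) : Monotone fun n => hit Λ n x := by
  refine monotone_nat_of_le_succ fun n => ?_
  induction n generalizing x with
  | zero =>
    by_cases hx : x ∈ Λ
    · simp [hit_of_mem hx]
    · simp [hit_zero_of_notMem hx]
  | succ n ih =>
    by_cases hx : x ∈ Λ
    · simp [hit_of_mem hx]
    · rw [hit_succ_of_notMem hx, hit_succ_of_notMem hx]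
      exact avg_mono ih x

lemma noret_succ_le (hd : d ≠ 0) (Λ : Set (V d)) (n : ℕ) (x : V d) :
    noret Λ (n + 1) x ≤ noret Λ n x := by
  induction n generalizing x with
  | zero => exact noret_le_one hd Λ 1 x
  | succ n ih =>
    rw [noret, noret]
    exact avg_mono (fun y => Set.indicator_le_indicator (ih y)) x

lemma noret_antitone (hd : d ≠ 0) (Λ : Set (V d)) (x : V d) : Antitone fun n => noret Λ n x :=
  antitone_nat_of_succ_le fun n => noret_succ_le hd Λ n x

lemma sum_iter_avg_noret (hd : d ≠ 0) (Λ : Set (V d)) (n : ℕ) (x : V d) :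
    ∑ k ∈ range (n + 1), avg^[k] (Λ.indicator (noret Λ (n - k))) x = hit Λ n x := by
  induction n generalizing x with
  | zero => simp [hit, noret]; rfl
  | succ n ih =>
    rw [Finset.sum_range_succ']
    have h1 : ∑ k ∈ range (n + 1), avg^[k + 1] (Λ.indicator (noret Λ (n + 1 - (k + 1)))) x =
        avg (hit Λ n) x := by
      have h : hit Λ n = fun x =>
          ∑ k ∈ range (n + 1), avg^[k] (Λ.indicator (noret Λ (n - k))) x :=
        funext fun x => (ih x).symm
      rw [h]
      have h2 := congrFun (iter_avg_sum (range (n + 1))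
        (fun k => avg^[k] (Λ.indicator (noret Λ (n - k)))) 1) x
      simp only [Function.iterate_one] at h2
      rw [h2]
      refine Finset.sum_congr rfl fun k _ => ?_
      rw [Function.iterate_succ_apply', Nat.add_sub_add_right]
    rw [h1]
    simp only [Function.iterate_zero, id, Nat.sub_zero]
    by_cases hx : x ∈ Λ
    · rw [hit_of_mem hx, Set.indicator_of_mem hx, noret]
      have h := congrFun (avg_add (hit Λ n) (Λᶜ.indicator (noret Λ n))) x
      simp only [hit_add_noret hd, avg_const hd] at h
      exact h.symm
    · rw [hit_succ_of_notMem hx, Set.indicator_of_notMem hx, add_zero]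

lemma green_equil_le_one (hd : d ≠ 0) (Λ : Set (V d)) (x : V d) : green (equil Λ) x ≤ 1 := by
  refine ENNReal.tsum_le_of_sum_range_le fun n => ?_
  calc ∑ k ∈ range n, avg^[k] (equil Λ) x
      ≤ ∑ k ∈ range (n + 1), avg^[k] (equil Λ) x :=
        Finset.sum_le_sum_of_subset (Finset.range_mono (Nat.le_succ n))
    _ ≤ ∑ k ∈ range (n + 1), avg^[k] (Λ.indicator (noret Λ (n - k))) x := by
        refine Finset.sum_le_sum fun k _ => iter_avg_mono (fun y => ?_) k x
        exact Set.indicator_le_indicator (iInf_le _ _)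
    _ ≤ 1 := by
        rw [sum_iter_avg_noret hd]
        exact hit_le_one hd Λ n x

lemma hit_le_green_equil (hd : d ≠ 0) (Λ : Set (V d)) (x : V d)
    (hx : green (Λ.indicator 1) x ≠ ∞) (n : ℕ) : hit Λ n x ≤ green (equil Λ) x := by
  let F : ℕ → ℕ × V d → ℝ≥0∞ := fun n p =>
    if p.1 ≤ n then hk p.1 (p.2 - x) * Λ.indicator (noret Λ (n - p.1)) p.2 else 0
  have hF : ∀ n, ∫⁻ p, F n p ∂Measure.count = hit Λ n x := by
    intro n
    rw [lintegral_count, ENNReal.tsum_prod', ← sum_iter_avg_noret hd]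
    rw [tsum_eq_sum (s := range (n + 1))]
    · refine Finset.sum_congr rfl fun k hk => ?_
      simp [F, Nat.lt_succ_iff.1 (Finset.mem_range.1 hk), iter_avg_eq_tsum]
    · intro k hk
      rw [Finset.mem_range, Nat.lt_succ_iff] at hk
      simp [F, hk]
  have hlim : Tendsto (fun n => ∫⁻ p, F n p ∂Measure.count) atTop
      (nhds (∫⁻ p : ℕ × V d, hk p.1 (p.2 - x) * equil Λ p.2 ∂Measure.count)) := by
    refine tendsto_lintegral_of_dominated_convergence
      (fun p => hk p.1 (p.2 - x) * Λ.indicator 1 p.2) (fun n => measurable_of_countable _)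
      (fun n => Eventually.of_forall fun p => ?_) ?_ (Eventually.of_forall fun p => ?_)
    · by_cases hp : p.1 ≤ n
      · simp only [F, hp, if_true]
        gcongr
        exact noret_le_one hd Λ _ _
      · simp [F, hp]
    · rw [lintegral_count, ENNReal.tsum_prod']
      simp only [← iter_avg_eq_tsum]
      exact hx
    · have h1 : Tendsto (fun n => hk p.1 (p.2 - x) * Λ.indicator (noret Λ (n - p.1)) p.2) atTop
          (nhds (hk p.1 (p.2 - x) * equil Λ p.2)) := by
        refine ENNReal.Tendsto.const_mul ?_ (Or.inr (hk_ne_top hd _ _))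
        by_cases hp : p.2 ∈ Λ
        · simp only [equil, Set.indicator_of_mem hp]
          exact (tendsto_atTop_iInf (noret_antitone hd Λ p.2)).comp (tendsto_sub_atTop_nat p.1)
        · simp only [equil, Set.indicator_of_notMem hp]
          exact tendsto_const_nhds
      refine h1.congr' ?_
      filter_upwards [eventually_ge_atTop p.1] with n hn
      simp [F, hn]
  have hgreen : ∫⁻ p : ℕ × V d, hk p.1 (p.2 - x) * equil Λ p.2 ∂Measure.count
      = green (equil Λ) x := by
    rw [lintegral_count, ENNReal.tsum_prod']
    simp only [← iter_avg_eq_tsum]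
    rfl
  simp only [hF, hgreen] at hlim
  exact (hit_mono_right Λ x).ge_of_tendsto hlim n

lemma green_le_mul_green_equil (hd : d ≠ 0) {Λ F : Set (V d)} (hF : F ⊆ Λ) {x : V d}
    (hx : green (Λ.indicator 1) x ≠ ∞) {w : V d → ℝ≥0∞} (hw : ∀ y ∉ F, w y = 0) {K : ℝ≥0∞}
    (hK : ∀ y ∈ F, green w y ≤ K) : green w x ≤ K * green (equil Λ) x := by
  have key : ∀ n y, ∑ k ∈ range (n + 1), avg^[k] w y ≤ K * hit Λ n y := by
    intro n
    induction n with
    | zero =>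
      intro y
      by_cases hy : y ∈ F
      · rw [hit_of_mem (hF hy), mul_one]
        exact (ENNReal.sum_le_tsum _).trans (hK y hy)
      · simp [hw y hy]
    | succ n ih =>
      intro y
      by_cases hy : y ∈ F
      · rw [hit_of_mem (hF hy), mul_one]
        exact (ENNReal.sum_le_tsum _).trans (hK y hy)
      · have h1 : ∑ k ∈ range (n + 1 + 1), avg^[k] w y ≤ K * avg (hit Λ n) y := by
          rw [Finset.sum_range_succ']
          simp only [Function.iterate_zero, id, hw y hy, add_zero]
          have h2 := congrFun (iter_avg_sum (range (n + 1)) (fun k => avg^[k] w) 1) y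
          have h3 := congrFun (avg_mul_left K (hit Λ n)) y
          simp only [Function.iterate_one] at h2
          simp only [Function.iterate_succ_apply']
          rw [← h2, ← h3]
          exact avg_mono ih y
        by_cases hy' : y ∈ Λ
        · refine h1.trans ?_
          gcongr
          rw [hit_of_mem hy']
          calc avg (hit Λ n) y ≤ avg (fun _ => 1) y := avg_mono (hit_le_one hd Λ n) y
            _ = 1 := by rw [avg_const hd]
        · rwa [hit_succ_of_notMem hy']
  refine ENNReal.tsum_le_of_sum_range_le fun n => ?_
  calc ∑ k ∈ range n, avg^[k] w x ≤ ∑ k ∈ range (n + 1), avg^[k] w x :=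
        Finset.sum_le_sum_of_subset (Finset.range_mono (Nat.le_succ n))
    _ ≤ K * hit Λ n x := key n x
    _ ≤ _ := by
        gcongr
        exact hit_le_green_equil hd Λ x hx n

lemma measurableSet_mem_range (v : V d) :
    MeasurableSet {s : ℕ → V d | v ∈ Set.range (pos (0 : V d) s)} := by
  have h : {s : ℕ → V d | v ∈ Set.range (pos (0 : V d) s)} = ⋃ j, {s | pos 0 s j = v} := by
    ext s
    simp
  rw [h]
  exact MeasurableSet.iUnion fun j => measurable_pos 0 j (measurableSet_singleton v)

lemma measurable_noret_range (n : ℕ) (x : V d) :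
    Measurable fun s : ℕ → V d => noret (Set.range (pos (0 : V d) s)) n x := by
  induction n generalizing x with
  | zero => exact measurable_const
  | succ n ih =>
    simp only [noret, avg]
    refine Measurable.const_mul (Finset.measurable_sum _ fun e _ => ?_) _
    exact Measurable.ite (measurableSet_mem_range (x + e)).compl (ih _) measurable_const

lemma measurable_equil_range (x : V d) :
    Measurable fun s : ℕ → V d => equil (Set.range (pos (0 : V d) s)) x :=
  Measurable.ite (measurableSet_mem_range x)
    (Measurable.iInf fun n => measurable_noret_range n x) measurable_const

lemma measurable_green_equil_range (x : V d) :
    Measurable fun s : ℕ → V d => green (equil (Set.range (pos (0 : V d) s))) x := by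
  simp only [green_eq_tsum]
  exact Measurable.tsum fun y => (measurable_equil_range y).const_mul _

end Potential

section Decay

variable {d : ℕ}

lemma one_add_mul_le_rpow_neg {q x : ℝ} (hq : 0 ≤ q) (hx1 : x < 1) :
    1 + q * x ≤ (1 - x) ^ (-q) := by
  have h1 : 0 < 1 - x := by linarith
  rw [Real.rpow_def_of_pos h1]
  have h2 := Real.log_le_sub_one_of_pos h1
  have h3 : q * x ≤ Real.log (1 - x) * -q := by nlinarith
  have := Real.add_one_le_exp (Real.log (1 - x) * -q)
  linarith

lemma rpow_neg_le_telescope {p : ℝ} (hp : 1 < p) {n : ℕ} (hn : 1 ≤ n) :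
    (n : ℝ) ^ (-p) ≤
      2 ^ p / (p - 1) * ((n : ℝ) ^ (1 - p) - ((n + 1 : ℕ) : ℝ) ^ (1 - p)) := by
  have hn' : (1 : ℝ) ≤ n := by exact_mod_cast hn
  have hn1 : (0 : ℝ) < n := by linarith
  push_cast
  set N : ℝ := (n : ℝ) + 1 with hN
  have hNpos : 0 < N := by linarith
  have h1 := one_add_mul_le_rpow_neg (q := p - 1) (x := 1 / N) (by linarith)
    (by rw [div_lt_one hNpos]; linarith)
  have h2 : 1 - 1 / N = n / N := by field_simp; linarith
  rw [h2, neg_sub, Real.div_rpow hn1.le hNpos.le, le_div_iff₀ (by positivity)] at h1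
  have h3 : N ^ (1 - p) = N * N ^ (-p) := by
    rw [sub_eq_add_neg, Real.rpow_add hNpos, Real.rpow_one]
  have h4 : (n : ℝ) ^ (-p) ≤ 2 ^ p * N ^ (-p) := by
    rw [Real.rpow_neg hn1.le, Real.rpow_neg hNpos.le, ← div_eq_mul_inv, inv_eq_one_div,
      div_le_div_iff₀ (by positivity) (by positivity), one_mul,
      ← Real.mul_rpow (by norm_num) hn1.le]
    exact Real.rpow_le_rpow hNpos.le (by linarith) (by linarith)
  have h5 : (p - 1) * N ^ (-p) ≤ (n : ℝ) ^ (1 - p) - N ^ (1 - p) := by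
    have : (1 + (p - 1) * (1 / N)) * N ^ (1 - p) = N ^ (1 - p) + (p - 1) * N ^ (-p) := by
      rw [h3]
      field_simp
    linarith
  have hp1 : 0 < p - 1 := by linarith
  calc (n : ℝ) ^ (-p) ≤ 2 ^ p * N ^ (-p) := h4
    _ = 2 ^ p / (p - 1) * ((p - 1) * N ^ (-p)) := by field_simp
    _ ≤ _ := by gcongr

lemma tsum_rpow_neg_le {p : ℝ} (hp : 1 < p) {m : ℕ} (hm : 1 ≤ m) :
    ∑' j : ℕ, ENNReal.ofReal (((m + j : ℕ) : ℝ) ^ (-p)) ≤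
      ENNReal.ofReal (2 ^ p / (p - 1) * (m : ℝ) ^ (1 - p)) := by
  refine ENNReal.tsum_le_of_sum_range_le fun n => ?_
  rw [← ENNReal.ofReal_sum_of_nonneg fun _ _ => by positivity]
  refine ENNReal.ofReal_le_ofReal ?_
  have hp1 : 0 < p - 1 := by linarith
  calc ∑ j ∈ range n, ((m + j : ℕ) : ℝ) ^ (-p)
      ≤ ∑ j ∈ range n, 2 ^ p / (p - 1) *
          (((m + j : ℕ) : ℝ) ^ (1 - p) - ((m + (j + 1) : ℕ) : ℝ) ^ (1 - p)) :=
        Finset.sum_le_sum fun j _ => rpow_neg_le_telescope hp (by omega)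
    _ = 2 ^ p / (p - 1) * ((m : ℝ) ^ (1 - p) - ((m + n : ℕ) : ℝ) ^ (1 - p)) := by
        rw [← Finset.mul_sum, Finset.sum_range_sub' fun j => ((m + j : ℕ) : ℝ) ^ (1 - p)]
        simp
    _ ≤ _ := by
        gcongr
        have : 0 ≤ ((m + n : ℕ) : ℝ) ^ (1 - p) := by positivity
        linarith

lemma exists_tsum_hk_le (a : ℕ) (hd : 1 + (a : ℝ) < d / 2) : ∃ C : ℝ, 0 < C ∧
    ∀ (m : ℕ) (z : V d), 1 ≤ m → ∑' j : ℕ, ((m + j + 1 : ℕ) : ℝ≥0∞) ^ a * hk (m + j) z ≤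
      ENNReal.ofReal (C * (m : ℝ) ^ (1 + a - (d : ℝ) / 2)) := by
  have hd0 : d ≠ 0 := by
    rintro rfl
    have : (0 : ℝ) ≤ a := by positivity
    norm_num at hd
    linarith
  obtain ⟨C, hC, h⟩ := exists_hk_le (d := d) hd0
  set p : ℝ := d / 2 - a with hp
  have hp1 : 1 < p := by linarith
  have hp2 : 0 < p - 1 := by linarith
  refine ⟨C * 2 ^ a * (2 ^ p / (p - 1)), by positivity, fun m z hm => ?_⟩
  calc ∑' j : ℕ, ((m + j + 1 : ℕ) : ℝ≥0∞) ^ a * hk (m + j) z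
      ≤ ∑' j : ℕ, ENNReal.ofReal (C * 2 ^ a) * ENNReal.ofReal (((m + j : ℕ) : ℝ) ^ (-p)) := by
        refine ENNReal.tsum_le_tsum fun j => ?_
        have hn : (1 : ℝ) ≤ ((m + j : ℕ) : ℝ) := by exact_mod_cast (by omega : 1 ≤ m + j)
        have h1 := h (m + j) z (by omega)
        rw [← ENNReal.ofReal_mul (by positivity)]
        calc ((m + j + 1 : ℕ) : ℝ≥0∞) ^ a * hk (m + j) z
            ≤ ENNReal.ofReal (((m + j + 1 : ℕ) : ℝ) ^ a) *
              ENNReal.ofReal (C * ((m + j : ℕ) : ℝ) ^ (-(d : ℝ) / 2)) := by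
              rw [ENNReal.ofReal_pow (by positivity), ENNReal.ofReal_natCast]
              gcongr
          _ ≤ _ := by
              rw [← ENNReal.ofReal_mul (by positivity)]
              refine ENNReal.ofReal_le_ofReal ?_
              have h2 : ((m + j : ℕ) : ℝ) ^ (-p) =
                  ((m + j : ℕ) : ℝ) ^ a * ((m + j : ℕ) : ℝ) ^ (-(d : ℝ) / 2) := by
                rw [← Real.rpow_natCast, ← Real.rpow_add (by linarith)]
                congr 1
                rw [hp]
                ring
              rw [h2]
              have h3 : ((m + j + 1 : ℕ) : ℝ) ^ a ≤ 2 ^ a * ((m + j : ℕ) : ℝ) ^ a := by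
                rw [← mul_pow]
                gcongr
                push_cast at hn ⊢
                linarith
              calc _ ≤ (2 ^ a * ((m + j : ℕ) : ℝ) ^ a) *
                    (C * ((m + j : ℕ) : ℝ) ^ (-(d : ℝ) / 2)) := by gcongr
                _ = _ := by ring
    _ ≤ ENNReal.ofReal (C * 2 ^ a) * ENNReal.ofReal (2 ^ p / (p - 1) * (m : ℝ) ^ (1 - p)) := by
        rw [ENNReal.tsum_mul_left]
        gcongr
        exact tsum_rpow_neg_le hp1 hm
    _ = _ := by
        rw [← ENNReal.ofReal_mul (by positivity)]
        have he : 1 - p = 1 + a - (d : ℝ) / 2 := by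
          rw [hp]
          ring
        rw [he]
        ring_nf

/-- The iterated Green's function is bounded. -/
lemma exists_tsum_succ_mul_hk_le (hd : 5 ≤ d) : ∃ C : ℝ, 0 < C ∧
    ∀ z : V d, ∑' n : ℕ, ((n + 1 : ℕ) : ℝ≥0∞) * hk n z ≤ ENNReal.ofReal C := by
  have hd' : (5 : ℝ) ≤ d := by exact_mod_cast hd
  obtain ⟨C, hC, h⟩ := exists_tsum_hk_le (d := d) 1 (by push_cast; linarith)
  refine ⟨1 + C, by positivity, fun z => ?_⟩
  rw [tsum_eq_zero_add' ENNReal.summable, ENNReal.ofReal_add (by positivity) (by positivity)]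
  refine add_le_add ?_ ?_
  · simpa using hk_le_one (by omega) 0 z
  · have h1 := h 1 z le_rfl
    simp only [pow_one, Nat.cast_one, Real.one_rpow, mul_one] at h1
    refine le_trans (le_of_eq ?_) h1
    refine tsum_congr fun n => ?_
    rw [add_comm 1 n]

lemma gr_le_tsum (z : V d) : gr z ≤ ∑' n : ℕ, ((n + 1 : ℕ) : ℝ≥0∞) * hk n z := by
  refine ENNReal.tsum_le_tsum fun n => ?_
  refine le_mul_of_one_le_left zero_le ?_
  exact_mod_cast Nat.succ_le_succ (Nat.zero_le n)

lemma gr_ne_top (hd : 5 ≤ d) (z : V d) : gr z ≠ ∞ := by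
  obtain ⟨C, hC, h⟩ := exists_tsum_succ_mul_hk_le hd
  exact ne_top_of_le_ne_top ENNReal.ofReal_ne_top ((gr_le_tsum z).trans (h z))

lemma tsum_tsum_add (f : ℕ → ℝ≥0∞) :
    ∑' m, ∑' n, f (m + n) = ∑' n : ℕ, ((n + 1 : ℕ) : ℝ≥0∞) * f n := by
  rw [← ENNReal.tsum_prod' (f := fun p : ℕ × ℕ => f (p.1 + p.2)),
    ← (Finset.HasAntidiagonal.sigmaAntidiagonalEquivProd (A := ℕ)).tsum_eq, ENNReal.tsum_sigma']
  refine tsum_congr fun n => ?_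
  rw [tsum_fintype]
  have : ∀ p : (antidiagonal n), f (p.1.1 + p.1.2) = f n := fun p => by
    rw [Finset.HasAntidiagonal.mem_antidiagonal.1 p.2]
  simp only [Finset.HasAntidiagonal.sigmaAntidiagonalEquivProd_apply, this]
  simp

lemma iter_avg_green (f : V d → ℝ≥0∞) (m : ℕ) (x : V d) :
    avg^[m] (green f) x = ∑' n, avg^[m + n] f x := by
  have h := congrFun (iter_avg_tsum (fun n => avg^[n] f) m) x
  simp only [← Function.iterate_add_apply] at h
  exact h

lemma green_green (f : V d → ℝ≥0∞) (x : V d) :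
    green (green f) x = ∑' n : ℕ, ((n + 1 : ℕ) : ℝ≥0∞) * avg^[n] f x := by
  rw [← tsum_tsum_add fun n => avg^[n] f x]
  exact tsum_congr fun m => iter_avg_green f m x

lemma gr_sub_eq_green (x y : V d) : gr (x - y) = green (fun z => if z = y then 1 else 0) x := by
  simp only [gr, green, iter_avg_single, hk_sub_comm _ x y]

lemma green_gr_sub (x y : V d) :
    green (fun v => gr (v - y)) x = ∑' n : ℕ, ((n + 1 : ℕ) : ℝ≥0∞) * hk n (x - y) := by
  simp only [gr_sub_eq_green]
  rw [green_green]
  simp only [iter_avg_single, hk_sub_comm _ x y]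

lemma exists_sum_gr_le (hd : 3 ≤ d) : ∃ C : ℝ, 0 < C ∧ ∀ (Q : Finset (V d)) (y : V d) (m : ℕ),
    1 ≤ m → ∑ v ∈ Q, gr (y - v) ≤ m + (Q.card : ℝ≥0∞) *
      ENNReal.ofReal (C * (m : ℝ) ^ (1 - (d : ℝ) / 2)) := by
  have hd' : (3 : ℝ) ≤ d := by exact_mod_cast hd
  obtain ⟨C, hC, h⟩ := exists_tsum_hk_le (d := d) 0 (by push_cast; linarith)
  refine ⟨C, hC, fun Q y m hm => ?_⟩
  simp only [pow_zero, one_mul, Nat.cast_zero, add_zero] at h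
  have h1 : ∀ z : V d, gr z = ∑ n ∈ range m, hk n z + ∑' j, hk (m + j) z := by
    intro z
    rw [gr, ← Summable.sum_add_tsum_nat_add' (k := m) ENNReal.summable]
    simp only [add_comm m]
  simp only [h1, Finset.sum_add_distrib]
  refine add_le_add ?_ ?_
  · rw [Finset.sum_comm]
    calc ∑ n ∈ range m, ∑ v ∈ Q, hk n (y - v) ≤ ∑ n ∈ range m, (1 : ℝ≥0∞) := by
          refine Finset.sum_le_sum fun n _ => ?_
          rw [← tsum_hk (d := d) (by omega) n y]
          simp only [hk_sub_comm n y]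
          exact ENNReal.sum_le_tsum Q
      _ = m := by simp
  · calc ∑ v ∈ Q, ∑' j, hk (m + j) (y - v)
        ≤ ∑ v ∈ Q, ENNReal.ofReal (C * (m : ℝ) ^ (1 - (d : ℝ) / 2)) :=
          Finset.sum_le_sum fun v _ => h m (y - v) hm
      _ = _ := by rw [Finset.sum_const, nsmul_eq_mul]

end Decay

section Khasminskii

variable {d : ℕ}

lemma exp_half_mul_le {a b : ℝ} (ha : 0 ≤ a) (hab : a ≤ b) (hb : b ≤ 1) :
    Real.exp (a / 2) * (1 + (b - a)) ≤ 1 + b := by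
  have h1 : Real.exp (a / 2) ≤ 1 / (1 - a / 2) := by
    rw [le_div_iff₀ (by linarith)]
    have h2 : 1 - a / 2 ≤ Real.exp (-(a / 2)) := by linarith [Real.add_one_le_exp (-(a / 2))]
    calc Real.exp (a / 2) * (1 - a / 2) ≤ Real.exp (a / 2) * Real.exp (-(a / 2)) := by
          gcongr
      _ = 1 := by rw [← Real.exp_add, add_neg_cancel, Real.exp_zero]
  calc Real.exp (a / 2) * (1 + (b - a)) ≤ 1 / (1 - a / 2) * (1 + (b - a)) := by
        gcongr
    _ ≤ 1 + b := by
        rw [one_div_mul_eq_div, div_le_iff₀ (by linarith)]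
        nlinarith

lemma ofReal_exp_mul_le {a b u : ℝ≥0∞} {σ : ℝ} (hσ : 0 < σ) (h : a + u ≤ b)
    (hb : a ≠ 0 → b ≤ ENNReal.ofReal σ) :
    ENNReal.ofReal (Real.exp (a.toReal / (2 * σ))) * (1 + u / ENNReal.ofReal σ) ≤
      1 + b / ENNReal.ofReal σ := by
  by_cases ha : a = 0
  · subst ha
    rw [zero_add] at h
    simp only [ENNReal.toReal_zero, zero_div, Real.exp_zero, ENNReal.ofReal_one, one_mul]
    gcongr
  · replace hb := hb ha
    have hbt : b ≠ ∞ := ne_top_of_le_ne_top ENNReal.ofReal_ne_top hb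
    have hat : a ≠ ∞ := ne_top_of_le_ne_top hbt (le_self_add.trans h)
    have hut : u ≠ ∞ := ne_top_of_le_ne_top hbt (le_add_self.trans h)
    lift a to NNReal using hat
    lift b to NNReal using hbt
    lift u to NNReal using hut
    have h' : (a : ℝ) + u ≤ b := by exact_mod_cast h
    have hb' : (b : ℝ) ≤ σ := by
      rw [← ENNReal.ofReal_coe_nnreal] at hb
      exact (ENNReal.ofReal_le_ofReal_iff hσ.le).1 hb
    have key := exp_half_mul_le (a := a / σ) (b := b / σ) (by positivity)
      (by gcongr; linarith [u.2]) ((div_le_one hσ).2 hb')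
    rw [← ENNReal.ofReal_coe_nnreal (p := b), ← ENNReal.ofReal_coe_nnreal (p := u),
      ← ENNReal.ofReal_div_of_pos hσ, ← ENNReal.ofReal_div_of_pos hσ, ← ENNReal.ofReal_one,
      ← ENNReal.ofReal_add zero_le_one (by positivity),
      ← ENNReal.ofReal_add zero_le_one (by positivity), ← ENNReal.ofReal_mul (by positivity)]
    refine ENNReal.ofReal_le_ofReal (le_trans ?_ key)
    rw [ENNReal.coe_toReal, div_div, mul_comm σ 2]
    gcongr
    rw [← sub_div]
    gcongr
    linarith

lemma IsWalk.lintegral_prod_exp_le (hd : d ≠ 0) {ν : Measure (ℕ → V d)} (h : IsWalk ν)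
    {f : V d → ℝ≥0∞} {σ : ℝ} (hσ : 0 < σ) (hf : ∀ x, f x ≠ 0 → green f x ≤ ENNReal.ofReal σ)
    (K : ℕ) (x : V d) :
    ∫⁻ s, ∏ k ∈ range K, ENNReal.ofReal (Real.exp ((f (pos x s k)).toReal / (2 * σ))) ∂ν ≤
      1 + green f x / ENNReal.ofReal σ := by
  have := h.isProbabilityMeasure hd
  induction K generalizing x with
  | zero => simp
  | succ K ih =>
    have hm : ∀ k, Measurable fun s =>
        ENNReal.ofReal (Real.exp ((f (pos x s k)).toReal / (2 * σ))) := fun k =>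
      (measurable_of_countable fun y => ENNReal.ofReal (Real.exp ((f y).toReal / (2 * σ)))).comp
        (measurable_pos x k)
    have hm' : ∀ y : V d, Measurable fun s => ∏ k ∈ range K,
        ENNReal.ofReal (Real.exp ((f (pos y s k)).toReal / (2 * σ))) := fun y =>
      Finset.measurable_prod _ fun k _ =>
        (measurable_of_countable fun y => ENNReal.ofReal (Real.exp ((f y).toReal / (2 * σ)))).comp
          (measurable_pos y k)
    rw [h.lintegral_cons hd (Finset.measurable_prod _ fun k _ => hm k)]
    simp only [Finset.prod_range_succ', pos_cons_succ, pos_zero]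
    simp only [lintegral_mul_const _ (hm' _)]
    rw [← Finset.sum_mul, ← mul_assoc, mul_comm]
    refine le_trans ?_ (ofReal_exp_mul_le hσ (green_eq_add f x).ge (hf x))
    gcongr
    have h1 := congrFun (avg_add (fun _ => 1) fun y => (ENNReal.ofReal σ)⁻¹ * green f y) x
    have h2 := congrFun (avg_mul_left (ENNReal.ofReal σ)⁻¹ (green f)) x
    simp only [avg_const hd] at h1
    rw [div_eq_mul_inv, mul_comm (avg (green f) x), ← h2, ← h1]
    unfold avg
    gcongr with e he
    refine (ih (x + e)).trans ?_
    rw [div_eq_mul_inv, mul_comm (green f _)]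

/-- Exponential tail of an additive functional with small potential. -/
lemma IsWalk.measure_lt_tsum_le (hd : d ≠ 0) {ν : Measure (ℕ → V d)} (h : IsWalk ν)
    {f : V d → ℝ≥0∞} {σ : ℝ} (hσ : 0 < σ) (hf : ∀ x, f x ≠ 0 → green f x ≤ ENNReal.ofReal σ)
    {x : V d} (hx : green f x ≤ ENNReal.ofReal σ) (a : ℝ) :
    ν {s | ENNReal.ofReal a < ∑' k, f (pos x s k)} ≤
      ENNReal.ofReal (2 * Real.exp (-a / (2 * σ))) := by
  have hft : ∀ y, f y ≠ ∞ := by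
    intro y hy
    have h1 := hf y (by simp [hy])
    have h2 : f y ≤ green f y := by
      rw [green_eq_add]
      exact le_self_add
    rw [hy, top_le_iff] at h2
    rw [h2, top_le_iff] at h1
    exact ENNReal.ofReal_ne_top h1
  have hU : {s | ENNReal.ofReal a < ∑' k, f (pos x s k)} =
      ⋃ K, {s | ENNReal.ofReal a < ∑ k ∈ range K, f (pos x s k)} := by
    ext s
    simp only [Set.mem_ofPred_eq, Set.mem_iUnion, ENNReal.tsum_eq_iSup_nat, lt_iSup_iff]
  rw [hU, Monotone.measure_iUnion]
  · refine iSup_le fun K => ?_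
    have hm : Measurable fun s =>
        ∏ k ∈ range K, ENNReal.ofReal (Real.exp ((f (pos x s k)).toReal / (2 * σ))) :=
      Finset.measurable_prod _ fun k _ =>
        (measurable_of_countable fun y => ENNReal.ofReal (Real.exp ((f y).toReal / (2 * σ)))).comp
          (measurable_pos x k)
    have h1 := mul_meas_ge_le_lintegral (μ := ν) hm (ENNReal.ofReal (Real.exp (a / (2 * σ))))
    have h2 := h1.trans (h.lintegral_prod_exp_le hd hσ hf K x)
    have h3 : (1 : ℝ≥0∞) + green f x / ENNReal.ofReal σ ≤ 2 := by
      rw [← one_add_one_eq_two]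
      gcongr
      exact ENNReal.div_le_of_le_mul (by rwa [one_mul])
    have h4 : {s | ENNReal.ofReal a < ∑ k ∈ range K, f (pos x s k)} ⊆
        {s | ENNReal.ofReal (Real.exp (a / (2 * σ))) ≤
          ∏ k ∈ range K, ENNReal.ofReal (Real.exp ((f (pos x s k)).toReal / (2 * σ)))} := by
      intro s hs
      simp only [Set.mem_ofPred_eq] at hs ⊢
      rw [← ENNReal.ofReal_prod_of_nonneg fun _ _ => (Real.exp_pos _).le, ← Real.exp_sum,
        ← Finset.sum_div, ← ENNReal.toReal_sum fun k _ => hft _]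
      have h5 := (ENNReal.ofReal_le_iff_le_toReal (ENNReal.sum_ne_top.2 fun k _ => hft _)).1 hs.le
      gcongr
    have h5 := (mul_le_mul_right (measure_mono (μ := ν) h4) _).trans (h2.trans h3)
    have h6 : ENNReal.ofReal (2 * Real.exp (-a / (2 * σ))) =
        2 / ENNReal.ofReal (Real.exp (a / (2 * σ))) := by
      rw [neg_div, Real.exp_neg, ← div_eq_mul_inv, ENNReal.ofReal_div_of_pos (Real.exp_pos _)]
      norm_num
    rw [h6, ENNReal.le_div_iff_mul_le (Or.inl (by simp [Real.exp_pos])) (Or.inl (by simp)),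
      mul_comm]
    exact h5
  · intro K K' hK s hs
    exact lt_of_lt_of_le (α := ℝ≥0∞) hs (Finset.sum_le_sum_of_subset (Finset.range_mono hK))

end Khasminskii

section UpperBound

variable {d : ℕ}

/-- Tail of the twice iterated Green's kernel. -/
noncomputable def tailSum (M : ℕ) (z : V d) : ℝ≥0∞ :=
  ∑' j : ℕ, ((M + j + 1 : ℕ) : ℝ≥0∞) ^ 2 * hk (M + j) z

/-- Part of the iterated Green's kernel at `x` coming from times at least `M`. -/
noncomputable def farKernel (M : ℕ) (x y : V d) : ℝ≥0∞ :=
  ∑' j : ℕ, ((M + j + 1 : ℕ) : ℝ≥0∞) * hk (M + j) (x - y)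

lemma tsum_tsum_le_tailSum (M : ℕ) (z : V d) :
    ∑' m : ℕ, ∑' j : ℕ, ((M + j + 1 : ℕ) : ℝ≥0∞) * hk (m + (M + j)) z ≤ tailSum M z := by
  calc ∑' m : ℕ, ∑' j : ℕ, ((M + j + 1 : ℕ) : ℝ≥0∞) * hk (m + (M + j)) z
      ≤ ∑' m : ℕ, ∑' j : ℕ, ((M + (m + j) + 1 : ℕ) : ℝ≥0∞) * hk (M + (m + j)) z := by
        refine ENNReal.tsum_le_tsum fun m => ENNReal.tsum_le_tsum fun j => ?_
        rw [add_left_comm]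
        gcongr
        omega
    _ = ∑' n : ℕ, ((n + 1 : ℕ) : ℝ≥0∞) * (((M + n + 1 : ℕ) : ℝ≥0∞) * hk (M + n) z) :=
        tsum_tsum_add fun n => ((M + n + 1 : ℕ) : ℝ≥0∞) * hk (M + n) z
    _ ≤ tailSum M z := by
        refine ENNReal.tsum_le_tsum fun n => ?_
        rw [← mul_assoc, sq]
        gcongr
        omega

lemma green_farKernel_le (M : ℕ) (x y : V d) : green (farKernel M x) y ≤ tailSum M (x - y) := by
  refine le_trans (le_of_eq ?_) (tsum_tsum_le_tailSum M (x - y))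
  refine tsum_congr fun m => ?_
  unfold farKernel
  rw [iter_avg_tsum]
  refine tsum_congr fun j => ?_
  rw [iter_avg_mul_left]
  beta_reduce
  rw [iter_avg_hk_sub]

lemma tsum_indicator_range_le {ι α : Type*} (p : ι → α) (h : α → ℝ≥0∞) :
    ∑' x, (Set.range p).indicator h x ≤ ∑' k, h (p k) := by
  rw [← _root_.tsum_subtype]
  exact ENNReal.tsum_le_tsum_comp_of_surjective Set.rangeFactorization_surjective
    fun x : Set.range p => h x

lemma equil_le_one (hd : d ≠ 0) (Λ : Set (V d)) (x : V d) : equil Λ x ≤ Λ.indicator 1 x :=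
  Set.indicator_le_indicator ((iInf_le _ 0).trans (noret_le_one hd Λ 0 x))

lemma green_green_equil_le (hd : d ≠ 0) (M : ℕ) (s : ℕ → V d) (x : V d) :
    green (green (equil (Set.range (pos 0 s)))) x ≤ M + ∑' k, farKernel M x (pos 0 s k) := by
  set e := equil (Set.range (pos 0 s)) with he
  rw [green_green, ← Summable.sum_add_tsum_nat_add' (k := M) ENNReal.summable]
  refine add_le_add ?_ ?_
  · calc ∑ n ∈ range M, ((n + 1 : ℕ) : ℝ≥0∞) * avg^[n] e x
        ≤ ∑ n ∈ range M, (M : ℝ≥0∞) * avg^[n] e x := by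
          refine Finset.sum_le_sum fun n hn => ?_
          have := Finset.mem_range.1 hn
          gcongr
          omega
      _ ≤ M * green e x := by
          rw [← Finset.mul_sum]
          gcongr
          exact ENNReal.sum_le_tsum _
      _ ≤ M * 1 := by
          gcongr
          exact green_equil_le_one hd _ x
      _ = M := mul_one _
  · calc ∑' n, ((n + M + 1 : ℕ) : ℝ≥0∞) * avg^[n + M] e x
        = ∑' n, ∑' y, ((M + n + 1 : ℕ) : ℝ≥0∞) * hk (M + n) (x - y) * e y := by
          refine tsum_congr fun n => ?_
          rw [iter_avg_eq_tsum, ← ENNReal.tsum_mul_left, add_comm n M]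
          refine tsum_congr fun y => ?_
          rw [hk_sub_comm, mul_assoc]
      _ = ∑' y, farKernel M x y * e y := by
          rw [ENNReal.tsum_comm]
          simp only [ENNReal.tsum_mul_right]
          rfl
      _ ≤ ∑' y, (Set.range (pos 0 s)).indicator (farKernel M x) y := by
          refine ENNReal.tsum_le_tsum fun y => ?_
          calc farKernel M x y * e y
              ≤ farKernel M x y * (Set.range (pos 0 s)).indicator 1 y := by
                gcongr
                exact equil_le_one hd _ y
            _ = _ := by by_cases hy : y ∈ Set.range (pos 0 s) <;> simp [hy]
      _ ≤ _ := tsum_indicator_range_le _ _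

/-- The cube of radius `L` for the sup norm. -/
noncomputable def box (d L : ℕ) : Finset (V d) := Finset.Icc (fun _ => -(L : ℤ)) fun _ => (L : ℤ)

lemma mem_box {L : ℕ} {x : V d} : x ∈ box d L ↔ ∀ i, |x i| ≤ L := by
  simp only [box, Finset.mem_Icc, Pi.le_def, abs_le, forall_and]

lemma card_box (d L : ℕ) : (box d L).card = (2 * L + 1) ^ d := by
  rw [box, Pi.card_Icc]
  simp only [Int.card_Icc, Finset.prod_const, Finset.card_univ, Fintype.card_fin]
  congr 1
  omega

lemma IsWalk.ae_mem_steps {ν : Measure (ℕ → V d)} (h : IsWalk ν) :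
    ∀ᵐ s ∂ν, ∀ i, s i ∈ steps d := by
  rw [ae_all_iff]
  intro i
  have h1 : ∀ᵐ a ∂(level d (i + 1)), a (Fin.last i) ∈ steps d := by
    classical
    have h2 : MeasurableSet {a : Fin (i + 1) → V d | a (Fin.last i) ∉ steps d} :=
      MeasurableSet.of_discrete
    change level d (i + 1) {a : Fin (i + 1) → V d | a (Fin.last i) ∉ steps d} = 0
    rw [← lintegral_indicator_one h2, lintegral_level, Finset.sum_eq_zero, mul_zero]
    intro a ha
    refine Set.indicator_of_notMem ?_ _
    rw [Set.mem_ofPred_eq, not_not]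
    exact Fintype.mem_piFinset.1 ha _
  rw [← h (i + 1)] at h1
  exact ae_of_ae_map (measurable_restr _).aemeasurable h1

lemma abs_apply_le_one_of_mem_steps {e : V d} (he : e ∈ steps d) (i : Fin d) : |e i| ≤ 1 := by
  rw [steps_eq, Finset.mem_image] at he
  obtain ⟨⟨j, b⟩, -, rfl⟩ := he
  simp only [unitStep]
  split_ifs <;> simp

lemma pos_mem_box {s : ℕ → V d} (hs : ∀ i, s i ∈ steps d) {k L : ℕ} (hk : k ≤ L) :
    pos 0 s k ∈ box d L := by
  rw [mem_box]
  intro i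
  have h : |pos 0 s k i| ≤ k := by
    simp only [pos, zero_add, Finset.sum_apply]
    refine (Finset.abs_sum_le_sum_abs _ _).trans ?_
    calc ∑ j ∈ range k, |s j i| ≤ ∑ j ∈ range k, 1 :=
          Finset.sum_le_sum fun j _ => abs_apply_le_one_of_mem_steps (hs j) i
      _ = k := by simp
  omega

/-- Potential of the range of `s`. -/
noncomputable def potential (s : ℕ → V d) : V d → ℝ≥0∞ := green (equil (Set.range (pos 0 s)))

lemma measurable_potential (x : V d) : Measurable fun s : ℕ → V d => potential s x :=
  measurable_green_equil_range x

lemma measurable_potential_prod : Measurable fun q : V d × (ℕ → V d) => potential q.2 q.1 := by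
  exact measurable_from_prod_countable_right fun x => measurable_potential x

lemma measurable_pos_prod (k : ℕ) :
    Measurable fun p : (ℕ → V d) × (ℕ → V d) => ((pos 0 p.1 k, p.2) : V d × (ℕ → V d)) :=
  ((measurable_pos 0 k).comp measurable_fst).prodMk measurable_snd

lemma measurable_potential_pos (k : ℕ) :
    Measurable fun p : (ℕ → V d) × (ℕ → V d) => potential p.2 (pos 0 p.1 k) := by
  have h := Measurable.comp (measurable_potential_prod (d := d)) (measurable_pos_prod k)
  simp only [Function.comp_def] at h
  exact h

lemma potential_le_tsum_gr (hd : d ≠ 0) (s : ℕ → V d) (x : V d) :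
    potential s x ≤ ∑' j, gr (pos 0 s j - x) := by
  rw [potential, green_eq_tsum]
  refine le_trans ?_ (tsum_indicator_range_le (pos 0 s) fun y => gr (y - x))
  refine ENNReal.tsum_le_tsum fun y => ?_
  calc gr (y - x) * equil (Set.range (pos 0 s)) y
      ≤ gr (y - x) * (Set.range (pos 0 s)).indicator 1 y := by
        gcongr
        exact equil_le_one hd _ y
    _ = _ := by by_cases hy : y ∈ Set.range (pos 0 s) <;> simp [hy]

lemma IsWalk.lintegral_tsum_gr (hd : d ≠ 0) {ν : Measure (ℕ → V d)} (h : IsWalk ν) (x : V d) :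
    ∫⁻ s, ∑' j, gr (pos 0 s j - x) ∂ν = ∑' n : ℕ, ((n + 1 : ℕ) : ℝ≥0∞) * hk n x := by
  rw [lintegral_tsum (f := fun j s => gr (pos 0 s j - x)) fun j =>
    ((measurable_of_countable fun y => gr (y - x)).comp (measurable_pos 0 j)).aemeasurable]
  simp only [fun j => h.lintegral_pos hd (fun y => gr (y - x)) j 0]
  have h1 := green_gr_sub 0 x
  simp only [zero_sub, hk_neg] at h1
  exact h1

lemma IsWalk.lintegral_potential_tail_le (hd : d ≠ 0) {ν : Measure (ℕ → V d)} (h : IsWalk ν)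
    (L : ℕ) : ∫⁻ p, ∑' j, potential p.2 (pos 0 p.1 (L + j)) ∂(ν.prod ν) ≤ tailSum L (0 : V d) := by
  have := h.isProbabilityMeasure hd
  rw [lintegral_tsum fun j => (measurable_potential_pos (L + j)).aemeasurable]
  have h1 : ∀ k, ∫⁻ p, potential p.2 (pos 0 p.1 k) ∂(ν.prod ν) ≤
      ∑' n : ℕ, ((n + 1 : ℕ) : ℝ≥0∞) * hk (n + k) (0 : V d) := by
    intro k
    rw [lintegral_prod _ (measurable_potential_pos k).aemeasurable]
    calc ∫⁻ s, ∫⁻ s', potential s' (pos 0 s k) ∂ν ∂ν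
        ≤ ∫⁻ s, (∑' n : ℕ, ((n + 1 : ℕ) : ℝ≥0∞) * hk n (0 - pos 0 s k)) ∂ν := by
          refine lintegral_mono fun s => ?_
          simp only [zero_sub, hk_neg]
          rw [← h.lintegral_tsum_gr hd]
          exact lintegral_mono fun s' => potential_le_tsum_gr hd s' _
      _ = _ := by
          rw [h.lintegral_pos hd (fun x => ∑' n : ℕ, ((n + 1 : ℕ) : ℝ≥0∞) * hk n (0 - x)) k 0,
            iter_avg_tsum]
          refine tsum_congr fun n => ?_
          rw [iter_avg_mul_left]
          beta_reduce
          rw [iter_avg_hk_sub, add_comm k n, sub_zero]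
  refine (ENNReal.tsum_le_tsum fun j => h1 (L + j)).trans ?_
  calc ∑' j : ℕ, ∑' n : ℕ, ((n + 1 : ℕ) : ℝ≥0∞) * hk (n + (L + j)) (0 : V d)
      ≤ ∑' j : ℕ, ∑' n : ℕ, ((L + (j + n) + 1 : ℕ) : ℝ≥0∞) * hk (L + (j + n)) (0 : V d) := by
        refine ENNReal.tsum_le_tsum fun j => ENNReal.tsum_le_tsum fun n => ?_
        rw [show n + (L + j) = L + (j + n) by omega]
        gcongr
        omega
    _ = ∑' n : ℕ, ((n + 1 : ℕ) : ℝ≥0∞) * (((L + n + 1 : ℕ) : ℝ≥0∞) * hk (L + n) (0 : V d)) :=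
        tsum_tsum_add fun n => ((L + n + 1 : ℕ) : ℝ≥0∞) * hk (L + n) (0 : V d)
    _ ≤ tailSum L 0 := by
        refine ENNReal.tsum_le_tsum fun n => ?_
        rw [← mul_assoc, sq]
        gcongr
        omega

end UpperBound

section UpperTail

variable {d : ℕ}

lemma gammaInf_le_tsum_potential (hd : 5 ≤ d) (sA sB : ℕ → V d) :
    gammaInf d sA sB ≤ ∑' k, potential sB (pos 0 sA k) := by
  rw [gammaInf_eq (by omega) (gr_ne_top hd)]
  exact tsum_indicator_range_le _ _

lemma measurable_tsum_pos (f : V d → ℝ≥0∞) :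
    Measurable fun s : ℕ → V d => ∑' k, f (pos 0 s k) :=
  Measurable.tsum fun k => (measurable_of_countable f).comp (measurable_pos 0 k)

lemma IsWalk.measure_exists_farKernel_le (hd : d ≠ 0) {ν : Measure (ℕ → V d)} (h : IsWalk ν)
    {σ : ℝ} (hσ : 0 < σ) {M : ℕ} (hM : ∀ z : V d, tailSum M z ≤ ENNReal.ofReal σ) (L : ℕ) (a : ℝ) :
    ν {s | ∃ x ∈ box d L, ENNReal.ofReal a < ∑' k, farKernel M x (pos 0 s k)} ≤
      ((2 * L + 1) ^ d : ℕ) * ENNReal.ofReal (2 * Real.exp (-a / (2 * σ))) := by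
  calc ν {s | ∃ x ∈ box d L, ENNReal.ofReal a < ∑' k, farKernel M x (pos 0 s k)}
      ≤ ν (⋃ x ∈ box d L, {s | ENNReal.ofReal a < ∑' k, farKernel M x (pos 0 s k)}) := by
        refine measure_mono fun s hs => ?_
        obtain ⟨x, hx, hs⟩ := hs
        simp only [Set.mem_iUnion]
        exact ⟨x, hx, hs⟩
    _ ≤ ∑ x ∈ box d L, ν {s | ENNReal.ofReal a < ∑' k, farKernel M x (pos 0 s k)} :=
        measure_biUnion_finset_le _ _
    _ ≤ ∑ x ∈ box d L, ENNReal.ofReal (2 * Real.exp (-a / (2 * σ))) := by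
        refine Finset.sum_le_sum fun x _ => ?_
        exact h.measure_lt_tsum_le hd hσ (fun y _ => (green_farKernel_le M x y).trans (hM _))
          ((green_farKernel_le M x 0).trans (hM _)) a
    _ = _ := by rw [Finset.sum_const, card_box, nsmul_eq_mul]

lemma IsWalk.measure_potential_box_le (hd : d ≠ 0) {ν : Measure (ℕ → V d)} (h : IsWalk ν)
    {M L : ℕ} {a : ℝ} (ha : 0 < a) {s : ℕ → V d}
    (hs : ∀ x ∈ box d L, ∑' k, farKernel M x (pos 0 s k) ≤ ENNReal.ofReal a) (b : ℝ) :
    ν {s' | ENNReal.ofReal b < ∑' k, (box d L : Set (V d)).indicator (potential s) (pos 0 s' k)} ≤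
      ENNReal.ofReal (2 * Real.exp (-b / (2 * (M + a)))) := by
  have h1 : ∀ x ∈ box d L, green ((box d L : Set (V d)).indicator (potential s)) x ≤
      ENNReal.ofReal (M + a) := by
    intro x hx
    calc green ((box d L : Set (V d)).indicator (potential s)) x
        ≤ green (potential s) x := green_mono (Set.indicator_le_self _ _) x
      _ ≤ M + ∑' k, farKernel M x (pos 0 s k) := green_green_equil_le hd M s x
      _ ≤ M + ENNReal.ofReal a := by gcongr; exact hs x hx
      _ = ENNReal.ofReal (M + a) := by
        rw [ENNReal.ofReal_add (by positivity) ha.le, ENNReal.ofReal_natCast]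
  refine h.measure_lt_tsum_le hd (by positivity) (fun x hx => h1 x ?_) (h1 0 ?_) b
  · by_contra hx'
    exact hx (Set.indicator_of_notMem (by simpa using hx') _)
  · rw [mem_box]
    simp

lemma measurable_potential_box (L k : ℕ) :
    Measurable fun p : (ℕ → V d) × (ℕ → V d) =>
      (box d L : Set (V d)).indicator (potential p.2) (pos 0 p.1 k) := by
  have h : Measurable fun q : V d × (ℕ → V d) =>
      (box d L : Set (V d)).indicator (potential q.2) q.1 := by
    refine measurable_from_prod_countable_right fun x => ?_
    by_cases hx : x ∈ (box d L : Set (V d))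
    · simp only [Set.indicator_of_mem hx]
      exact measurable_potential x
    · simp only [Set.indicator_of_notMem hx]
      exact measurable_const
  have h2 := Measurable.comp h (measurable_pos_prod (d := d) k)
  simp only [Function.comp_def] at h2
  exact h2

lemma IsWalk.measure_potential_box_prod_le (hd : d ≠ 0) {ν : Measure (ℕ → V d)} (h : IsWalk ν)
    {M L : ℕ} {a : ℝ} (ha : 0 < a) (b : ℝ) :
    (ν.prod ν) {p | (∀ x ∈ box d L, ∑' k, farKernel M x (pos 0 p.2 k) ≤ ENNReal.ofReal a) ∧
      ENNReal.ofReal b < ∑' k, (box d L : Set (V d)).indicator (potential p.2) (pos 0 p.1 k)} ≤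
      ENNReal.ofReal (2 * Real.exp (-b / (2 * (M + a)))) := by
  have := h.isProbabilityMeasure hd
  have hm : MeasurableSet {p : (ℕ → V d) × (ℕ → V d) |
      (∀ x ∈ box d L, ∑' k, farKernel M x (pos 0 p.2 k) ≤ ENNReal.ofReal a) ∧
      ENNReal.ofReal b <
        ∑' k, (box d L : Set (V d)).indicator (potential p.2) (pos 0 p.1 k)} := by
    refine MeasurableSet.inter ?_ ?_
    · have h1 : MeasurableSet (⋂ x ∈ box d L, {p : (ℕ → V d) × (ℕ → V d) |
          ∑' k, farKernel M x (pos 0 p.2 k) ≤ ENNReal.ofReal a}) :=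
        Finset.measurableSet_biInter _ fun x _ =>
          measurableSet_le ((measurable_tsum_pos (farKernel M x)).comp measurable_snd)
            measurable_const
      have h2 : {p : (ℕ → V d) × (ℕ → V d) | ∀ x ∈ box d L,
          ∑' k, farKernel M x (pos 0 p.2 k) ≤ ENNReal.ofReal a} =
          ⋂ x ∈ box d L, {p : (ℕ → V d) × (ℕ → V d) |
          ∑' k, farKernel M x (pos 0 p.2 k) ≤ ENNReal.ofReal a} := by
        ext p
        simp only [Set.mem_iInter]
        rfl
      rw [← h2] at h1
      exact h1
    · exact measurableSet_lt measurable_const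
        (Measurable.tsum fun k => measurable_potential_box L k)
  rw [Measure.prod_apply_symm hm]
  calc ∫⁻ s, ν _ ∂ν ≤ ∫⁻ _, ENNReal.ofReal (2 * Real.exp (-b / (2 * (M + a)))) ∂ν := by
        refine lintegral_mono fun s => ?_
        by_cases hs : ∀ x ∈ box d L, ∑' k, farKernel M x (pos 0 s k) ≤ ENNReal.ofReal a
        · exact (measure_mono fun s' hs' => hs'.2).trans (h.measure_potential_box_le hd ha hs b)
        · refine (measure_mono (t := ∅) fun s' hs' => hs hs'.1).trans ?_
          simp
    _ = _ := by simp

lemma IsWalk.ae_sum_potential_le (hd : d ≠ 0) {ν : Measure (ℕ → V d)} (h : IsWalk ν) (L : ℕ) :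
    ∀ᵐ p ∂(ν.prod ν), ∑' k, potential p.2 (pos 0 p.1 k) ≤
      ∑' k, (box d L : Set (V d)).indicator (potential p.2) (pos 0 p.1 k) +
        ∑' j, potential p.2 (pos 0 p.1 (L + j)) := by
  have := h.isProbabilityMeasure hd
  have h1 : ∀ᵐ p ∂(ν.prod ν), ∀ i, p.1 i ∈ steps d :=
    Measure.quasiMeasurePreserving_fst.ae h.ae_mem_steps
  filter_upwards [h1] with p hp
  rw [← Summable.sum_add_tsum_nat_add' (k := L) ENNReal.summable]
  refine add_le_add ?_ (le_of_eq (tsum_congr fun j => by rw [add_comm]))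
  calc ∑ k ∈ range L, potential p.2 (pos 0 p.1 k)
      = ∑ k ∈ range L, (box d L : Set (V d)).indicator (potential p.2) (pos 0 p.1 k) := by
        refine Finset.sum_congr rfl fun k hk => ?_
        rw [Set.indicator_of_mem]
        exact pos_mem_box hp (Finset.mem_range.1 hk).le
    _ ≤ _ := ENNReal.sum_le_tsum _

lemma IsWalk.measure_gammaInf_le (hd : 5 ≤ d) {ν : Measure (ℕ → V d)} (h : IsWalk ν)
    {σ : ℝ} (hσ : 0 < σ) {M : ℕ} (hM : ∀ z : V d, tailSum M z ≤ ENNReal.ofReal σ) (L : ℕ)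
    {a : ℝ} (ha : 0 < a) {b : ℝ} (hb : 0 < b) :
    (ν.prod ν) {p | ENNReal.ofReal (b + b) < gammaInf d p.1 p.2} ≤
      ((2 * L + 1) ^ d : ℕ) * ENNReal.ofReal (2 * Real.exp (-a / (2 * σ))) +
        ENNReal.ofReal (2 * Real.exp (-b / (2 * (M + a)))) +
        tailSum L (0 : V d) / ENNReal.ofReal b := by
  have hd0 : d ≠ 0 := by omega
  have := h.isProbabilityMeasure hd0
  set B := {s : ℕ → V d | ∃ x ∈ box d L, ENNReal.ofReal a < ∑' k, farKernel M x (pos 0 s k)}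
  set A := {p : (ℕ → V d) × (ℕ → V d) |
    (∀ x ∈ box d L, ∑' k, farKernel M x (pos 0 p.2 k) ≤ ENNReal.ofReal a) ∧
      ENNReal.ofReal b < ∑' k, (box d L : Set (V d)).indicator (potential p.2) (pos 0 p.1 k)}
  set D := {p : (ℕ → V d) × (ℕ → V d) |
    ENNReal.ofReal b ≤ ∑' j, potential p.2 (pos 0 p.1 (L + j))}
  calc (ν.prod ν) {p | ENNReal.ofReal (b + b) < gammaInf d p.1 p.2}
      ≤ (ν.prod ν) (Set.univ ×ˢ B ∪ A ∪ D) := by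
        refine measure_mono_ae ?_
        filter_upwards [h.ae_sum_potential_le hd0 L] with p hp hlt
        by_contra hcon
        have hcon' : p ∉ Set.univ ×ˢ B ∪ A ∪ D := hcon
        simp only [Set.mem_union, not_or] at hcon'
        obtain ⟨⟨hB, hA⟩, hD⟩ := hcon'
        have hgood : ∀ x ∈ box d L, ∑' k, farKernel M x (pos 0 p.2 k) ≤ ENNReal.ofReal a := by
          intro x hx
          by_contra! hcon
          exact hB ⟨Set.mem_univ _, x, hx, hcon⟩
        have hA' : ∑' k, (box d L : Set (V d)).indicator (potential p.2) (pos 0 p.1 k) ≤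
            ENNReal.ofReal b := by
          by_contra! hcon
          exact hA ⟨hgood, hcon⟩
        have hD' : ∑' j, potential p.2 (pos 0 p.1 (L + j)) ≤ ENNReal.ofReal b :=
          (not_le.1 hD).le
        have hlt' : ENNReal.ofReal (b + b) < gammaInf d p.1 p.2 := hlt
        rw [ENNReal.ofReal_add hb.le hb.le] at hlt'
        exact absurd (hlt'.trans_le (((gammaInf_le_tsum_potential hd p.1 p.2).trans hp).trans
          (add_le_add hA' hD'))) (lt_irrefl _)
    _ ≤ (ν.prod ν) (Set.univ ×ˢ B) + (ν.prod ν) A + (ν.prod ν) D :=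
        (measure_union_le _ _).trans (add_le_add (measure_union_le _ _) le_rfl)
    _ ≤ _ := by
        refine add_le_add (add_le_add ?_ (h.measure_potential_box_prod_le hd0 ha b)) ?_
        · rw [Measure.prod_prod, measure_univ, one_mul]
          exact h.measure_exists_farKernel_le hd0 hσ hM L a
        · refine (meas_ge_le_lintegral_div (AEMeasurable.tsum fun j =>
            (measurable_potential_pos (L + j)).aemeasurable) (by simpa using hb)
            ENNReal.ofReal_ne_top).trans ?_
          gcongr
          exact h.lintegral_potential_tail_le hd0 L

end UpperTail

section UpperAsymptotics

variable {d : ℕ}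

lemma rpow_split {t : ℝ} (ht : 0 < t) :
    t ^ (1 - 2 / ((d : ℝ) - 2)) * t ^ (2 / ((d : ℝ) - 2)) = t := by
  rw [← Real.rpow_add ht, sub_add_cancel, Real.rpow_one]

lemma exponent_pos (hd : 7 ≤ d) : 0 < 1 - 2 / ((d : ℝ) - 2) := by
  have : (7 : ℝ) ≤ d := by exact_mod_cast hd
  rw [sub_pos, div_lt_one (by linarith)]
  linarith

lemma rpow_rpow_exponent (hd : 7 ≤ d) {t : ℝ} (ht : 0 < t) :
    (t ^ (2 / ((d : ℝ) - 2))) ^ ((d : ℝ) / 2 - 2) = t ^ (1 - 2 / ((d : ℝ) - 2)) := by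
  have : (7 : ℝ) ≤ d := by exact_mod_cast hd
  have h2 : (d : ℝ) - 2 ≠ 0 := by linarith
  rw [← Real.rpow_mul ht.le]
  congr 1
  field_simp
  ring

theorem exists_gammaInf_upper (hd : 7 ≤ d) : ∃ c : ℝ, 0 < c ∧ ∃ t₀ : ℝ, ∀ t : ℝ, t₀ ≤ t →
    ∀ ν : Measure (ℕ → V d), IsWalk ν →
      (ν.prod ν) {p | ENNReal.ofReal t < gammaInf d p.1 p.2} ≤
        ENNReal.ofReal (Real.exp (-c * t ^ (1 - 2 / ((d : ℝ) - 2)))) := by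
  have hd7 : (7 : ℝ) ≤ d := by exact_mod_cast hd
  obtain ⟨C, hC, htail⟩ := exists_tsum_hk_le (d := d) 2 (by push_cast; linarith)
  have htail' : ∀ (M : ℕ) (z : V d), 1 ≤ M →
      tailSum M z ≤ ENNReal.ofReal (C * (M : ℝ) ^ (3 - (d : ℝ) / 2)) := by
    intro M z hM
    refine (htail M z hM).trans (le_of_eq ?_)
    congr 3
    push_cast
    ring
  set K : ℝ := 2 * C * (2 * d + 1) with hK
  have hK0 : 0 < K := by positivity
  set c : ℝ := 1 / (8 * (K + 1)) with hc
  have hc0 : 0 < c := by positivity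
  have hc1 : c ≤ 1 := by
    rw [hc, div_le_one (by positivity)]
    linarith
  set A : ℝ := 2 * 5 ^ d + 2 + C with hA
  have hA0 : 0 < A := by positivity
  have hev : ∀ᶠ t : ℝ in atTop, Real.log A ≤ c / 2 * t ^ (1 - 2 / ((d : ℝ) - 2)) :=
    ((tendsto_rpow_atTop (exponent_pos hd)).const_mul_atTop (half_pos hc0)).eventually_ge_atTop _
  obtain ⟨t₁, ht₁⟩ := eventually_atTop.1 hev
  refine ⟨c / 2, half_pos hc0, max t₁ 2, fun t ht ν h => ?_⟩
  have hlogA := ht₁ t ((le_max_left _ _).trans ht)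
  have ht2 : 2 ≤ t := (le_max_right _ _).trans ht
  have ht0 : 0 < t := by linarith
  have hτβ := rpow_split (d := d) ht0
  have hβτ := rpow_rpow_exponent hd ht0
  set τ : ℝ := t ^ (1 - 2 / ((d : ℝ) - 2)) with hτ
  set β : ℝ := t ^ (2 / ((d : ℝ) - 2)) with hβ
  have hβ1 : 1 ≤ β := Real.one_le_rpow (by linarith) (div_nonneg (by norm_num) (by linarith))
  have hτ0 : 0 < τ := Real.rpow_pos_of_pos ht0 _
  set M : ℕ := ⌈β⌉₊ with hMdef
  have hMβ : β ≤ M := Nat.le_ceil β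
  have hM1 : 1 ≤ M := by exact_mod_cast hβ1.trans hMβ
  have hM0 : (0 : ℝ) < M := by exact_mod_cast hM1
  have hM2 : (M : ℝ) ≤ 2 * β := by
    have := Nat.ceil_lt_add_one (show 0 ≤ β by linarith)
    linarith
  set σ : ℝ := C * (M : ℝ) ^ (3 - (d : ℝ) / 2) with hσ
  have hσ0 : 0 < σ := mul_pos hC (Real.rpow_pos_of_pos hM0 _)
  have hMσ : τ * σ ≤ C * M := by
    have h1 : τ ≤ (M : ℝ) ^ ((d : ℝ) / 2 - 2) := by
      rw [← hβτ]
      exact Real.rpow_le_rpow (by linarith) hMβ (by linarith)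
    calc τ * σ ≤ (M : ℝ) ^ ((d : ℝ) / 2 - 2) * σ := by gcongr
      _ = C * ((M : ℝ) ^ ((d : ℝ) / 2 - 2) * (M : ℝ) ^ (3 - (d : ℝ) / 2)) := by rw [hσ]; ring
      _ = C * M := by
        rw [← Real.rpow_add hM0, show (d : ℝ) / 2 - 2 + (3 - (d : ℝ) / 2) = 1 by ring,
          Real.rpow_one]
  set L : ℕ := ⌈Real.exp (2 * τ)⌉₊ with hL
  have he1 : 1 ≤ Real.exp (2 * τ) := Real.one_le_exp (by linarith)
  have hLe : Real.exp (2 * τ) ≤ L := Nat.le_ceil _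
  have hL1 : 1 ≤ L := by exact_mod_cast he1.trans hLe
  have hL5 : 2 * (L : ℝ) + 1 ≤ 5 * Real.exp (2 * τ) := by
    have := Nat.ceil_lt_add_one (show 0 ≤ Real.exp (2 * τ) by linarith)
    linarith
  have hmain := h.measure_gammaInf_le (by omega) hσ0 (fun z => htail' M z hM1) L
    (a := K * M) (by positivity) (b := t / 2) (by positivity)
  rw [add_halves] at hmain
  refine hmain.trans ?_
  have hT1 : (((2 * L + 1) ^ d : ℕ) : ℝ) * (2 * Real.exp (-(K * M) / (2 * σ))) ≤
      2 * 5 ^ d * Real.exp (-c * τ) := by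
    have h1 : (2 * d + 1) * τ ≤ K * M / (2 * σ) := by
      rw [le_div_iff₀ (by positivity), hK]
      have : (2 * (d : ℝ) + 1) * (τ * σ) ≤ (2 * d + 1) * (C * M) := by gcongr
      linarith
    have h2 : (((2 * L + 1) ^ d : ℕ) : ℝ) ≤ 5 ^ d * Real.exp (2 * d * τ) := by
      push_cast
      calc (2 * (L : ℝ) + 1) ^ d ≤ (5 * Real.exp (2 * τ)) ^ d := by gcongr
        _ = 5 ^ d * Real.exp (2 * d * τ) := by
          rw [mul_pow, ← Real.exp_nat_mul]
          congr 2
          ring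
    calc (((2 * L + 1) ^ d : ℕ) : ℝ) * (2 * Real.exp (-(K * M) / (2 * σ)))
        ≤ (5 ^ d * Real.exp (2 * d * τ)) * (2 * Real.exp (-((2 * d + 1) * τ))) := by
          rw [neg_div]
          gcongr
      _ = 2 * 5 ^ d * Real.exp (-τ) := by
          rw [show -τ = 2 * d * τ + -((2 * d + 1) * τ) by ring, Real.exp_add]
          ring
      _ ≤ 2 * 5 ^ d * Real.exp (-c * τ) := by
          gcongr
          nlinarith
  have hT2 : 2 * Real.exp (-(t / 2) / (2 * (M + K * M))) ≤ 2 * Real.exp (-c * τ) := by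
    have : c * τ ≤ t / 2 / (2 * (M + K * M)) := by
      rw [le_div_iff₀ (by positivity), hc, ← hτβ]
      have h1 : 1 / (8 * (K + 1)) * τ * (2 * (M + K * M)) = τ * M / 4 := by
        field_simp
        ring
      rw [h1]
      nlinarith
    rw [neg_div, neg_mul]
    gcongr
  have hT3 : tailSum L (0 : V d) / ENNReal.ofReal (t / 2) ≤
      ENNReal.ofReal (C * Real.exp (-c * τ)) := by
    have hL0 : (0 : ℝ) < L := by exact_mod_cast hL1
    have h1 : (L : ℝ) ^ (3 - (d : ℝ) / 2) ≤ Real.exp (-c * τ) := by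
      calc (L : ℝ) ^ (3 - (d : ℝ) / 2) ≤ (L : ℝ) ^ (-(1 / 2) : ℝ) :=
            Real.rpow_le_rpow_of_exponent_le (by exact_mod_cast hL1) (by linarith)
        _ ≤ Real.exp (2 * τ) ^ (-(1 / 2) : ℝ) :=
            Real.rpow_le_rpow_of_nonpos (Real.exp_pos _) hLe (by norm_num)
        _ = Real.exp (-τ) := by
            rw [← Real.exp_mul]
            congr 1
            ring
        _ ≤ Real.exp (-c * τ) := by
            gcongr
            nlinarith
    calc tailSum L (0 : V d) / ENNReal.ofReal (t / 2)
        ≤ tailSum L (0 : V d) / 1 := by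
          gcongr
          rw [ENNReal.one_le_ofReal]
          linarith
      _ ≤ ENNReal.ofReal (C * (L : ℝ) ^ (3 - (d : ℝ) / 2)) := by
          rw [div_one]
          exact htail' L 0 hL1
      _ ≤ _ := by gcongr
  calc _ ≤ ENNReal.ofReal (2 * 5 ^ d * Real.exp (-c * τ)) +
        ENNReal.ofReal (2 * Real.exp (-c * τ)) + ENNReal.ofReal (C * Real.exp (-c * τ)) := by
        refine add_le_add (add_le_add ?_ (ENNReal.ofReal_le_ofReal hT2)) hT3
        rw [← ENNReal.ofReal_natCast, ← ENNReal.ofReal_mul (by positivity)]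
        exact ENNReal.ofReal_le_ofReal hT1
    _ = ENNReal.ofReal (A * Real.exp (-c * τ)) := by
        rw [← ENNReal.ofReal_add (by positivity) (by positivity),
          ← ENNReal.ofReal_add (by positivity) (by positivity), hA]
        congr 1
        ring
    _ ≤ _ := by
        refine ENNReal.ofReal_le_ofReal ?_
        calc A * Real.exp (-c * τ) = Real.exp (Real.log A) * Real.exp (-c * τ) := by
              rw [Real.exp_log hA0]
          _ ≤ Real.exp (c / 2 * τ) * Real.exp (-c * τ) := by gcongr
          _ = Real.exp (-(c / 2) * τ) := by
              rw [← Real.exp_add]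
              congr 1
              ring

end UpperAsymptotics

section RealInequalities

lemma two_mul_le_log_sub_log {y : ℝ} (h0 : 0 ≤ y) (h1 : y < 1) :
    2 * y ≤ Real.log (1 + y) - Real.log (1 - y) := by
  have h := Real.hasSum_log_sub_log_of_abs_lt_one (x := y) (by rwa [abs_of_nonneg h0])
  have h2 := le_hasSum h 0 fun k _ => by positivity
  simpa using h2

lemma two_add_sq_le_exp_add_exp_neg {u : ℝ} (h : 0 ≤ u) :
    2 + u ^ 2 ≤ Real.exp u + Real.exp (-u) := by
  have h1 : u / 2 ≤ Real.sinh (u / 2) := Real.self_le_sinh_iff.2 (by linarith)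
  rw [Real.sinh_eq] at h1
  have h2 : Real.exp u = Real.exp (u / 2) ^ 2 := by
    rw [← Real.exp_nat_mul]
    congr 1
    push_cast
    ring
  have h3 : Real.exp (-u) = Real.exp (-(u / 2)) ^ 2 := by
    rw [← Real.exp_nat_mul]
    congr 1
    push_cast
    ring
  have h4 : Real.exp (u / 2) * Real.exp (-(u / 2)) = 1 := by
    rw [← Real.exp_add, add_neg_cancel, Real.exp_zero]
  rw [h2, h3]
  nlinarith

lemma le_rpow_neg_add_rpow_neg_of_nonneg {a y : ℝ} (ha : 0 < a) (h0 : 0 ≤ y) (h1 : y < 1) :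
    2 + a * (a + 1) * y ^ 2 ≤ (1 + y) ^ (-a) + (1 - y) ^ (-a) := by
  have hl := two_mul_le_log_sub_log h0 h1
  have hp : 0 < 1 + y := by linarith
  have hm : 0 < 1 - y := by linarith
  rw [Real.rpow_def_of_pos hp, Real.rpow_def_of_pos hm]
  set p := Real.log (1 + y)
  set q := Real.log (1 - y)
  have hpq : p + q ≤ -y ^ 2 := by
    have h2 : p + q = Real.log (1 - y ^ 2) := by
      rw [← Real.log_mul hp.ne' hm.ne']
      congr 1
      ring
    have h3 : (0 : ℝ) < 1 - y ^ 2 := by nlinarith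
    rw [h2]
    linarith [Real.log_le_sub_one_of_pos h3]
  set u := a * (p - q) / 2 with hu
  have hu1 : a * y ≤ u := by
    rw [hu]
    nlinarith
  have hu0 : 0 ≤ u := le_trans (by positivity) hu1
  have hw : 1 + a * y ^ 2 / 2 ≤ Real.exp (-(a * (p + q) / 2)) := by
    have := Real.add_one_le_exp (-(a * (p + q) / 2))
    nlinarith
  have hc : 2 + (a * y) ^ 2 ≤ Real.exp u + Real.exp (-u) := by
    have := two_add_sq_le_exp_add_exp_neg hu0
    have h3 : (a * y) ^ 2 ≤ u ^ 2 := by gcongr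
    linarith
  calc 2 + a * (a + 1) * y ^ 2 ≤ (1 + a * y ^ 2 / 2) * (2 + (a * y) ^ 2) := by
        have : 0 ≤ a * y ^ 2 / 2 * (a * y) ^ 2 := by positivity
        nlinarith
    _ ≤ Real.exp (-(a * (p + q) / 2)) * (Real.exp u + Real.exp (-u)) := by gcongr
    _ = Real.exp (p * -a) + Real.exp (q * -a) := by
        rw [mul_add, ← Real.exp_add, ← Real.exp_add, add_comm]
        congr 2 <;> rw [hu] <;> ring

lemma le_rpow_neg_add_rpow_neg {a y : ℝ} (ha : 0 < a) (h1 : |y| < 1) :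
    2 + a * (a + 1) * y ^ 2 ≤ (1 + y) ^ (-a) + (1 - y) ^ (-a) := by
  rcases le_total 0 y with h | h
  · exact le_rpow_neg_add_rpow_neg_of_nonneg ha h (lt_of_abs_lt h1)
  · have := le_rpow_neg_add_rpow_neg_of_nonneg ha (y := -y) (by linarith)
      (by linarith [neg_lt_of_abs_lt h1])
    rw [neg_sq, sub_neg_eq_add, ← sub_eq_add_neg] at this
    linarith

lemma exp_le_of_nonneg {w : ℝ} (h : 0 ≤ w) : Real.exp w ≤ 1 + w + w ^ 2 * Real.exp w := by
  have h1 : Real.exp w * (1 - w) ≤ 1 := by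
    have := Real.add_one_le_exp (-w)
    calc Real.exp w * (1 - w) ≤ Real.exp w * Real.exp (-w) := by
          gcongr
          linarith
      _ = 1 := by rw [← Real.exp_add, add_neg_cancel, Real.exp_zero]
  nlinarith

lemma one_sub_rpow_neg_le {a x : ℝ} (ha : 0 < a) (h0 : 0 ≤ x) (h1 : x ≤ 1 / 2) :
    (1 - x) ^ (-a) ≤ 1 + a * x + (2 * a + 4 * a ^ 2 * Real.exp (2 * a)) * x ^ 2 := by
  have hm : 0 < 1 - x := by linarith
  have hlog : -Real.log (1 - x) ≤ x + 2 * x ^ 2 := by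
    have h2 := Real.one_sub_inv_le_log_of_pos hm
    have h3 : (1 - x)⁻¹ ≤ 1 + x + 2 * x ^ 2 := by
      rw [inv_le_iff_one_le_mul₀ hm]
      nlinarith [mul_nonneg (sq_nonneg x) (show 0 ≤ 1 - 2 * x by linarith)]
    linarith
  set w := a * (x + 2 * x ^ 2) with hw
  have hw0 : 0 ≤ w := by positivity
  have hw1 : w ≤ 2 * a * x := by
    rw [hw]
    nlinarith [mul_nonneg (mul_nonneg ha.le h0) (show 0 ≤ 1 - 2 * x by linarith)]
  have hw2 : w ≤ 2 * a := by nlinarith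
  calc (1 - x) ^ (-a) = Real.exp (a * -Real.log (1 - x)) := by
        rw [Real.rpow_def_of_pos hm]
        congr 1
        ring
    _ ≤ Real.exp w := Real.exp_le_exp.2 (mul_le_mul_of_nonneg_left hlog ha.le)
    _ ≤ 1 + w + w ^ 2 * Real.exp w := exp_le_of_nonneg hw0
    _ ≤ 1 + w + (2 * a * x) ^ 2 * Real.exp (2 * a) := by gcongr
    _ = _ := by rw [hw]; ring

end RealInequalities

section GreenLowerBound

variable {d : ℕ}

/-- Squared Euclidean norm. -/
def nsq (z : V d) : ℝ := ∑ i, (z i : ℝ) ^ 2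

lemma nsq_nonneg (z : V d) : 0 ≤ nsq z := Finset.sum_nonneg fun _ _ => sq_nonneg _

lemma sq_le_nsq (z : V d) (i : Fin d) : (z i : ℝ) ^ 2 ≤ nsq z :=
  Finset.single_le_sum (f := fun i => (z i : ℝ) ^ 2) (fun _ _ => sq_nonneg _) (Finset.mem_univ i)

lemma nsq_add_unitStep (z : V d) (i : Fin d) (b : Bool) :
    nsq (z + unitStep (i, b)) = nsq z + 1 + (if b then 1 else -1) * (2 * z i) := by
  have h : ∀ j, (((z + unitStep (i, b)) j : ℤ) : ℝ) ^ 2 =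
      (z j : ℝ) ^ 2 + if j = i then 1 + (if b then 1 else -1) * (2 * (z i : ℝ)) else 0 := by
    intro j
    by_cases hj : j = i
    · subst hj
      cases b <;> simp [unitStep] <;> ring
    · simp [unitStep, hj]
  unfold nsq
  rw [Finset.sum_congr rfl fun j _ => h j, Finset.sum_add_distrib]
  simp
  ring

/-- A function that is superharmonic where negative, and has finite sublevel sets below zero,
is nonnegative. -/
lemma nonneg_of_superharmonic (hd : d ≠ 0) (D : V d → ℝ)
    (hsup : ∀ z, D z < 0 → ∑ e ∈ steps d, D (z + e) ≤ (2 * d : ℕ) * D z)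
    (hfin : ∀ ε < 0, {z | D z ≤ ε}.Finite) (z : V d) : 0 ≤ D z := by
  by_contra! hz
  obtain ⟨w, hw, hmin⟩ := Set.exists_min_image _ D (hfin _ hz) ⟨z, le_refl (D z)⟩
  have hw0 : D w < 0 := lt_of_le_of_lt hw hz
  have hmin' : ∀ y, D w ≤ D y := by
    intro y
    by_cases hy : D y ≤ D z
    · exact hmin y hy
    · exact le_trans hw (not_le.1 hy).le
  let i : Fin d := ⟨0, Nat.pos_of_ne_zero hd⟩
  obtain ⟨v, hv, hmax⟩ := Set.exists_max_image _ (fun y : V d => y i) (hfin _ hw0)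
    ⟨w, le_refl (D w)⟩
  have hvw : D v = D w := le_antisymm hv (hmin' v)
  have hmem : unitStep (i, true) ∈ steps d :=
    Finset.mem_image_of_mem unitStep (Finset.mem_univ _)
  have hle : D (v + unitStep (i, true)) ≤ D w := by
    have h1 := hsup v (by rw [hvw]; exact hw0)
    rw [← Finset.add_sum_erase _ _ hmem] at h1
    have h2 : ((steps d).erase (unitStep (i, true))).card • D w ≤
        ∑ e ∈ (steps d).erase (unitStep (i, true)), D (v + e) :=
      Finset.card_nsmul_le_sum _ _ _ fun e _ => hmin' _
    rw [Finset.card_erase_of_mem hmem, card_steps, nsmul_eq_mul,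
      Nat.cast_sub (by omega)] at h2
    rw [hvw] at h1
    push_cast at h1 h2
    linarith
  have h3 := hmax _ hle
  simp [unitStep] at h3

/-- The barrier `max(|z|² - b, 1)^{-a}`. -/
noncomputable def barrier (a b : ℝ) (z : V d) : ℝ := (max (nsq z - b) 1) ^ (-a)

lemma barrier_le_one {a : ℝ} (ha : 0 < a) (b : ℝ) (z : V d) : barrier a b z ≤ 1 :=
  Real.rpow_le_one_of_one_le_of_nonpos (le_max_right _ _) (by linarith)

lemma finite_nsq_le (R : ℝ) : {z : V d | nsq z ≤ R}.Finite := by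
  refine (box d ⌈R⌉₊).finite_toSet.subset fun z hz => ?_
  rw [Finset.mem_coe, mem_box]
  intro i
  have h1 : (|z i| : ℤ) ≤ (z i) ^ 2 := by
    rw [← sq_abs]
    nlinarith [abs_nonneg (z i), Int.le_self_sq |z i|]
  have h2 : ((z i ^ 2 : ℤ) : ℝ) ≤ ⌈R⌉₊ := by
    push_cast
    exact (sq_le_nsq z i).trans (le_trans hz (Nat.le_ceil R))
  have h3 : z i ^ 2 ≤ (⌈R⌉₊ : ℤ) := by exact_mod_cast h2
  exact h1.trans h3

lemma nsq_le_of_le_barrier {a b ε : ℝ} (ha : 0 < a) (hε : 0 < ε) {z : V d}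
    (h : ε ≤ barrier a b z) : nsq z ≤ b + ε ^ (-a⁻¹) := by
  have hm : (0 : ℝ) < max (nsq z - b) 1 := lt_max_of_lt_right one_pos
  have h1 : max (nsq z - b) 1 ≤ ε ^ (-a⁻¹) := by
    have h2 := Real.rpow_le_rpow_of_nonpos hε h (show -a⁻¹ ≤ 0 by
      have := inv_pos.2 ha
      linarith)
    unfold barrier at h2
    rwa [← Real.rpow_mul hm.le, neg_mul_neg, mul_inv_cancel₀ ha.ne', Real.rpow_one] at h2
  linarith [le_max_left (nsq z - b) 1]

lemma barrier_subharmonic (hd : 3 ≤ d) : ∃ b R : ℝ, 0 ≤ b ∧ ∀ z : V d, R ≤ nsq z →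
    (2 * d : ℕ) * barrier (((d : ℝ) - 2) / 2) b z ≤
      ∑ e ∈ steps d, barrier (((d : ℝ) - 2) / 2) b (z + e) := by
  have hd3 : (3 : ℝ) ≤ d := by exact_mod_cast hd
  set a : ℝ := ((d : ℝ) - 2) / 2 with ha
  have ha0 : 0 < a := by rw [ha]; linarith
  set C : ℝ := 2 * a + 4 * a ^ 2 * Real.exp (2 * a) with hC
  have hC0 : 0 < C := by positivity
  set b : ℝ := 1 + C / a with hb
  have hb1 : 1 ≤ b := by rw [hb]; linarith [div_pos hC0 ha0]
  refine ⟨b, 16 + 4 * b, by linarith, fun z hz => ?_⟩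
  set s := nsq z with hs
  set v := s + 1 - b with hv
  have hv8 : 17 ≤ v := by rw [hv]; linarith
  have hsv : s ≤ 4 / 3 * v := by rw [hv]; linarith
  have hv0 : 0 < v := by linarith
  have hy : ∀ i, |2 * (z i : ℝ) / v| < 1 / 2 := by
    intro i
    have h1 := sq_le_nsq z i
    rw [← hs] at h1
    have h2 : (2 * (z i : ℝ) / v) ^ 2 < (1 / 2) ^ 2 := by
      rw [div_pow, div_lt_iff₀ (by positivity)]
      nlinarith
    exact abs_lt_of_sq_lt_sq h2 (by norm_num)
  have hval : ∀ i (c : Bool), barrier a b (z + unitStep (i, c)) =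
      v ^ (-a) * (1 + (if c then 1 else -1) * (2 * (z i : ℝ) / v)) ^ (-a) := by
    intro i c
    have h1 := abs_lt.1 (hy i)
    have h2 : 1 / 2 ≤ 1 + (if c then 1 else -1) * (2 * (z i : ℝ) / v) := by
      cases c <;> simp <;> linarith
    have h3 : nsq (z + unitStep (i, c)) - b =
        v * (1 + (if c then 1 else -1) * (2 * (z i : ℝ) / v)) := by
      rw [nsq_add_unitStep, ← hs, hv]
      have : s + 1 - b ≠ 0 := hv0.ne'
      field_simp
      ring
    rw [barrier, h3, max_eq_left (by nlinarith), Real.mul_rpow hv0.le (by linarith)]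
  have hsum : v ^ (-a) * (2 * d * (1 + a * s / v ^ 2)) ≤
      ∑ e ∈ steps d, barrier a b (z + e) := by
    rw [sum_steps]
    calc v ^ (-a) * (2 * d * (1 + a * s / v ^ 2))
        = ∑ i : Fin d, v ^ (-a) * (2 + a * (a + 1) * (2 * (z i : ℝ) / v) ^ 2) := by
          rw [← Finset.mul_sum, Finset.sum_add_distrib]
          simp only [div_pow, mul_pow, ← Finset.mul_sum, ← Finset.sum_div]
          rw [show ∑ i, (z i : ℝ) ^ 2 = s from rfl]
          simp only [Finset.sum_const, Finset.card_univ, Fintype.card_fin, nsmul_eq_mul]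
          rw [show a * (a + 1) = a * d / 2 by rw [ha]; ring]
          field_simp
      _ ≤ _ := by
          refine Finset.sum_le_sum fun i _ => ?_
          rw [hval, hval, ← mul_add]
          have h1 := le_rpow_neg_add_rpow_neg ha0 ((hy i).trans (by norm_num))
          simp only [if_true, Bool.false_eq_true, if_false, one_mul, neg_one_mul,
            ← sub_eq_add_neg]
          gcongr
  have hz' : barrier a b z ≤ v ^ (-a) * (1 + a * s / v ^ 2) := by
    have h1 : nsq z - b = v * (1 - 1 / v) := by
      rw [← hs, hv]
      have : s + 1 - b ≠ 0 := hv0.ne'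
      field_simp
      ring
    have hx : 1 / v ≤ 1 / 2 := by
      rw [div_le_div_iff₀ hv0 (by norm_num)]
      linarith
    rw [barrier, max_eq_left (by rw [← hs]; linarith), h1, Real.mul_rpow hv0.le (by linarith)]
    gcongr
    refine (one_sub_rpow_neg_le ha0 (by positivity) hx).trans (le_of_eq ?_)
    rw [← hC, show s = v + C / a by rw [hv, hb]; ring]
    field_simp
    ring
  calc (2 * d : ℕ) * barrier a b z ≤ (2 * d : ℕ) * (v ^ (-a) * (1 + a * s / v ^ 2)) := by gcongr
    _ = v ^ (-a) * (2 * d * (1 + a * s / v ^ 2)) := by push_cast; ring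
    _ ≤ _ := hsum

lemma gr_ne_zero (z : V d) : gr z ≠ 0 := by
  induction hn : ∑ i, (z i).natAbs using Nat.strong_induction_on generalizing z with
  | _ n ih =>
    by_cases hz : z = 0
    · rw [gr_eq_add, if_pos hz]
      exact (add_pos_of_pos_of_nonneg one_pos bot_le).ne'
    · obtain ⟨i, hi⟩ := Function.ne_iff.1 hz
      have hi' : z i ≠ 0 := hi
      obtain ⟨b, hb⟩ : ∃ b : Bool, ((z + unitStep (i, b)) i).natAbs < (z i).natAbs := by
        rcases lt_or_gt_of_ne hi' with h | h
        · refine ⟨true, ?_⟩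
          simp only [Pi.add_apply, unitStep, if_true]
          omega
        · refine ⟨false, ?_⟩
          simp only [Pi.add_apply, unitStep, if_true, Bool.false_eq_true, if_false]
          omega
      have hlt : ∑ j, ((z + unitStep (i, b)) j).natAbs < n := by
        rw [← hn]
        refine Finset.sum_lt_sum (fun j _ => ?_) ⟨i, Finset.mem_univ i, hb⟩
        by_cases hj : j = i
        · subst hj
          exact hb.le
        · simp [unitStep, hj]
      have h1 := ih _ hlt _ rfl
      rw [gr_eq_add, if_neg hz, zero_add, avg]
      refine mul_ne_zero (ENNReal.inv_ne_zero.2 (ENNReal.natCast_ne_top _)) ?_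
      intro h0
      exact h1 (Finset.sum_eq_zero_iff.1 h0 _
        (Finset.mem_image_of_mem unitStep (Finset.mem_univ _)))

theorem exists_le_gr (hd : 5 ≤ d) : ∃ c : ℝ, 0 < c ∧ ∀ z : V d,
    ENNReal.ofReal (c * (1 + nsq z) ^ (-(((d : ℝ) - 2) / 2))) ≤ gr z := by
  have hd5 : (5 : ℝ) ≤ d := by exact_mod_cast hd
  have hd0 : d ≠ 0 := by omega
  obtain ⟨b, R, hb0, hsub⟩ := barrier_subharmonic (d := d) (by omega)
  set a : ℝ := ((d : ℝ) - 2) / 2 with ha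
  have ha0 : 0 < a := by rw [ha]; linarith
  set g : V d → ℝ := fun z => (gr z).toReal with hg
  have hg0 : ∀ z, 0 < g z := fun z => ENNReal.toReal_pos (gr_ne_zero z) (gr_ne_top hd z)
  have hharm : ∀ z : V d, ∑ e ∈ steps d, g (z + e) ≤ (2 * d : ℕ) * g z := by
    intro z
    have h1 : avg gr z ≤ gr z := by
      conv_rhs => rw [gr_eq_add]
      exact le_add_self
    rw [avg, mul_comm, ← div_eq_mul_inv,
      ENNReal.div_le_iff_le_mul (Or.inl (by simpa using hd0)) (Or.inl (ENNReal.natCast_ne_top _))]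
      at h1
    have h2 := ENNReal.toReal_mono
      (ENNReal.mul_ne_top (gr_ne_top hd z) (ENNReal.natCast_ne_top _)) h1
    rw [ENNReal.toReal_sum fun e _ => gr_ne_top hd _, ENNReal.toReal_mul,
      ENNReal.toReal_natCast, mul_comm] at h2
    exact h2
  obtain ⟨c, hc, hcg⟩ : ∃ c : ℝ, 0 < c ∧ ∀ z : V d, nsq z ≤ R → c ≤ g z := by
    by_cases hne : {z : V d | nsq z ≤ R}.Nonempty
    · obtain ⟨w, _, hw⟩ := Set.exists_min_image _ g (finite_nsq_le R) hne
      exact ⟨g w, hg0 w, hw⟩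
    · exact ⟨1, one_pos, fun z hz => absurd ⟨z, hz⟩ hne⟩
  have hD := nonneg_of_superharmonic hd0 (fun z => g z - c * barrier a b z) (fun z hz => by
    have hR : R ≤ nsq z := by
      by_contra! hR
      have h1 := hcg z hR.le
      have h2 := barrier_le_one ha0 b z
      nlinarith
    have h1 := hsub z hR
    have h2 := hharm z
    rw [Finset.sum_sub_distrib, ← Finset.mul_sum]
    nlinarith) (fun ε hε => by
    refine (finite_nsq_le (b + (-ε / c) ^ (-a⁻¹))).subset fun z hz => ?_
    refine nsq_le_of_le_barrier ha0 (div_pos (by linarith) hc) ?_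
    have hz' : g z - c * barrier a b z ≤ ε := hz
    rw [div_le_iff₀ hc]
    linarith [hg0 z])
  refine ⟨c, hc, fun z => ?_⟩
  rw [ENNReal.ofReal_le_iff_le_toReal (gr_ne_top hd z)]
  have h1 : 0 ≤ g z - c * barrier a b z := hD z
  have h2 : (1 + nsq z) ^ (-a) ≤ barrier a b z := by
    refine Real.rpow_le_rpow_of_nonpos (lt_max_of_lt_right one_pos) ?_ (by linarith)
    have := nsq_nonneg z
    exact max_le (by linarith) (by linarith)
  have h3 : c * (1 + nsq z) ^ (-a) ≤ c * barrier a b z := by gcongr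
  exact h3.trans (by linarith)

end GreenLowerBound

section Confinement

variable {d : ℕ}

/-- One-step operator of the walk killed outside `Q`. -/
noncomputable def kill (Q : Set (V d)) (f : V d → ℝ≥0∞) : V d → ℝ≥0∞ := Q.indicator (avg f)

lemma IsWalk.lintegral_kill (hd : d ≠ 0) {ν : Measure (ℕ → V d)} (h : IsWalk ν) (Q : Set (V d))
    (f : V d → ℝ≥0∞) (n : ℕ) (x : V d) :
    ∫⁻ s, (∏ k ∈ range n, Q.indicator 1 (pos x s k)) * f (pos x s n) ∂ν = (kill Q)^[n] f x := by
  have := h.isProbabilityMeasure hd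
  have hmeas : ∀ n x, Measurable fun s : ℕ → V d =>
      (∏ k ∈ range n, Q.indicator (1 : V d → ℝ≥0∞) (pos x s k)) * f (pos x s n) := by
    intro n x
    refine Measurable.mul (Finset.measurable_prod _ fun k _ => ?_)
      ((measurable_of_countable f).comp (measurable_pos x n))
    exact (measurable_of_countable (Q.indicator 1)).comp (measurable_pos x k)
  induction n generalizing x with
  | zero => simp [pos_zero]
  | succ n ih =>
    rw [h.lintegral_cons hd (hmeas (n + 1) x), Function.iterate_succ_apply']
    simp only [Finset.prod_range_succ', pos_cons_succ, pos_zero]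
    have h1 : ∀ e : V d, ∫⁻ s, (∏ k ∈ range n, Q.indicator 1 (pos (x + e) s k)) *
        Q.indicator 1 x * f (pos (x + e) s n) ∂ν = Q.indicator 1 x * (kill Q)^[n] f (x + e) := by
      intro e
      rw [← ih, ← lintegral_const_mul _ (hmeas n (x + e))]
      refine lintegral_congr fun s => ?_
      ring
    rw [Finset.sum_congr rfl fun e _ => h1 e, ← Finset.mul_sum]
    by_cases hx : x ∈ Q
    · simp [kill, hx, avg]
    · simp [kill, hx]

/-- Change of signs of the coordinates. -/
def reflect (σ : Fin d → Bool) (z : V d) : V d := fun i => (if σ i then 1 else -1) * z i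

lemma reflect_reflect (σ : Fin d → Bool) (z : V d) : reflect σ (reflect σ z) = z := by
  funext i
  simp only [reflect]
  split_ifs <;> simp

lemma reflect_add (σ : Fin d → Bool) (z w : V d) :
    reflect σ (z + w) = reflect σ z + reflect σ w := by
  funext i
  simp [reflect, mul_add]

lemma reflect_mem_steps (σ : Fin d → Bool) {e : V d} (he : e ∈ steps d) :
    reflect σ e ∈ steps d := by
  rw [steps_eq, Finset.mem_image] at he ⊢
  obtain ⟨⟨i, b⟩, -, rfl⟩ := he
  refine ⟨(i, if σ i then b else !b), Finset.mem_univ _, ?_⟩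
  funext j
  by_cases hj : j = i
  · subst hj
    cases h : σ j <;> cases b <;> simp [reflect, unitStep, h]
  · simp [reflect, unitStep, hj]

lemma avg_comp_reflect (σ : Fin d → Bool) (f : V d → ℝ≥0∞) (x : V d) :
    avg (fun y => f (reflect σ y)) x = avg f (reflect σ x) := by
  unfold avg
  congr 1
  refine Finset.sum_nbij' (reflect σ) (reflect σ) (fun e he => reflect_mem_steps σ he)
    (fun e he => reflect_mem_steps σ he) (fun e _ => reflect_reflect σ e)
    (fun e _ => reflect_reflect σ e)
    fun e _ => ?_
  beta_reduce
  rw [reflect_add]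

lemma iter_kill_comp_reflect {Q : Set (V d)} {σ : Fin d → Bool} (hQ : ∀ x, reflect σ x ∈ Q ↔ x ∈ Q)
    (f : V d → ℝ≥0∞) (n : ℕ) (x : V d) :
    (kill Q)^[n] (fun y => f (reflect σ y)) x = (kill Q)^[n] f (reflect σ x) := by
  induction n generalizing x with
  | zero => rfl
  | succ n ih =>
    rw [Function.iterate_succ_apply', Function.iterate_succ_apply', funext ih]
    by_cases hx : x ∈ Q
    · rw [kill, kill, Set.indicator_of_mem hx, Set.indicator_of_mem ((hQ x).2 hx), avg_comp_reflect]
    · rw [kill, kill, Set.indicator_of_notMem hx,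
        Set.indicator_of_notMem (fun h => hx ((hQ x).1 h))]

lemma reflect_mem_box (σ : Fin d → Bool) (r : ℕ) (x : V d) :
    reflect σ x ∈ (box d r : Set (V d)) ↔ x ∈ (box d r : Set (V d)) := by
  simp only [Finset.mem_coe, mem_box]
  refine forall_congr' fun i => ?_
  simp only [reflect]
  split_ifs <;> simp

lemma avg_ofReal_nsq (hd : d ≠ 0) {r : ℝ} (n : ℕ) (x : V d) :
    avg (fun y => ENNReal.ofReal ((nsq y + n) / r ^ 2)) x =
      ENNReal.ofReal ((nsq x + (n + 1 : ℕ)) / r ^ 2) := by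
  have hnn : ∀ (m : ℕ) (y : V d), 0 ≤ (nsq y + m) / r ^ 2 := fun m y => by
    have := nsq_nonneg y
    positivity
  have hd' : (0 : ℝ) < (2 * d : ℕ) := by
    have : 0 < d := Nat.pos_of_ne_zero hd
    exact_mod_cast (by omega : 0 < 2 * d)
  have hsum : ∑ e ∈ steps d, (nsq (x + e) + n) / r ^ 2 =
      (2 * d : ℕ) * ((nsq x + (n + 1 : ℕ)) / r ^ 2) := by
    rw [sum_steps]
    have : ∀ i : Fin d, (nsq (x + unitStep (i, true)) + n) / r ^ 2 +
        (nsq (x + unitStep (i, false)) + n) / r ^ 2 = 2 * ((nsq x + (n + 1 : ℕ)) / r ^ 2) := by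
      intro i
      rw [nsq_add_unitStep, nsq_add_unitStep]
      simp only [if_true, Bool.false_eq_true, if_false]
      push_cast
      ring
    simp only [this, Finset.sum_const, Finset.card_univ, Fintype.card_fin, nsmul_eq_mul]
    push_cast
    ring
  rw [avg, ← ENNReal.ofReal_sum_of_nonneg fun e _ => hnn n _, hsum,
    ENNReal.ofReal_mul hd'.le, ENNReal.ofReal_natCast, ← mul_assoc,
    ENNReal.inv_mul_cancel (by simpa using hd) (ENNReal.natCast_ne_top _), one_mul]

lemma one_le_iter_kill_add (hd : d ≠ 0) {r : ℕ} (hr : 1 ≤ r) (n : ℕ) (x : V d) :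
    1 ≤ (kill (box d r : Set (V d)))^[n] ((box d r : Set (V d)).indicator 1) x +
      ENNReal.ofReal ((nsq x + n) / (r : ℝ) ^ 2) := by
  have hr0 : (0 : ℝ) < r := by exact_mod_cast hr
  have hout : ∀ (m : ℕ) (y : V d), y ∉ (box d r : Set (V d)) →
      1 ≤ ENNReal.ofReal ((nsq y + m) / (r : ℝ) ^ 2) := by
    intro m y hy
    rw [Finset.mem_coe, mem_box] at hy
    push Not at hy
    obtain ⟨i, hi⟩ := hy
    have h1 : (r : ℝ) < |(y i : ℝ)| := by exact_mod_cast hi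
    have h2 : (r : ℝ) ^ 2 ≤ (y i : ℝ) ^ 2 := by
      rw [← sq_abs (y i : ℝ)]
      gcongr
    rw [ENNReal.one_le_ofReal, le_div_iff₀ (by positivity)]
    have := sq_le_nsq y i
    have : (0 : ℝ) ≤ m := by positivity
    linarith
  induction n generalizing x with
  | zero =>
    by_cases hx : x ∈ (box d r : Set (V d))
    · rw [Function.iterate_zero, id, Set.indicator_of_mem hx]
      exact le_self_add
    · exact (hout 0 x hx).trans le_add_self
  | succ n ih =>
    by_cases hx : x ∈ (box d r : Set (V d))
    · rw [Function.iterate_succ_apply', kill, Set.indicator_of_mem hx, ← avg_ofReal_nsq hd]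
      calc (1 : ℝ≥0∞) = avg (fun _ => 1) x := by rw [avg_const hd]
        _ ≤ avg (fun y => (kill (box d r : Set (V d)))^[n] ((box d r : Set (V d)).indicator 1) y +
            ENNReal.ofReal ((nsq y + n) / (r : ℝ) ^ 2)) x := avg_mono ih x
        _ = _ := by
          rw [avg_add]
    · exact (hout (n + 1) x hx).trans le_add_self

/-- The walk stays in a box for a time of the order of its squared size, ending in a prescribed
orthant, with probability bounded below. -/
lemma IsWalk.le_measure_confined (hd : d ≠ 0) {ν : Measure (ℕ → V d)} (h : IsWalk ν) {r n : ℕ}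
    (hr : 1 ≤ r) (hn : 2 * n ≤ r ^ 2) (z : V d) :
    ((2 : ℝ≥0∞) ^ (d + 1))⁻¹ ≤
      ν {s | (∀ k ≤ n, pos 0 s k ∈ box d r) ∧ ∀ i, pos 0 s n i * z i ≤ 0} := by
  have := h.isProbabilityMeasure hd
  set Q : Set (V d) := (box d r : Set (V d)) with hQ
  set O : Set (V d) := {y | ∀ i, y i * z i ≤ 0} with hO
  set A : Set (ℕ → V d) := {s | (∀ k ≤ n, pos 0 s k ∈ box d r) ∧ ∀ i, pos 0 s n i * z i ≤ 0} with hA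
  have hr0 : (0 : ℝ) < r := by exact_mod_cast hr
  have h1 : (2 : ℝ≥0∞)⁻¹ ≤ (kill Q)^[n] (Q.indicator 1) 0 := by
    have h2 := one_le_iter_kill_add hd hr n (0 : V d)
    have h3 : ENNReal.ofReal ((nsq (0 : V d) + n) / (r : ℝ) ^ 2) ≤ 2⁻¹ := by
      rw [← ENNReal.ofReal_ofNat 2, ← ENNReal.ofReal_inv_of_pos (by norm_num)]
      refine ENNReal.ofReal_le_ofReal ?_
      have h4 : (2 : ℝ) * n ≤ r ^ 2 := by exact_mod_cast hn
      rw [div_le_iff₀ (by positivity)]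
      simp only [nsq, Pi.zero_apply, Int.cast_zero, ne_eq, OfNat.ofNat_ne_zero, not_false_eq_true,
        zero_pow, Finset.sum_const_zero, zero_add]
      linarith
    have h5 : (1 : ℝ≥0∞) ≤ (kill Q)^[n] (Q.indicator 1) 0 + 2⁻¹ := h2.trans (by gcongr)
    rw [← ENNReal.inv_two_add_inv_two] at h5
    exact (ENNReal.add_le_add_iff_right (by simp)).1 h5
  have hcover : ∀ x, Q.indicator (1 : V d → ℝ≥0∞) x ≤
      ∑ σ : Fin d → Bool, (Q ∩ O).indicator 1 (reflect σ x) := by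
    intro x
    by_cases hx : x ∈ Q
    · let σ : Fin d → Bool := fun i => decide (x i * z i ≤ 0)
      have hσ : reflect σ x ∈ Q ∩ O := by
        refine ⟨(reflect_mem_box σ r x).2 hx, fun i => ?_⟩
        by_cases hi : x i * z i ≤ 0
        · simp [reflect, σ, hi]
        · simp only [reflect, σ, hi, decide_false, Bool.false_eq_true, if_false]
          linarith
      rw [Set.indicator_of_mem hx]
      refine le_trans ?_ (Finset.single_le_sum (f := fun σ : Fin d → Bool =>
        (Q ∩ O).indicator (1 : V d → ℝ≥0∞) (reflect σ x)) (fun _ _ => bot_le) (Finset.mem_univ σ))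
      simp only [Set.indicator_of_mem hσ]
      exact le_rfl
    · rw [Set.indicator_of_notMem hx]
      exact bot_le
  have hle : (kill Q)^[n] ((Q ∩ O).indicator 1) 0 ≤ ν A := by
    rw [← h.lintegral_kill hd]
    refine le_trans (lintegral_mono (g := A.indicator 1) fun s => ?_)
      (lintegral_indicator_one_le A)
    by_cases hs : s ∈ A
    · rw [Set.indicator_of_mem hs]
      exact mul_le_one' (Finset.prod_le_one' fun k _ =>
        Set.indicator_le (g := 1) (fun _ _ => le_rfl) _)
        (Set.indicator_le (g := 1) (fun _ _ => le_rfl) _)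
    · have hs' : ¬((∀ k ≤ n, pos 0 s k ∈ box d r) ∧ ∀ i, pos 0 s n i * z i ≤ 0) := hs
      rw [Set.indicator_of_notMem hs, nonpos_iff_eq_zero, mul_eq_zero]
      by_contra! hcon
      refine hs' ⟨fun k hk => ?_, ?_⟩
      · rcases hk.lt_or_eq with hk | rfl
        · have := Finset.prod_ne_zero_iff.1 hcon.1 k (Finset.mem_range.2 hk)
          exact Set.mem_of_indicator_ne_zero this
        · exact (Set.mem_of_indicator_ne_zero hcon.2).1
      · exact (Set.mem_of_indicator_ne_zero hcon.2).2
  have hmain : (2 : ℝ≥0∞)⁻¹ ≤ 2 ^ d * ν A := by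
    calc (2 : ℝ≥0∞)⁻¹ ≤ (kill Q)^[n] (Q.indicator 1) 0 := h1
      _ = ∫⁻ s, (∏ k ∈ range n, Q.indicator 1 (pos 0 s k)) * Q.indicator 1 (pos 0 s n) ∂ν :=
          (h.lintegral_kill hd _ _ _ _).symm
      _ ≤ ∫⁻ s, ∑ σ : Fin d → Bool, (∏ k ∈ range n, Q.indicator 1 (pos 0 s k)) *
            (Q ∩ O).indicator 1 (reflect σ (pos 0 s n)) ∂ν := by
          refine lintegral_mono fun s => ?_
          rw [← Finset.mul_sum]
          gcongr
          exact hcover _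
      _ = ∑ σ : Fin d → Bool, ∫⁻ s, (∏ k ∈ range n, Q.indicator 1 (pos 0 s k)) *
            (Q ∩ O).indicator 1 (reflect σ (pos 0 s n)) ∂ν := by
          refine lintegral_finsetSum _ fun σ _ => ?_
          refine Measurable.mul (Finset.measurable_prod _ fun k _ => ?_) ?_
          · exact (measurable_of_countable (Q.indicator 1)).comp (measurable_pos 0 k)
          · exact (measurable_of_countable fun y => (Q ∩ O).indicator 1 (reflect σ y)).comp
              (measurable_pos 0 n)
      _ = ∑ σ : Fin d → Bool, (kill Q)^[n] ((Q ∩ O).indicator 1) 0 := by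
          refine Finset.sum_congr rfl fun σ _ => ?_
          rw [h.lintegral_kill hd Q (fun y => (Q ∩ O).indicator 1 (reflect σ y)),
            iter_kill_comp_reflect (reflect_mem_box σ r)]
          have h0 : reflect σ (0 : V d) = 0 := by
            funext i
            simp [reflect]
          rw [h0]
      _ ≤ ∑ σ : Fin d → Bool, ν A := Finset.sum_le_sum fun _ _ => hle
      _ = 2 ^ d * ν A := by simp
  rw [pow_succ, ENNReal.mul_inv (by simp) (by simp)]
  calc ((2 : ℝ≥0∞) ^ d)⁻¹ * 2⁻¹ ≤ (2 ^ d)⁻¹ * (2 ^ d * ν A) := by gcongr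
    _ = ν A := by
      rw [← mul_assoc, ENNReal.inv_mul_cancel (by simp) (by simp), one_mul]

end Confinement

section Capacity

variable {d : ℕ}

lemma exists_subset_card_le {ι : Type*} (P : Finset ι) (g : ι → ℝ≥0∞) {B : ℝ≥0∞} (hB0 : B ≠ 0)
    (hB : B ≠ ∞) (h : ∑ p ∈ P, g p ≤ B * P.card) :
    ∃ P' ⊆ P, P.card ≤ 2 * P'.card ∧ ∀ p ∈ P', g p ≤ 2 * B := by
  classical
  refine ⟨P.filter fun p => g p ≤ 2 * B, Finset.filter_subset _ _, ?_,
    fun p hp => (Finset.mem_filter.1 hp).2⟩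
  have h1 : B * (2 * (P.filter fun p => ¬g p ≤ 2 * B).card : ℕ) ≤ B * P.card := by
    calc B * (2 * (P.filter fun p => ¬g p ≤ 2 * B).card : ℕ)
        = ∑ p ∈ P.filter fun p => ¬g p ≤ 2 * B, 2 * B := by
          rw [Finset.sum_const, nsmul_eq_mul]
          push_cast
          ring
      _ ≤ ∑ p ∈ P.filter fun p => ¬g p ≤ 2 * B, g p :=
          Finset.sum_le_sum fun p hp => (not_le.1 (Finset.mem_filter.1 hp).2).le
      _ ≤ ∑ p ∈ P, g p := Finset.sum_le_sum_of_subset (Finset.filter_subset _ _)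
      _ ≤ B * P.card := h
  rw [ENNReal.mul_le_mul_iff_right hB0 hB] at h1
  have h2 : 2 * (P.filter fun p => ¬g p ≤ 2 * B).card ≤ P.card := by exact_mod_cast h1
  have h3 := Finset.card_filter_add_card_filter_not (s := P) (fun p => g p ≤ 2 * B)
  omega

open Classical in
lemma green_sum_single {ι : Type*} (P : Finset ι) (X : ι → V d) (x : V d) :
    green (fun v => ∑ p ∈ P, if v = X p then 1 else 0) x = ∑ p ∈ P, gr (X p - x) := by
  rw [green_eq_tsum]
  simp only [Finset.mul_sum]
  rw [Summable.tsum_finsetSum fun _ _ => ENNReal.summable]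
  refine Finset.sum_congr rfl fun p _ => ?_
  rw [tsum_eq_single (X p) fun v hv => by rw [if_neg hv, mul_zero], if_pos rfl, mul_one]

lemma card_mul_le_potential (hd : d ≠ 0) {ι : Type*} (P : Finset ι) (τ : ι → ℕ) (s : ℕ → V d)
    {x : V d} (hx : green ((Set.range (pos 0 s)).indicator 1) x ≠ ∞) {K g : ℝ≥0∞}
    (hK : ∀ q ∈ P, ∑ p ∈ P, gr (pos 0 s (τ p) - pos 0 s (τ q)) ≤ K)
    (hg : ∀ p ∈ P, g ≤ gr (pos 0 s (τ p) - x)) : P.card * g ≤ K * potential s x := by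
  classical
  set F : Set (V d) := (fun p => pos 0 s (τ p)) '' (P : Set ι) with hF
  have h1 : F ⊆ Set.range (pos 0 s) := by
    rintro _ ⟨p, _, rfl⟩
    exact ⟨τ p, rfl⟩
  have h2 := green_le_mul_green_equil hd (K := K)
    (w := fun v => ∑ p ∈ P, if v = pos 0 s (τ p) then 1 else 0) h1 hx (fun y hy => by
      refine Finset.sum_eq_zero fun p hp => if_neg ?_
      rintro rfl
      exact hy ⟨p, hp, rfl⟩) (fun y hy => by
      obtain ⟨q, hq, rfl⟩ := hy
      rw [green_sum_single P (fun p => pos 0 s (τ p))]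
      exact hK q hq)
  rw [green_sum_single P (fun p => pos 0 s (τ p))] at h2
  refine le_trans ?_ h2
  rw [← nsmul_eq_mul]
  exact Finset.card_nsmul_le_sum _ _ _ hg

lemma one_le_gr_zero : 1 ≤ gr (0 : V d) := by
  rw [gr_eq_add, if_pos rfl]
  exact le_self_add

open Classical in
lemma card_le_mul_card_image_pos {ι : Type*} (P : Finset ι) (X : ι → V d) {K : ℝ≥0∞}
    (hK : ∀ q ∈ P, ∑ p ∈ P, gr (X p - X q) ≤ K) : (P.card : ℝ≥0∞) ≤ K * (P.image X).card := by
  rw [Finset.card_eq_sum_card_image X P, Nat.cast_sum, mul_comm, ← nsmul_eq_mul]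
  refine Finset.sum_le_card_nsmul _ _ _ fun y hy => ?_
  obtain ⟨q, hq, rfl⟩ := Finset.mem_image.1 hy
  calc ((P.filter fun p => X p = X q).card : ℝ≥0∞)
      = ∑ p ∈ P.filter fun p => X p = X q, 1 := by simp
    _ ≤ ∑ p ∈ P.filter fun p => X p = X q, gr (X p - X q) := by
        refine Finset.sum_le_sum fun p hp => ?_
        rw [(Finset.mem_filter.1 hp).2, sub_self]
        exact one_le_gr_zero
    _ ≤ ∑ p ∈ P, gr (X p - X q) := Finset.sum_le_sum_of_subset (Finset.filter_subset _ _)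
    _ ≤ K := hK q hq

/-- Lower bound for `gammaInf` for two paths with many points of controlled energy in a box. -/
lemma card_sq_mul_le_gammaInf (hd : 5 ≤ d) {ι : Type*} (P : Finset ι) (τ : ι → ℕ)
    (sA sB : ℕ → V d) {B g : ℝ≥0∞} (hB0 : B ≠ 0) (hB : B ≠ ∞)
    (hfin : ∀ x, green ((Set.range (pos 0 sB)).indicator 1) x ≠ ∞)
    (hA : ∑ q ∈ P, ∑ p ∈ P, gr (pos 0 sA (τ p) - pos 0 sA (τ q)) ≤ B * P.card)
    (hB' : ∑ q ∈ P, ∑ p ∈ P, gr (pos 0 sB (τ p) - pos 0 sB (τ q)) ≤ B * P.card)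
    (hg : ∀ p ∈ P, ∀ q ∈ P, g ≤ gr (pos 0 sB (τ p) - pos 0 sA (τ q))) :
    (P.card : ℝ≥0∞) ^ 2 * g ≤ 16 * B ^ 2 * gammaInf d sA sB := by
  classical
  have hd0 : d ≠ 0 := by omega
  obtain ⟨PA, hPA, hcA, hKA⟩ := exists_subset_card_le P _ hB0 hB hA
  obtain ⟨PB, hPB, hcB, hKB⟩ := exists_subset_card_le P _ hB0 hB hB'
  have hcA' : (P.card : ℝ≥0∞) ≤ 2 * PA.card := by exact_mod_cast hcA
  have hcB' : (P.card : ℝ≥0∞) ≤ 2 * PB.card := by exact_mod_cast hcB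
  set X : ι → V d := fun p => pos 0 sA (τ p) with hX
  have hF : (PA.card : ℝ≥0∞) ≤ 2 * B * (PA.image X).card :=
    card_le_mul_card_image_pos PA X fun q hq =>
      (Finset.sum_le_sum_of_subset hPA).trans (hKA q hq)
  have hpot : ∀ x ∈ PA.image X, PB.card * g ≤ 2 * B * potential sB x := by
    intro x hx
    obtain ⟨q, hq, rfl⟩ := Finset.mem_image.1 hx
    exact card_mul_le_potential hd0 PB τ sB (hfin _)
      (fun q hq => (Finset.sum_le_sum_of_subset hPB).trans (hKB q hq))
      fun p hp => hg p (hPB hp) q (hPA hq)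
  have hgam : ∑ x ∈ PA.image X, potential sB x ≤ gammaInf d sA sB := by
    rw [gammaInf_eq hd0 (gr_ne_top hd)]
    refine le_trans (le_of_eq ?_) (ENNReal.sum_le_tsum (PA.image X))
    refine Finset.sum_congr rfl fun x hx => ?_
    obtain ⟨q, hq, rfl⟩ := Finset.mem_image.1 hx
    rw [Set.indicator_of_mem (show X q ∈ Set.range (pos 0 sA) from ⟨τ q, rfl⟩)]
    rfl
  have h2 : (PA.image X).card * (PB.card * g) ≤ 2 * B * gammaInf d sA sB := by
    rw [← nsmul_eq_mul]
    refine (Finset.card_nsmul_le_sum _ _ _ hpot).trans ?_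
    rw [← Finset.mul_sum]
    gcongr
  calc (P.card : ℝ≥0∞) ^ 2 * g = P.card * (P.card * g) := by ring
    _ ≤ (2 * (2 * B * (PA.image X).card)) * (2 * PB.card * g) := by
        gcongr
        exact hcA'.trans (by gcongr)
    _ = 8 * B * ((PA.image X).card * (PB.card * g)) := by ring
    _ ≤ 8 * B * (2 * B * gammaInf d sA sB) := by gcongr
    _ = 16 * B ^ 2 * gammaInf d sA sB := by ring

lemma IsWalk.ae_green_range_ne_top (hd : 5 ≤ d) {ν : Measure (ℕ → V d)} (h : IsWalk ν) :
    ∀ᵐ s ∂ν, ∀ x, green ((Set.range (pos 0 s)).indicator 1) x ≠ ∞ := by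
  rw [ae_all_iff]
  intro x
  obtain ⟨C, -, hC⟩ := exists_tsum_succ_mul_hk_le hd
  have h1 : ∫⁻ s, ∑' j, gr (pos 0 s j - x) ∂ν ≠ ∞ := by
    rw [h.lintegral_tsum_gr (by omega)]
    exact ((hC x).trans_lt ENNReal.ofReal_lt_top).ne
  filter_upwards [ae_lt_top (measurable_tsum_pos fun y => gr (y - x)) h1] with s hs
  refine (lt_of_le_of_lt ?_ hs).ne
  rw [green_eq_tsum]
  refine le_trans (le_of_eq ?_) (tsum_indicator_range_le (pos 0 s) fun y => gr (y - x))
  refine tsum_congr fun y => ?_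
  by_cases hy : y ∈ Set.range (pos 0 s) <;> simp [hy]

end Capacity

section BlockEnergy

variable {d : ℕ}

lemma IsWalk.lintegral_gr_sub (hd : d ≠ 0) {ν : Measure (ℕ → V d)} (h : IsWalk ν) (z : V d)
    {k l : ℕ} (hkl : k ≤ l) :
    ∫⁻ s, gr (pos z s k - pos z s l) ∂ν = ∑' n, hk (n + (l - k)) (0 : V d) := by
  have := h.isProbabilityMeasure hd
  obtain ⟨j, rfl⟩ := Nat.exists_eq_add_of_le hkl
  have hmeas : Measurable fun s : ℕ → V d => gr (pos z s k - pos z s (k + j)) :=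
    (measurable_of_countable gr).comp ((measurable_pos z k).sub (measurable_pos z (k + j)))
  rw [h.lintegral_concat hd k hmeas]
  have h1 : ∀ s : ℕ → V d, ∫⁻ s', gr (pos z (concat k s s') k - pos z (concat k s s') (k + j)) ∂ν
      = ∑' n, hk (n + j) (0 : V d) := by
    intro s
    simp only [pos_concat_add, pos_concat_of_le z (le_refl k)]
    set x := pos z s k
    rw [h.lintegral_pos hd (fun y => gr (x - y)) j x]
    simp only [gr]
    rw [iter_avg_tsum]
    refine tsum_congr fun n => ?_
    rw [iter_avg_hk_sub, sub_self, add_comm]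
  simp only [h1, lintegral_const, measure_univ, mul_one, Nat.add_sub_cancel_left]

lemma sum_range_dist_le (a : ℕ → ℝ≥0∞) (k T : ℕ) :
    ∑ l ∈ Finset.range T, a (max k l - min k l) ≤ 2 * ∑' n, a n := by
  classical
  have hA : ∑ l ∈ (Finset.range T).filter (fun l => l ≤ k), a (max k l - min k l) ≤ ∑' n, a n := by
    calc _ = ∑ l ∈ (Finset.range T).filter (fun l => l ≤ k), a (k - l) := by
          refine Finset.sum_congr rfl fun l hl => ?_
          have := (Finset.mem_filter.1 hl).2
          rw [max_eq_left this, min_eq_right this]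
      _ = ∑ n ∈ ((Finset.range T).filter (fun l => l ≤ k)).image (fun l => k - l), a n := by
          rw [Finset.sum_image]
          intro x hx y hy hxy
          have h1 := (Finset.mem_filter.1 hx).2
          have h2 := (Finset.mem_filter.1 hy).2
          simp only at hxy
          omega
      _ ≤ _ := ENNReal.sum_le_tsum _
  have hB : ∑ l ∈ (Finset.range T).filter (fun l => ¬l ≤ k), a (max k l - min k l)
      ≤ ∑' n, a n := by
    calc _ = ∑ l ∈ (Finset.range T).filter (fun l => ¬l ≤ k), a (l - k) := by
          refine Finset.sum_congr rfl fun l hl => ?_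
          have := (not_le.1 (Finset.mem_filter.1 hl).2).le
          rw [max_eq_right this, min_eq_left this]
      _ = ∑ n ∈ ((Finset.range T).filter (fun l => ¬l ≤ k)).image (fun l => l - k), a n := by
          rw [Finset.sum_image]
          intro x hx y hy hxy
          have h1 := (Finset.mem_filter.1 hx).2
          have h2 := (Finset.mem_filter.1 hy).2
          simp only at hxy
          omega
      _ ≤ _ := ENNReal.sum_le_tsum _
  rw [← Finset.sum_filter_add_sum_filter_not _ (fun l => l ≤ k), two_mul]
  exact add_le_add hA hB

lemma IsWalk.lintegral_selfEnergy_le (hd : d ≠ 0) {ν : Measure (ℕ → V d)} (h : IsWalk ν)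
    (z : V d) (H T : ℕ) :
    ∫⁻ s, ∑ k ∈ Finset.Ico H T, ∑ l ∈ Finset.Ico H T, gr (pos z s k - pos z s l) ∂ν
      ≤ T * (2 * ∑' n, ((n + 1 : ℕ) : ℝ≥0∞) * hk n (0 : V d)) := by
  have hmeas : ∀ k l, Measurable fun s : ℕ → V d => gr (pos z s k - pos z s l) := fun k l =>
    (measurable_of_countable gr).comp ((measurable_pos z k).sub (measurable_pos z l))
  have hkl : ∀ k l, ∫⁻ s, gr (pos z s k - pos z s l) ∂ν
      = ∑' n, hk (n + (max k l - min k l)) (0 : V d) := by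
    intro k l
    rcases le_total k l with hle | hle
    · rw [h.lintegral_gr_sub hd z hle, max_eq_right hle, min_eq_left hle]
    · simp_rw [gr_sub_comm (pos z _ k)]
      rw [h.lintegral_gr_sub hd z hle, max_eq_left hle, min_eq_right hle]
  rw [lintegral_finsetSum _ fun k _ => Finset.measurable_fun_sum _ fun l _ => hmeas k l]
  have hsub : Finset.Ico H T ⊆ Finset.range T := fun x hx =>
    Finset.mem_range.2 (Finset.mem_Ico.1 hx).2
  calc _ ≤ ∑ k ∈ Finset.Ico H T, 2 * ∑' n, ((n + 1 : ℕ) : ℝ≥0∞) * hk n (0 : V d) := by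
        refine Finset.sum_le_sum fun k _ => ?_
        rw [lintegral_finsetSum _ fun l _ => hmeas k l]
        simp only [hkl]
        refine (Finset.sum_le_sum_of_subset hsub).trans ?_
        refine (sum_range_dist_le (fun m => ∑' n, hk (n + m) (0 : V d)) k T).trans ?_
        rw [← tsum_tsum_add fun n => hk n (0 : V d)]
        simp only [add_comm]
        exact le_rfl
    _ ≤ _ := by
        rw [Finset.sum_const, nsmul_eq_mul]
        gcongr
        simp

lemma IsWalk.lintegral_indicator_gr_le (hd : d ≠ 0) {ν : Measure (ℕ → V d)} (h : IsWalk ν)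
    (z w : V d) (Q : Finset (V d)) {k : ℕ} {η K : ℝ≥0∞} (hη : ∀ y : V d, hk k y ≤ η)
    (hK : ∑ v ∈ Q, gr (w - v) ≤ K) :
    ∫⁻ s, (Q : Set (V d)).indicator (fun v => gr (w - v)) (pos z s k) ∂ν ≤ η * K := by
  classical
  rw [h.lintegral_pos hd, iter_avg_eq_tsum, tsum_eq_sum (s := Q)]
  · calc _ ≤ ∑ v ∈ Q, η * gr (w - v) := by
          refine Finset.sum_le_sum fun v hv => ?_
          rw [Set.indicator_of_mem (Finset.mem_coe.2 hv)]
          gcongr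
          exact hη _
      _ ≤ _ := by
          rw [← Finset.mul_sum]
          gcongr
  · intro v hv
    rw [Set.indicator_of_notMem (by simpa using hv), mul_zero]

/-- The energy added to a collection `X` of points by the walk from `z` during `[H, T)`. -/
noncomputable def blockEnergy {ι : Type*} (Q : Finset (V d)) (P : Finset ι) (X : ι → V d)
    (z : V d) (H T : ℕ) (s : ℕ → V d) : ℝ≥0∞ :=
  2 * ∑ k ∈ Finset.Ico H T, ∑ p ∈ P,
      (Q : Set (V d)).indicator (fun v => gr (X p - v)) (pos z s k) +
    ∑ k ∈ Finset.Ico H T, ∑ l ∈ Finset.Ico H T, gr (pos z s k - pos z s l)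

lemma IsWalk.lintegral_blockEnergy_le (hd : d ≠ 0) {ν : Measure (ℕ → V d)} (h : IsWalk ν)
    {ι : Type*} (Q : Finset (V d)) (P : Finset ι) (X : ι → V d) (z : V d) {H T : ℕ}
    {η K : ℝ≥0∞} (hη : ∀ k ∈ Finset.Ico H T, ∀ y : V d, hk k y ≤ η)
    (hK : ∀ w, ∑ v ∈ Q, gr (w - v) ≤ K) :
    ∫⁻ s, blockEnergy Q P X z H T s ∂ν
      ≤ 2 * (T * (P.card * (η * K))) + T * (2 * ∑' n, ((n + 1 : ℕ) : ℝ≥0∞) * hk n (0 : V d)) := by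
  have hmeas : ∀ k p, Measurable fun s : ℕ → V d =>
      (Q : Set (V d)).indicator (fun v => gr (X p - v)) (pos z s k) := fun k p =>
    (measurable_of_countable ((Q : Set (V d)).indicator fun v => gr (X p - v))).comp
      (measurable_pos z k)
  have hmeas' : Measurable fun s : ℕ → V d => ∑ k ∈ Finset.Ico H T, ∑ p ∈ P,
      (Q : Set (V d)).indicator (fun v => gr (X p - v)) (pos z s k) :=
    Finset.measurable_fun_sum _ fun k _ => Finset.measurable_fun_sum _ fun p _ => hmeas k p
  simp only [blockEnergy]
  rw [lintegral_add_left (hmeas'.const_mul 2), lintegral_const_mul _ hmeas']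
  refine add_le_add ?_ (h.lintegral_selfEnergy_le hd z H T)
  gcongr
  rw [lintegral_finsetSum _ fun k _ => Finset.measurable_fun_sum _ fun p _ => hmeas k p]
  calc _ ≤ ∑ k ∈ Finset.Ico H T, (P.card : ℝ≥0∞) * (η * K) := by
        refine Finset.sum_le_sum fun k hk => ?_
        rw [lintegral_finsetSum _ fun p _ => hmeas k p, ← nsmul_eq_mul]
        exact Finset.sum_le_card_nsmul _ _ _ fun p _ =>
          h.lintegral_indicator_gr_le hd z (X p) Q (hη k hk) (hK _)
    _ ≤ _ := by
        rw [Finset.sum_const, nsmul_eq_mul]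
        gcongr
        simp

end BlockEnergy

section BlockBound

variable {d : ℕ}

lemma exists_blockEnergy_le (hd : 5 ≤ d) : ∃ B : ℝ, 0 < B ∧ ∀ (ρ : ℕ), 1 ≤ ρ →
    ∀ (ν : Measure (ℕ → V d)), IsWalk ν → ∀ {ι : Type} (P : Finset ι) (X : ι → V d) (z : V d),
    P.card ≤ ρ ^ (d - 2) →
    ∫⁻ s, blockEnergy (box d (4 * ρ)) P X z (ρ ^ 2) (2 * ρ ^ 2) s ∂ν
      ≤ ENNReal.ofReal (B * (ρ : ℝ) ^ 2) := by
  have hd0 : d ≠ 0 := by omega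
  obtain ⟨C₁, hC₁, h₁⟩ := exists_hk_le (d := d) hd0
  obtain ⟨C₂, hC₂, h₂⟩ := exists_sum_gr_le (d := d) (by omega)
  obtain ⟨C₃, hC₃, h₃⟩ := exists_tsum_succ_mul_hk_le hd
  refine ⟨4 * (C₁ * (1 + 9 ^ d * C₂)) + 4 * C₃, by positivity, ?_⟩
  intro ρ hρ ν hν ι P X z hP
  obtain ⟨a, ha_def⟩ : ∃ a : ℝ, a = (ρ : ℝ) := ⟨_, rfl⟩
  have ha : 1 ≤ a := by
    rw [ha_def]
    exact_mod_cast hρ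
  have ha0 : 0 < a := by linarith
  rw [← ha_def]
  have hpow : ((ρ ^ 2 : ℕ) : ℝ) ^ (-(d : ℝ) / 2) = (a ^ d)⁻¹ := by
    push_cast
    rw [← ha_def, ← Real.rpow_natCast, ← Real.rpow_mul ha0.le, ← Real.rpow_natCast,
      ← Real.rpow_neg ha0.le]
    congr 1
    push_cast
    ring
  have hpow' : ((ρ ^ 2 : ℕ) : ℝ) ^ (1 - (d : ℝ) / 2) = a ^ 2 * (a ^ d)⁻¹ := by
    rw [← hpow, sub_eq_add_neg, Real.rpow_add (by positivity), Real.rpow_one,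
      neg_div]
    push_cast
    rw [ha_def]
  have hη : ∀ k ∈ Finset.Ico (ρ ^ 2) (2 * ρ ^ 2), ∀ y : V d,
      hk k y ≤ ENNReal.ofReal (C₁ * (a ^ d)⁻¹) := by
    intro k hk y
    have hk1 := (Finset.mem_Ico.1 hk).1
    have hpos : 0 < ρ ^ 2 := by positivity
    refine (h₁ k y (by omega)).trans (ENNReal.ofReal_le_ofReal ?_)
    rw [← hpow]
    refine mul_le_mul_of_nonneg_left ?_ hC₁.le
    refine Real.rpow_le_rpow_of_nonpos (by exact_mod_cast hpos) (by exact_mod_cast hk1) ?_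
    have : (0 : ℝ) ≤ d := Nat.cast_nonneg d
    linarith
  have hK : ∀ w : V d, ∑ v ∈ box d (4 * ρ), gr (w - v)
      ≤ ENNReal.ofReal ((1 + 9 ^ d * C₂) * a ^ 2) := by
    intro w
    refine (h₂ (box d (4 * ρ)) w (ρ ^ 2) (Nat.one_le_pow _ _ hρ)).trans ?_
    rw [hpow', card_box]
    calc ((ρ ^ 2 : ℕ) : ℝ≥0∞) + (((2 * (4 * ρ) + 1) ^ d : ℕ) : ℝ≥0∞)
          * ENNReal.ofReal (C₂ * (a ^ 2 * (a ^ d)⁻¹))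
        = ENNReal.ofReal (((ρ ^ 2 : ℕ) : ℝ) + (((2 * (4 * ρ) + 1) ^ d : ℕ) : ℝ)
          * (C₂ * (a ^ 2 * (a ^ d)⁻¹))) := by
          rw [ENNReal.ofReal_add (by positivity) (by positivity),
            ENNReal.ofReal_natCast, ENNReal.ofReal_mul (Nat.cast_nonneg _), ENNReal.ofReal_natCast]
      _ ≤ _ := by
          apply ENNReal.ofReal_le_ofReal
          push_cast
          rw [← ha_def]
          have h9 : (2 * (4 * a) + 1) ^ d ≤ 9 ^ d * a ^ d := by
            rw [← mul_pow]
            gcongr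
            linarith
          calc a ^ 2 + (2 * (4 * a) + 1) ^ d * (C₂ * (a ^ 2 * (a ^ d)⁻¹))
              ≤ a ^ 2 + (9 ^ d * a ^ d) * (C₂ * (a ^ 2 * (a ^ d)⁻¹)) := by gcongr
            _ = _ := by field_simp
  have hc : (P.card : ℝ≥0∞) * (ENNReal.ofReal (C₁ * (a ^ d)⁻¹)
      * ENNReal.ofReal ((1 + 9 ^ d * C₂) * a ^ 2)) ≤ ENNReal.ofReal (C₁ * (1 + 9 ^ d * C₂)) := by
    have hP' : (P.card : ℝ≥0∞) ≤ ENNReal.ofReal (a ^ (d - 2)) := by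
      rw [ha_def, ← Nat.cast_pow, ENNReal.ofReal_natCast]
      exact_mod_cast hP
    calc _ ≤ ENNReal.ofReal (a ^ (d - 2)) * (ENNReal.ofReal (C₁ * (a ^ d)⁻¹)
          * ENNReal.ofReal ((1 + 9 ^ d * C₂) * a ^ 2)) := by gcongr
      _ = _ := by
          rw [← ENNReal.ofReal_mul (by positivity), ← ENNReal.ofReal_mul (by positivity)]
          congr 1
          have : a ^ (d - 2) * a ^ 2 = a ^ d := by rw [← pow_add]; congr 1; omega
          rw [← this]
          field_simp
  refine (hν.lintegral_blockEnergy_le hd0 (box d (4 * ρ)) P X z hη hK).trans ?_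
  have hT : ((2 * ρ ^ 2 : ℕ) : ℝ≥0∞) = ENNReal.ofReal (2 * a ^ 2) := by
    rw [ha_def, ← ENNReal.ofReal_natCast]
    push_cast
    rfl
  rw [hT]
  calc _ ≤ ENNReal.ofReal 2 * (ENNReal.ofReal (2 * a ^ 2)
          * ENNReal.ofReal (C₁ * (1 + 9 ^ d * C₂)))
        + ENNReal.ofReal (2 * a ^ 2) * (ENNReal.ofReal 2 * ENNReal.ofReal C₃) := by
        rw [show ENNReal.ofReal 2 = 2 by simp]
        gcongr
        exact h₃ 0
    _ = _ := by
        rw [← ENNReal.ofReal_mul (by positivity), ← ENNReal.ofReal_mul (by positivity),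
          ← ENNReal.ofReal_mul (by positivity), ← ENNReal.ofReal_mul (by positivity),
          ← ENNReal.ofReal_add (by positivity) (by positivity)]
        congr 1
        ring

end BlockBound

section Blocks

variable {d : ℕ}

/-- Labels `(i, k)` of the second halves of the first `j` blocks of length `2 * ρ ^ 2`. -/
def blocks (ρ j : ℕ) : Finset (ℕ × ℕ) := Finset.range j ×ˢ Finset.Ico (ρ ^ 2) (2 * ρ ^ 2)

/-- The time labelled by a point of `blocks`. -/
def blockTime (ρ : ℕ) (p : ℕ × ℕ) : ℕ := p.1 * (2 * ρ ^ 2) + p.2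

lemma card_blocks (ρ j : ℕ) : (blocks ρ j).card = j * ρ ^ 2 := by
  rw [blocks, Finset.card_product, Finset.card_range, Nat.card_Ico]
  congr 1
  omega

lemma sum_blocks_succ (ρ j : ℕ) (f : ℕ × ℕ → ℝ≥0∞) :
    ∑ p ∈ blocks ρ (j + 1), f p =
      ∑ p ∈ blocks ρ j, f p + ∑ k ∈ Finset.Ico (ρ ^ 2) (2 * ρ ^ 2), f (j, k) := by
  rw [blocks, blocks, Finset.sum_product, Finset.sum_product, Finset.sum_range_succ]

lemma blockTime_le {ρ j : ℕ} {p : ℕ × ℕ} (hp : p ∈ blocks ρ j) :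
    blockTime ρ p ≤ j * (2 * ρ ^ 2) := by
  obtain ⟨h1, h2⟩ := Finset.mem_product.1 hp
  have h1 := Finset.mem_range.1 h1
  have h2 := (Finset.mem_Ico.1 h2).2
  calc blockTime ρ p ≤ p.1 * (2 * ρ ^ 2) + 2 * ρ ^ 2 := by
        rw [blockTime]
        omega
    _ = (p.1 + 1) * (2 * ρ ^ 2) := by ring
    _ ≤ _ := Nat.mul_le_mul_right _ h1

/-- The first `j` blocks stay in a box of size of order `ρ` and have small energy. -/
def goodBlocks (b : ℝ≥0∞) (ρ j : ℕ) : Set (ℕ → V d) :=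
  {s | pos 0 s (j * (2 * ρ ^ 2)) ∈ box d (2 * ρ)} ∩
    {s | ∀ p ∈ blocks ρ j, pos 0 s (blockTime ρ p) ∈ box d (4 * ρ)} ∩
    {s | ∑ q ∈ blocks ρ j, ∑ p ∈ blocks ρ j,
      gr (pos 0 s (blockTime ρ p) - pos 0 s (blockTime ρ q)) ≤ j * b}

lemma measurableSet_goodBlocks (b : ℝ≥0∞) (ρ j : ℕ) :
    MeasurableSet (goodBlocks b ρ j : Set (ℕ → V d)) := by
  refine ((measurable_pos 0 _ (Set.to_countable _).measurableSet).inter ?_).inter ?_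
  · have : {s : ℕ → V d | ∀ p ∈ blocks ρ j, pos 0 s (blockTime ρ p) ∈ box d (4 * ρ)}
        = ⋂ p ∈ blocks ρ j, {s | pos 0 s (blockTime ρ p) ∈ box d (4 * ρ)} := by
      ext s
      simp
    rw [this]
    exact Finset.measurableSet_biInter _ fun p _ =>
      measurable_pos 0 _ (Set.to_countable _).measurableSet
  · refine measurableSet_le (Finset.measurable_fun_sum _ fun q _ =>
      Finset.measurable_fun_sum _ fun p _ => ?_) measurable_const
    exact (measurable_of_countable gr).comp ((measurable_pos 0 _).sub (measurable_pos 0 _))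

lemma measurable_blockEnergy {ι : Type*} (Q : Finset (V d)) (P : Finset ι) (X : ι → V d)
    (z : V d) (H T : ℕ) : Measurable (blockEnergy Q P X z H T) := by
  refine Measurable.add (Measurable.const_mul (Finset.measurable_fun_sum _ fun k _ =>
    Finset.measurable_fun_sum _ fun p _ => ?_) 2) (Finset.measurable_fun_sum _ fun k _ =>
      Finset.measurable_fun_sum _ fun l _ => ?_)
  · exact (measurable_of_countable ((Q : Set (V d)).indicator fun v => gr (X p - v))).comp
      (measurable_pos z k)
  · exact (measurable_of_countable gr).comp ((measurable_pos z k).sub (measurable_pos z l))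

lemma sum_sum_gr_blocks_succ (ρ j : ℕ) (X : ℕ × ℕ → V d) (z : V d) (s : ℕ → V d)
    (Q : Finset (V d)) (hX : ∀ k, X (j, k) = pos z s k)
    (hQ : ∀ k ∈ Finset.Ico (ρ ^ 2) (2 * ρ ^ 2), pos z s k ∈ Q) :
    ∑ q ∈ blocks ρ (j + 1), ∑ p ∈ blocks ρ (j + 1), gr (X p - X q) =
      ∑ q ∈ blocks ρ j, ∑ p ∈ blocks ρ j, gr (X p - X q) +
        blockEnergy Q (blocks ρ j) X z (ρ ^ 2) (2 * ρ ^ 2) s := by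
  simp only [sum_blocks_succ, Finset.sum_add_distrib, hX, blockEnergy]
  have h1 : ∑ q ∈ blocks ρ j, ∑ k ∈ Finset.Ico (ρ ^ 2) (2 * ρ ^ 2), gr (pos z s k - X q)
      = ∑ k ∈ Finset.Ico (ρ ^ 2) (2 * ρ ^ 2), ∑ p ∈ blocks ρ j,
        (Q : Set (V d)).indicator (fun v => gr (X p - v)) (pos z s k) := by
    rw [Finset.sum_comm]
    refine Finset.sum_congr rfl fun k hk => Finset.sum_congr rfl fun p _ => ?_
    rw [Set.indicator_of_mem (Finset.mem_coe.2 (hQ k hk)), gr_sub_comm]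
  have h2 : ∑ k ∈ Finset.Ico (ρ ^ 2) (2 * ρ ^ 2), ∑ p ∈ blocks ρ j, gr (X p - pos z s k)
      = ∑ k ∈ Finset.Ico (ρ ^ 2) (2 * ρ ^ 2), ∑ p ∈ blocks ρ j,
        (Q : Set (V d)).indicator (fun v => gr (X p - v)) (pos z s k) := by
    refine Finset.sum_congr rfl fun k hk => Finset.sum_congr rfl fun p _ => ?_
    rw [Set.indicator_of_mem (Finset.mem_coe.2 (hQ k hk))]
  rw [h1, h2, Finset.sum_comm (f := fun k l => gr (pos z s k - pos z s l))]
  ring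

lemma pos_eq_add (z : V d) (s : ℕ → V d) (k : ℕ) : pos z s k = z + pos 0 s k := by
  simp [pos]

lemma concat_mem_goodBlocks {b : ℝ≥0∞} {ρ j : ℕ} {s s' : ℕ → V d} (hs : s ∈ goodBlocks b ρ j)
    (h1 : ∀ k ≤ 2 * ρ ^ 2, pos 0 s' k ∈ box d (2 * ρ))
    (h2 : ∀ i, pos 0 s' (2 * ρ ^ 2) i * pos 0 s (j * (2 * ρ ^ 2)) i ≤ 0)
    (h3 : blockEnergy (box d (4 * ρ)) (blocks ρ j) (fun p => pos 0 s (blockTime ρ p))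
      (pos 0 s (j * (2 * ρ ^ 2))) (ρ ^ 2) (2 * ρ ^ 2) s' ≤ b) :
    concat (j * (2 * ρ ^ 2)) s s' ∈ goodBlocks b ρ (j + 1) := by
  obtain ⟨⟨hs1, hs2⟩, hs3⟩ := hs
  set m := j * (2 * ρ ^ 2) with hm
  set z := pos 0 s m with hz
  have hY : ∀ k, pos 0 (concat m s s') (blockTime ρ (j, k)) = pos z s' k := fun k =>
    pos_concat_add 0 m k s s'
  have hX : ∀ p ∈ blocks ρ j,
      pos 0 (concat m s s') (blockTime ρ p) = pos 0 s (blockTime ρ p) := fun p hp =>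
    pos_concat_of_le 0 (blockTime_le hp) s s'
  have hbox : ∀ k ≤ 2 * ρ ^ 2, pos z s' k ∈ box d (4 * ρ) := by
    intro k hk
    rw [mem_box]
    intro i
    have e1 := mem_box.1 hs1 i
    have e2 := mem_box.1 (h1 k hk) i
    rw [pos_eq_add, Pi.add_apply]
    refine (abs_add_le _ _).trans ?_
    push_cast at e1 e2 ⊢
    linarith
  refine ⟨⟨?_, ?_⟩, ?_⟩
  · have : (j + 1) * (2 * ρ ^ 2) = m + 2 * ρ ^ 2 := by rw [hm]; ring
    rw [Set.mem_ofPred_eq, this, pos_concat_add, mem_box]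
    intro i
    have e1 := abs_le.1 (mem_box.1 hs1 i)
    have e2 := abs_le.1 (mem_box.1 (h1 _ le_rfl) i)
    have e3 := h2 i
    rw [pos_eq_add, Pi.add_apply, abs_le]
    rw [← hz] at e1 ⊢
    rcases lt_trichotomy (z i) 0 with hzi | hzi | hzi
    · have : 0 ≤ pos 0 s' (2 * ρ ^ 2) i := by
        by_contra hneg
        nlinarith [mul_pos_of_neg_of_neg (not_le.1 hneg) hzi]
      constructor <;> linarith [e1.1, e2.2]
    · rw [hzi, zero_add]
      exact e2
    · have : pos 0 s' (2 * ρ ^ 2) i ≤ 0 := by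
        by_contra hneg
        nlinarith [mul_pos (not_le.1 hneg) hzi]
      constructor <;> linarith [e1.2, e2.1]
  · rintro ⟨i, k⟩ hp
    obtain ⟨hi, hk⟩ := Finset.mem_product.1 hp
    rcases (Nat.lt_succ_iff_lt_or_eq.1 (Finset.mem_range.1 hi)) with h | h
    · have hp' : (i, k) ∈ blocks ρ j := Finset.mem_product.2 ⟨Finset.mem_range.2 h, hk⟩
      rw [hX _ hp']
      exact hs2 _ hp'
    · obtain rfl : i = j := h
      rw [hY]
      exact hbox k (Finset.mem_Ico.1 hk).2.le
  · rw [Set.mem_ofPred_eq, sum_sum_gr_blocks_succ ρ j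
      (fun p => pos 0 (concat m s s') (blockTime ρ p)) z s' (box d (4 * ρ)) hY
      fun k hk => hbox k (Finset.mem_Ico.1 hk).2.le]
    have e1 : ∑ q ∈ blocks ρ j, ∑ p ∈ blocks ρ j, gr (pos 0 (concat m s s') (blockTime ρ p) -
        pos 0 (concat m s s') (blockTime ρ q)) ≤ j * b := by
      refine le_trans (le_of_eq ?_) hs3
      exact Finset.sum_congr rfl fun q hq => Finset.sum_congr rfl fun p hp => by
        rw [hX p hp, hX q hq]
    have e2 : blockEnergy (box d (4 * ρ)) (blocks ρ j)
        (fun p => pos 0 (concat m s s') (blockTime ρ p)) z (ρ ^ 2) (2 * ρ ^ 2) s' ≤ b := by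
      refine le_trans (le_of_eq ?_) h3
      simp only [blockEnergy]
      congr 2
      exact Finset.sum_congr rfl fun k _ => Finset.sum_congr rfl fun p hp => by rw [hX p hp]
    refine (add_le_add e1 e2).trans (le_of_eq ?_)
    push_cast
    ring

lemma inv_two_pow_add_self (n : ℕ) :
    ((2 : ℝ≥0∞) ^ (n + 1))⁻¹ + ((2 : ℝ≥0∞) ^ (n + 1))⁻¹ = ((2 : ℝ≥0∞) ^ n)⁻¹ := by
  rw [← two_mul, pow_succ, ENNReal.mul_inv (by simp) (by simp), mul_comm, mul_assoc,
    ENNReal.inv_mul_cancel (by simp) (by simp), mul_one]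

lemma IsWalk.mul_measure_le_of_concat (hd : d ≠ 0) {ν : Measure (ℕ → V d)} (h : IsWalk ν) (m : ℕ)
    {S S' : Set (ℕ → V d)} (hS : MeasurableSet S) (hS' : MeasurableSet S') {c : ℝ≥0∞}
    (hc : ∀ s ∈ S, c ≤ ν (concat m s ⁻¹' S')) : c * ν S ≤ ν S' := by
  rw [← lintegral_indicator_one hS', h.lintegral_concat hd m (measurable_one.indicator hS'),
    ← lintegral_indicator_const hS]
  refine lintegral_mono fun s => ?_
  by_cases hs : s ∈ S
  · rw [Set.indicator_of_mem hs]
    have hpre : MeasurableSet (concat m s ⁻¹' S') :=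
      ((measurable_concat m).comp measurable_prodMk_left) hS'
    refine (hc s hs).trans (le_of_eq ?_)
    rw [← lintegral_indicator_one hpre]
    rfl
  · rw [Set.indicator_of_notMem hs]
    exact zero_le

lemma IsWalk.le_measure_preimage_concat_goodBlocks (hd : d ≠ 0) {ν : Measure (ℕ → V d)}
    (h : IsWalk ν) {b : ℝ≥0∞} {ρ j : ℕ} (hρ : 1 ≤ ρ) {s : ℕ → V d} (hs : s ∈ goodBlocks b ρ j)
    (hF : ν {s' | b ≤ blockEnergy (box d (4 * ρ)) (blocks ρ j)
      (fun p => pos 0 s (blockTime ρ p)) (pos 0 s (j * (2 * ρ ^ 2))) (ρ ^ 2) (2 * ρ ^ 2) s'}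
      ≤ ((2 : ℝ≥0∞) ^ (d + 2))⁻¹) :
    ((2 : ℝ≥0∞) ^ (d + 2))⁻¹
      ≤ ν (concat (j * (2 * ρ ^ 2)) s ⁻¹' goodBlocks b ρ (j + 1)) := by
  have hA := h.le_measure_confined hd (r := 2 * ρ) (n := 2 * ρ ^ 2) (by omega)
    (by ring_nf; exact le_rfl) (pos 0 s (j * (2 * ρ ^ 2)))
  have hfin : ((2 : ℝ≥0∞) ^ (d + 2))⁻¹ ≠ ∞ := by simp
  rw [← inv_two_pow_add_self] at hA
  refine (ENNReal.add_le_add_iff_right hfin).1 (hA.trans ?_)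
  refine le_trans (measure_mono fun s' hs' => ?_)
    ((measure_union_le _ _).trans (add_le_add le_rfl hF))
  rcases le_or_gt b (blockEnergy (box d (4 * ρ)) (blocks ρ j)
    (fun p => pos 0 s (blockTime ρ p)) (pos 0 s (j * (2 * ρ ^ 2))) (ρ ^ 2) (2 * ρ ^ 2) s')
    with hW | hW
  · exact Set.mem_union_right _ hW
  · rw [Set.mem_ofPred_eq] at hs'
    refine Set.mem_union_left _ (Set.mem_preimage.2 ?_)
    exact concat_mem_goodBlocks hs hs'.1 hs'.2 hW.le

lemma exists_le_measure_goodBlocks (hd : 5 ≤ d) : ∃ B : ℝ, 0 < B ∧ ∀ ν : Measure (ℕ → V d),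
    IsWalk ν → ∀ ρ : ℕ, 1 ≤ ρ → ∀ j ≤ ρ ^ (d - 4),
    (((2 : ℝ≥0∞) ^ (d + 2))⁻¹) ^ j ≤ ν (goodBlocks (ENNReal.ofReal (B * (ρ : ℝ) ^ 2)) ρ j) := by
  have hd0 : d ≠ 0 := by omega
  obtain ⟨B, hB, h⟩ := exists_blockEnergy_le hd
  refine ⟨B * 2 ^ (d + 2), by positivity, fun ν hν ρ hρ j => ?_⟩
  have hρ0 : (0 : ℝ) < ρ := by exact_mod_cast hρ
  have := hν.isProbabilityMeasure hd0
  obtain ⟨b, hb⟩ : ∃ b, b = ENNReal.ofReal (B * 2 ^ (d + 2) * (ρ : ℝ) ^ 2) := ⟨_, rfl⟩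
  have hb0 : b ≠ 0 := by
    rw [hb, ne_eq, ENNReal.ofReal_eq_zero, not_le]
    positivity
  have hb1 : b ≠ ∞ := hb ▸ ENNReal.ofReal_ne_top
  rw [← hb]
  induction j with
  | zero =>
    intro _
    have : (goodBlocks b ρ 0 : Set (ℕ → V d)) = Set.univ := by
      refine Set.eq_univ_of_forall fun s => ⟨⟨?_, ?_⟩, ?_⟩
      · rw [Set.mem_ofPred_eq, mem_box]
        intro i
        simp [pos]
      · simp [blocks]
      · simp [blocks]
    rw [this, measure_univ, pow_zero]
  | succ j ih =>
    intro hj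
    refine le_trans ?_ (le_trans (mul_le_mul_right (ih (by omega)) ((2 : ℝ≥0∞) ^ (d + 2))⁻¹) ?_)
    · rw [pow_succ, mul_comm]
    refine hν.mul_measure_le_of_concat hd0 _ (measurableSet_goodBlocks b ρ j)
      (measurableSet_goodBlocks b ρ (j + 1)) fun s hs =>
        hν.le_measure_preimage_concat_goodBlocks hd0 hρ hs ?_
    have hcard : (blocks ρ j).card ≤ ρ ^ (d - 2) := by
      rw [card_blocks, show d - 2 = (d - 4) + 2 by omega, pow_add]
      exact Nat.mul_le_mul_right _ (by omega)
    refine (meas_ge_le_lintegral_div (measurable_blockEnergy _ _ _ _ _ _).aemeasurable hb0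
      hb1).trans ?_
    refine (ENNReal.div_le_div_right (h ρ hρ ν hν _ _ _ hcard) b).trans (le_of_eq ?_)
    rw [hb, ← ENNReal.ofReal_div_of_pos (by positivity),
      show B * (ρ : ℝ) ^ 2 / (B * 2 ^ (d + 2) * (ρ : ℝ) ^ 2) = (2 ^ (d + 2))⁻¹ by field_simp,
      ENNReal.ofReal_inv_of_pos (by positivity), ENNReal.ofReal_pow (by norm_num)]
    simp

end Blocks

section Lower

variable {d : ℕ}

lemma exists_le_gr_of_mem_box (hd : 5 ≤ d) : ∃ c : ℝ, 0 < c ∧ ∀ ρ : ℕ, 1 ≤ ρ →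
    ∀ x ∈ box d (4 * ρ), ∀ y ∈ box d (4 * ρ),
      ENNReal.ofReal (c * ((ρ : ℝ) ^ (d - 2))⁻¹) ≤ gr (x - y) := by
  obtain ⟨c, hc, h⟩ := exists_le_gr hd
  have hd1 : (0 : ℝ) < d := by exact_mod_cast (by omega : 0 < d)
  refine ⟨c * (65 * d : ℝ) ^ (-(((d : ℝ) - 2) / 2)), by positivity, fun ρ hρ x hx y hy => ?_⟩
  refine le_trans (ENNReal.ofReal_le_ofReal ?_) (h (x - y))
  have ha : (1 : ℝ) ≤ ρ := by exact_mod_cast hρ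
  have hn : nsq (x - y) ≤ 64 * d * (ρ : ℝ) ^ 2 := by
    have hi : ∀ i ∈ Finset.univ, (((x - y) i : ℤ) : ℝ) ^ 2 ≤ 64 * (ρ : ℝ) ^ 2 := by
      intro i _
      have e1 := mem_box.1 hx i
      have e2 := mem_box.1 hy i
      have e3 : |(x - y) i| ≤ 8 * ρ := by
        rw [Pi.sub_apply]
        refine (abs_sub _ _).trans ?_
        push_cast at e1 e2 ⊢
        linarith
      have e4 : |(((x - y) i : ℤ) : ℝ)| ≤ 8 * ρ := by exact_mod_cast e3
      calc (((x - y) i : ℤ) : ℝ) ^ 2 = |(((x - y) i : ℤ) : ℝ)| ^ 2 := (sq_abs _).symm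
        _ ≤ (8 * ρ) ^ 2 := by gcongr
        _ = _ := by ring
    refine (Finset.sum_le_card_nsmul _ _ _ hi).trans (le_of_eq ?_)
    rw [Finset.card_univ, Fintype.card_fin, nsmul_eq_mul]
    ring
  have hd2 : (5 : ℝ) ≤ d := by exact_mod_cast hd
  have hle : 1 + nsq (x - y) ≤ 65 * d * (ρ : ℝ) ^ 2 := by nlinarith
  have hpow : ((ρ : ℝ) ^ (d - 2))⁻¹ = ((ρ : ℝ) ^ 2) ^ (-(((d : ℝ) - 2) / 2)) := by
    rw [← Real.rpow_natCast, ← Real.rpow_natCast, ← Real.rpow_mul (by positivity),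
      ← Real.rpow_neg (by positivity), Nat.cast_sub (by omega)]
    congr 1
    push_cast
    ring
  rw [hpow, mul_assoc, ← Real.mul_rpow (by positivity) (by positivity)]
  refine mul_le_mul_of_nonneg_left ?_ hc.le
  refine Real.rpow_le_rpow_of_nonpos ?_ hle (by linarith)
  linarith [nsq_nonneg (x - y)]

lemma exists_le_gammaInf_of_goodBlocks (hd : 5 ≤ d) {B : ℝ} (hB : 0 < B) :
    ∃ c : ℝ, 0 < c ∧ ∀ ρ : ℕ, 1 ≤ ρ →
    ∀ sA ∈ goodBlocks (ENNReal.ofReal (B * (ρ : ℝ) ^ 2)) ρ (ρ ^ (d - 4)),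
    ∀ sB ∈ goodBlocks (ENNReal.ofReal (B * (ρ : ℝ) ^ 2)) ρ (ρ ^ (d - 4)),
    (∀ x : V d, green ((Set.range (pos (0 : V d) sB)).indicator 1) x ≠ ∞) →
      ENNReal.ofReal (c * (ρ : ℝ) ^ (d - 2)) ≤ gammaInf d sA sB := by
  obtain ⟨c, hc, h⟩ := exists_le_gr_of_mem_box hd
  refine ⟨c / (16 * B ^ 2), by positivity, ?_⟩
  rintro ρ hρ sA ⟨⟨-, hA2⟩, hA3⟩ sB ⟨⟨-, hB2⟩, hB3⟩ hfin
  have ha : (0 : ℝ) < ρ := by exact_mod_cast hρ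
  have hcard : (blocks ρ (ρ ^ (d - 4))).card = ρ ^ (d - 2) := by
    rw [card_blocks, ← pow_add]
    congr 1
    omega
  have hb : ((ρ ^ (d - 4) : ℕ) : ℝ≥0∞) * ENNReal.ofReal (B * (ρ : ℝ) ^ 2)
      = ENNReal.ofReal B * (blocks ρ (ρ ^ (d - 4))).card := by
    rw [card_blocks, ENNReal.ofReal_mul hB.le, ENNReal.ofReal_pow ha.le, ENNReal.ofReal_natCast]
    push_cast
    ring
  have key := card_sq_mul_le_gammaInf hd (blocks ρ (ρ ^ (d - 4))) (blockTime ρ) sA sB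
    (B := ENNReal.ofReal B) (g := ENNReal.ofReal (c * ((ρ : ℝ) ^ (d - 2))⁻¹))
    (by rw [ne_eq, ENNReal.ofReal_eq_zero, not_le]; exact hB) ENNReal.ofReal_ne_top hfin
    (hb ▸ hA3) (hb ▸ hB3) fun p hp q hq => h ρ hρ _ (hB2 p hp) _ (hA2 q hq)
  have e1 : ((blocks ρ (ρ ^ (d - 4))).card : ℝ≥0∞) ^ 2
      * ENNReal.ofReal (c * ((ρ : ℝ) ^ (d - 2))⁻¹) = ENNReal.ofReal (c * (ρ : ℝ) ^ (d - 2)) := by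
    rw [hcard, ← ENNReal.ofReal_natCast, ← ENNReal.ofReal_pow (by positivity),
      ← ENNReal.ofReal_mul (by positivity)]
    congr 1
    push_cast
    field_simp
  have e2 : 16 * ENNReal.ofReal B ^ 2 = ENNReal.ofReal (16 * B ^ 2) := by
    rw [ENNReal.ofReal_mul (by norm_num), ENNReal.ofReal_pow hB.le]
    norm_num
  rw [e1, e2] at key
  have := ENNReal.div_le_of_le_mul' key
  rw [← ENNReal.ofReal_div_of_pos (by positivity)] at this
  refine le_trans (le_of_eq ?_) this
  congr 1
  ring

lemma IsWalk.exists_sq_le_measure_gammaInf (hd : 5 ≤ d) : ∃ c : ℝ, 0 < c ∧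
    ∀ ν : Measure (ℕ → V d), IsWalk ν → ∀ ρ : ℕ, 1 ≤ ρ →
    ((((2 : ℝ≥0∞) ^ (d + 2))⁻¹) ^ (ρ ^ (d - 4))) ^ 2
      ≤ (ν.prod ν) {p | ENNReal.ofReal (c * (ρ : ℝ) ^ (d - 2)) ≤ gammaInf d p.1 p.2} := by
  obtain ⟨B, hB, h⟩ := exists_le_measure_goodBlocks hd
  obtain ⟨c, hc, h'⟩ := exists_le_gammaInf_of_goodBlocks hd hB
  refine ⟨c, hc, fun ν hν ρ hρ => ?_⟩
  have := hν.isProbabilityMeasure (by omega : d ≠ 0)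
  set S : Set (ℕ → V d) := goodBlocks (ENNReal.ofReal (B * (ρ : ℝ) ^ 2)) ρ (ρ ^ (d - 4))
  set S' : Set (ℕ → V d) :=
    {s | ∀ x : V d, green ((Set.range (pos (0 : V d) s)).indicator 1) x ≠ ∞}
  have h1 : (((2 : ℝ≥0∞) ^ (d + 2))⁻¹) ^ (ρ ^ (d - 4)) ≤ ν (S ∩ S') := by
    refine (h ν hν ρ hρ _ le_rfl).trans (measure_mono_ae ?_)
    filter_upwards [hν.ae_green_range_ne_top hd] with s hs hsS
    exact ⟨hsS, hs⟩
  calc _ ≤ ν (S ∩ S') ^ 2 := by gcongr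
    _ = (ν.prod ν) ((S ∩ S') ×ˢ (S ∩ S')) := by rw [Measure.prod_prod, sq]
    _ ≤ _ := measure_mono fun p hp =>
        h' ρ hρ p.1 hp.1.1 p.2 hp.2.1 hp.2.2

lemma exists_natCeil_rpow_pow_le (hd : 5 ≤ d) {c : ℝ} (hc : 0 < c) : ∃ K : ℝ, 0 < K ∧
    ∀ t : ℝ, c ≤ t → ∃ ρ : ℕ, 1 ≤ ρ ∧ t < c * (ρ : ℝ) ^ (d - 2) ∧
      ((ρ ^ (d - 4) : ℕ) : ℝ) ≤ K * t ^ (1 - 2 / ((d : ℝ) - 2)) := by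
  have hd' : (5 : ℝ) ≤ d := by exact_mod_cast hd
  set e : ℝ := 1 - 2 / ((d : ℝ) - 2) with he
  refine ⟨2 ^ (d - 4) * (2 / c) ^ e, by positivity, fun t ht => ?_⟩
  have ht0 : 0 < t := hc.trans_le ht
  have hone : 1 ≤ 2 / c * t := by
    rw [div_mul_eq_mul_div, le_div_iff₀ hc]
    linarith
  set u : ℝ := (2 / c * t) ^ (1 / ((d : ℝ) - 2)) with hu
  have hu1 : 1 ≤ u := Real.one_le_rpow hone (by apply div_nonneg <;> linarith)
  have hpow : u ^ (d - 2) = 2 / c * t := by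
    rw [← Real.rpow_natCast, hu, ← Real.rpow_mul (by positivity), Nat.cast_sub (by omega)]
    push_cast
    rw [one_div_mul_cancel (by linarith), Real.rpow_one]
  have hpow' : u ^ (d - 4) = (2 / c) ^ e * t ^ e := by
    rw [← Real.rpow_natCast, hu, ← Real.rpow_mul (by positivity), Nat.cast_sub (by omega),
      ← Real.mul_rpow (by positivity) ht0.le]
    congr 1
    have : (d : ℝ) - 2 ≠ 0 := by linarith
    rw [he]
    push_cast
    field_simp
    ring
  refine ⟨⌈u⌉₊, Nat.one_le_ceil_iff.2 (by linarith), ?_, ?_⟩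
  · calc t < c * (2 / c * t) := by
          rw [← mul_assoc, mul_div_cancel₀ _ hc.ne']
          linarith
      _ = c * u ^ (d - 2) := by rw [hpow]
      _ ≤ _ := by
          gcongr
          exact Nat.le_ceil u
  · have hle : ((⌈u⌉₊ : ℕ) : ℝ) ≤ 2 * u := by
      linarith [(Nat.ceil_lt_add_one (by linarith : (0 : ℝ) ≤ u)).le]
    push_cast
    calc ((⌈u⌉₊ : ℕ) : ℝ) ^ (d - 4) ≤ (2 * u) ^ (d - 4) := by gcongr
      _ = _ := by rw [mul_pow, hpow', mul_assoc]

theorem exists_gammaInf_lower (hd : 5 ≤ d) : ∃ c : ℝ, 0 < c ∧ ∃ t₀ : ℝ, ∀ t : ℝ, t₀ ≤ t →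
    ∀ ν : Measure (ℕ → V d), IsWalk ν →
      ENNReal.ofReal (Real.exp (-c * t ^ (1 - 2 / ((d : ℝ) - 2)))) ≤
        (ν.prod ν) {p | ENNReal.ofReal t < gammaInf d p.1 p.2} := by
  obtain ⟨c, hc, h⟩ := IsWalk.exists_sq_le_measure_gammaInf hd
  obtain ⟨K, hK, h'⟩ := exists_natCeil_rpow_pow_le hd hc
  have hlog : 0 < Real.log 2 := Real.log_pos (by norm_num)
  refine ⟨2 * (d + 2) * Real.log 2 * K, by positivity, c, fun t ht ν hν => ?_⟩
  obtain ⟨ρ, hρ, htρ, hN⟩ := h' t ht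
  refine le_trans ?_ ((h ν hν ρ hρ).trans (measure_mono fun p hp => ?_))
  · have : ((((2 : ℝ≥0∞) ^ (d + 2))⁻¹) ^ (ρ ^ (d - 4))) ^ 2 = ENNReal.ofReal
        (Real.exp (-(2 * (d + 2) * Real.log 2 * ((ρ ^ (d - 4) : ℕ) : ℝ)))) := by
      have h2 : ((2 : ℝ≥0∞) ^ (d + 2))⁻¹ = ENNReal.ofReal ((2 ^ (d + 2))⁻¹) := by
        rw [ENNReal.ofReal_inv_of_pos (by positivity), ENNReal.ofReal_pow (by norm_num)]
        norm_num
      have h3 : ((2 : ℝ) ^ (d + 2))⁻¹ = Real.exp (-((d + 2) * Real.log 2)) := by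
        rw [Real.exp_neg, ← Real.exp_log (by positivity : (0 : ℝ) < 2 ^ (d + 2)), Real.log_pow]
        push_cast
        rfl
      rw [h2, ← ENNReal.ofReal_pow (by positivity), ← ENNReal.ofReal_pow (by positivity), h3,
        ← Real.exp_nat_mul, ← Real.exp_nat_mul]
      congr 2
      push_cast
      ring
    rw [this]
    refine ENNReal.ofReal_le_ofReal (Real.exp_le_exp.2 ?_)
    rw [neg_mul, neg_le_neg_iff, mul_assoc _ K]
    gcongr
  · rw [Set.mem_ofPred_eq] at hp ⊢
    refine lt_of_lt_of_le ?_ hp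
    have : (0 : ℝ) < ρ := by exact_mod_cast hρ
    exact (ENNReal.ofReal_lt_ofReal_iff (by positivity)).2 htρ

end Lower

/-- Tail estimate for `Γ(R̃_∞, R_∞)` for two independent simple random walks in
`d ≥ 7`: `exp(-c₁ t^{1-2/(d-2)}) ≤ P(Γ(R̃_∞, R_∞) > t) ≤ exp(-c₂ t^{1-2/(d-2)})`
for all large `t`. The joint law `μ` of the two independent walks (i.e. of the
pair of step sequences) is characterized by its finite-dimensional marginals. -/
theorem gammaInf_tail {d : ℕ} (hd : 7 ≤ d)
    (μ : Measure ((ℕ → V d) × (ℕ → V d))) [IsProbabilityMeasure μ]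
    (hμ : ∀ n : ℕ,
      μ.map (fun p => ((fun i : Fin n => p.1 i.val, fun i : Fin n => p.2 i.val) :
        (Fin n → V d) × (Fin n → V d))) = pairLevel d n) :
    ∃ c₁ c₂ : ℝ, 0 < c₁ ∧ 0 < c₂ ∧ ∃ t₀ : ℝ, ∀ t : ℝ, t₀ ≤ t →
      Real.exp (-c₁ * t ^ (1 - 2 / ((d : ℝ) - 2))) ≤
          (μ {p | ENNReal.ofReal t < gammaInf d p.1 p.2}).toReal ∧
        (μ {p | ENNReal.ofReal t < gammaInf d p.1 p.2}).toReal ≤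
          Real.exp (-c₂ * t ^ (1 - 2 / ((d : ℝ) - 2))) := by
  have hd0 : d ≠ 0 := by omega
  have hν : IsWalk (μ.map Prod.fst) := isWalk_fst hd0 hμ
  have := hν.isProbabilityMeasure hd0
  have hprod : μ = (μ.map Prod.fst).prod (μ.map Prod.fst) := eq_prod hd0 hμ
  obtain ⟨c₁, hc₁, t₁, h₁⟩ := exists_gammaInf_lower (d := d) (by omega)
  obtain ⟨c₂, hc₂, t₂, h₂⟩ := exists_gammaInf_upper hd
  refine ⟨c₁, c₂, hc₁, hc₂, max t₁ t₂, fun t ht => ⟨?_, ?_⟩⟩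
  · have h := h₁ t ((le_max_left _ _).trans ht) _ hν
    rw [← hprod] at h
    exact (ENNReal.ofReal_le_iff_le_toReal (measure_ne_top μ _)).1 h
  · have h := h₂ t ((le_max_right _ _).trans ht) _ hν
    rw [← hprod] at h
    exact ENNReal.toReal_le_of_le_ofReal (Real.exp_nonneg _) h

end SRW
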